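/- Let G be a finite group acting freely by homeomorphisms on a Hausdorff topological space X such that the quotient map X → X/G is a covering map and X/G is homeomorphic to ℂ ∖ F for a finite subset F ⊆ ℂ (a sphere with at least one puncture). Regard Conf^G_n(X) as a subspace of X^n, and for a ≤ n let W_{n−a} = (Fin (n−a) → G) ⋊ Equiv.Perm (Fin (n−a)) act on Conf^G_n(X) through the first n − a coordinates (labels act coordinatewise, permutations permute the first n − a coordinates). Then for every a ≥ 0 there is a real polynomial p such that for all n ≥ a and all i ≥ 0, the dimension of the subspace of H_i(Conf^G_n(X); ℚ) fixed by all maps induced by the W_{n−a}-action is at most p(i); in fact there is a constant C with this dimension at most C · (1 + i)^{|F| + a − 1} whenever |F| + a ≥ 1. -/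

import Mathlib

open CategoryTheory AlgebraicTopology

/-- The `i`-th singular homology with rational coefficients, as a functor
`TopCat ⥤ ModuleCat ℚ`. -/
noncomputable def singularHomologyFunctor (i : ℕ) : TopCat.{0} ⥤ ModuleCat.{0} ℚ :=
  TopCat.toSSet ⋙ ((SimplicialObject.whiskering _ _).obj (ModuleCat.free ℚ)) ⋙
    alternatingFaceMapComplex _ ⋙ HomologicalComplex.homologyFunctor _ _ i

section OrbitConfig

variable (G X : Type) [Group G] [MulAction G X] [TopologicalSpace X]

/-- The orbit configuration space `Conf^G_n(X)`, as a subspace of `X^n`. -/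
def orbitConfigSp (n : ℕ) : Type :=
  {x : Fin n → X | ∀ i j, i ≠ j → ∀ g : G, x i ≠ g • x j}

instance (n : ℕ) : TopologicalSpace (orbitConfigSp G X n) :=
  inferInstanceAs (TopologicalSpace {x : Fin n → X | _})

variable {G X}

/-- The action of `(g⃗, σ) ∈ W_{n−a} = (Fin (n−a) → G) ⋊ Equiv.Perm (Fin (n−a))`
on `X^n` through the first `n − a` coordinates: labels act coordinatewise and
permutations permute the first `n − a` coordinates. -/
def wAct {n a : ℕ} (p : (Fin (n - a) → G) × Equiv.Perm (Fin (n - a)))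
    (x : Fin n → X) : Fin n → X := fun k =>
  if h : (k : ℕ) < n - a then
    p.1 ⟨k, h⟩ • x (Fin.castLE (Nat.sub_le n a) (p.2⁻¹ ⟨(k : ℕ), h⟩))
  else x k

end OrbitConfig



set_option linter.all false

namespace OC

/-! ### Affine tuples -/

abbrev L (n : ℕ) (S : Type) := (Fin n → S) →₀ ℚ

noncomputable abbrev sg {T : Type} (v : T) : T →₀ ℚ := Finsupp.single v 1

theorem lext {T M : Type} [AddCommGroup M] [Module ℚ M] {f g : (T →₀ ℚ) →ₗ[ℚ] M}
    (h : ∀ v, f (sg v) = g (sg v)) : f = g :=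
  Finsupp.lhom_ext' fun v => LinearMap.ext_ring (h v)

/-- linear extension -/
noncomputable def lex {T M : Type} [AddCommGroup M] [Module ℚ M] (f : T → M) :
    (T →₀ ℚ) →ₗ[ℚ] M := Finsupp.linearCombination ℚ f

theorem lex_sg {T M : Type} [AddCommGroup M] [Module ℚ M] (f : T → M) (v : T) :
    lex f (sg v) = f v := by simp [lex]

/-- pushforward -/
noncomputable def pf {T T' : Type} (f : T → T') : (T →₀ ℚ) →ₗ[ℚ] (T' →₀ ℚ) :=
  Finsupp.lmapDomain ℚ ℚ f

theorem pf_sg {T T' : Type} (f : T → T') (v : T) : pf f (sg v) = sg (f v) := by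
  simp [pf, Finsupp.mapDomain_single]

theorem pf_pf {T T' T'' : Type} (g : T' → T'') (f : T → T') (c : T →₀ ℚ) :
    pf g (pf f c) = pf (g ∘ f) c := by
  simp [pf, Finsupp.mapDomain_comp]

theorem pf_id {T : Type} (c : T →₀ ℚ) : pf id c = c := by simp [pf]

/-- pushforward of tuples -/
noncomputable abbrev tp {S S' : Type} (f : S → S') (n : ℕ) : L n S →ₗ[ℚ] L n S' :=
  pf (fun v : Fin n → S => f ∘ v)

noncomputable def lb {S : Type} (n : ℕ) : L (n + 1) S →ₗ[ℚ] L n S :=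
  lex fun v => ∑ j : Fin (n + 1), (-1 : ℚ) ^ (j : ℕ) • sg (v ∘ j.succAbove)

theorem lb_sg {S : Type} {n : ℕ} (v : Fin (n + 1) → S) :
    lb n (sg v) = ∑ j : Fin (n + 1), (-1 : ℚ) ^ (j : ℕ) • sg (v ∘ j.succAbove) := lex_sg _ _

noncomputable def cone {S : Type} {n : ℕ} (b : S) : L n S →ₗ[ℚ] L (n + 1) S :=
  pf (fun v => (Fin.cons b v : Fin (n + 1) → S))

theorem lb_cone0 {S : Type} (b : S) (c : L 0 S) : lb 0 (cone b c) = c := by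
  refine LinearMap.congr_fun (f := lb 0 ∘ₗ cone b) (g := LinearMap.id) (lext fun v => ?_) c
  simp only [LinearMap.comp_apply, cone, pf_sg, lb_sg]
  simp only [Finset.univ_unique, Finset.sum_singleton, LinearMap.id_apply]
  simp [Subsingleton.elim (_ : Fin 0 → S) v]

theorem lb_cone {S : Type} {n : ℕ} (b : S) (c : L (n + 1) S) :
    lb (n + 1) (cone b c) = c - cone b (lb n c) := by
  refine LinearMap.congr_fun (f := lb (n + 1) ∘ₗ cone b) (g := LinearMap.id - cone b ∘ₗ lb n)
    (lext fun v => ?_) c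
  simp only [LinearMap.comp_apply, LinearMap.sub_apply, cone, pf_sg, lb_sg, LinearMap.id_apply]
  rw [Fin.sum_univ_succ, sub_eq_add_neg, map_sum, ← Finset.sum_neg_distrib]
  congr 1
  · have : (Fin.cons b v : Fin (n + 1 + 1) → S) ∘ (0 : Fin (n + 1 + 1)).succAbove = v := by
      ext i; simp
    simp [this]
  · refine Finset.sum_congr rfl fun j _ => ?_
    have : (Fin.cons b v : Fin (n + 1 + 1) → S) ∘ j.succ.succAbove
        = Fin.cons b (v ∘ j.succAbove) := by
      ext i
      refine Fin.cases ?_ (fun i => ?_) i <;> simp [Fin.succ_succAbove_succ]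
    rw [this, map_smul, pf_sg, Fin.val_succ, pow_succ]
    simp

theorem tp_lb {S S' : Type} (f : S → S') {n : ℕ} (c : L (n + 1) S) :
    tp f n (lb n c) = lb n (tp f (n + 1) c) := by
  refine LinearMap.congr_fun (f := tp f n ∘ₗ lb n) (g := lb n ∘ₗ tp f (n + 1))
    (lext fun v => ?_) c
  simp only [LinearMap.comp_apply, lb_sg, pf_sg, map_sum, map_smul]
  rfl

theorem tp_cone {S S' : Type} (f : S → S') {n : ℕ} (b : S) (c : L n S) :
    tp f (n + 1) (cone b c) = cone (f b) (tp f n c) := by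
  simp only [cone, pf_pf]
  congr 1; congr 1; ext v i
  refine Fin.cases ?_ (fun i => ?_) i <;> simp

theorem lb_lb {S : Type} : ∀ (n : ℕ) (c : L (n + 2) S), lb n (lb (n + 1) c) = 0 := by
  intro n
  induction n with
  | zero =>
    refine LinearMap.congr_fun (f := lb 0 ∘ₗ lb 1) (g := 0) (lext fun v => ?_)
    have : sg v = cone (v 0) (sg (Fin.tail v)) := by simp [cone, pf_sg]
    rw [LinearMap.comp_apply, this, lb_cone, map_sub, lb_cone0]; simp
  | succ n ih =>
    refine LinearMap.congr_fun (f := lb (n + 1) ∘ₗ lb (n + 2)) (g := 0) (lext fun v => ?_)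
    have : sg v = cone (v 0) (sg (Fin.tail v)) := by simp [cone, pf_sg]
    rw [LinearMap.comp_apply, this, lb_cone, map_sub, lb_cone, ih]; simp

/-- cone homotopy -/
noncomputable def hop {S S' : Type} (φ ψ : ∀ n, L n S →ₗ[ℚ] L n S')
    (b : ∀ n, (Fin (n + 1) → S) → S') : ∀ n, L n S →ₗ[ℚ] L (n + 1) S'
  | 0 => 0
  | n + 1 => lex fun v =>
      cone (b n v) (φ (n + 1) (sg v) - ψ (n + 1) (sg v) - hop φ ψ b n (lb n (sg v)))

theorem hop_sg {S S' : Type} (φ ψ : ∀ n, L n S →ₗ[ℚ] L n S')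
    (b : ∀ n, (Fin (n + 1) → S) → S') (n : ℕ) (v : Fin (n + 1) → S) :
    hop φ ψ b (n + 1) (sg v) =
      cone (b n v) (φ (n + 1) (sg v) - ψ (n + 1) (sg v) - hop φ ψ b n (lb n (sg v))) :=
  lex_sg _ _

theorem lb_hop {S S' : Type} (φ ψ : ∀ n, L n S →ₗ[ℚ] L n S')
    (b : ∀ n, (Fin (n + 1) → S) → S') (h0 : φ 0 = ψ 0)
    (hφ : ∀ n c, lb n (φ (n + 1) c) = φ n (lb n c))
    (hψ : ∀ n c, lb n (ψ (n + 1) c) = ψ n (lb n c)) :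
    ∀ n c, lb (n + 1) (hop φ ψ b (n + 1) c) + hop φ ψ b n (lb n c)
      = φ (n + 1) c - ψ (n + 1) c := by
  intro n
  induction n with
  | zero =>
    refine LinearMap.congr_fun (f := lb 1 ∘ₗ hop φ ψ b 1 + hop φ ψ b 0 ∘ₗ lb 0)
      (g := φ 1 - ψ 1) (lext fun v => ?_)
    simp only [LinearMap.add_apply, LinearMap.comp_apply, LinearMap.sub_apply, hop_sg, lb_cone,
      map_sub, hφ, hψ, h0]
    simp [hop]
  | succ n ih =>
    refine LinearMap.congr_fun
      (f := lb (n + 2) ∘ₗ hop φ ψ b (n + 2) + hop φ ψ b (n + 1) ∘ₗ lb (n + 1))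
      (g := φ (n + 2) - ψ (n + 2)) (lext fun v => ?_)
    have h2 := ih (lb (n + 1) (sg v))
    rw [lb_lb, map_zero, add_zero] at h2
    simp only [LinearMap.add_apply, LinearMap.comp_apply, LinearMap.sub_apply, hop_sg, lb_cone]
    rw [map_sub (lb _), map_sub (lb _), hφ, hψ, h2]
    simp

theorem tp_hop {S S' Q Q' : Type} (φ ψ : ∀ n, L n S →ₗ[ℚ] L n S')
    (b : ∀ n, (Fin (n + 1) → S) → S') (φ' ψ' : ∀ n, L n Q →ₗ[ℚ] L n Q')
    (b' : ∀ n, (Fin (n + 1) → Q) → Q') (f : S → Q) (g : S' → Q')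
    (hφ : ∀ n c, tp g n (φ n c) = φ' n (tp f n c)) (hψ : ∀ n c, tp g n (ψ n c) = ψ' n (tp f n c))
    (hb : ∀ n v, g (b n v) = b' n (f ∘ v)) :
    ∀ n c, tp g (n + 1) (hop φ ψ b n c) = hop φ' ψ' b' n (tp f n c) := by
  intro n
  induction n with
  | zero => intro c; simp [hop]
  | succ n ih =>
    refine LinearMap.congr_fun (f := tp g (n + 2) ∘ₗ hop φ ψ b (n + 1))
      (g := hop φ' ψ' b' (n + 1) ∘ₗ tp f (n + 1)) (lext fun v => ?_)
    simp only [LinearMap.comp_apply, hop_sg, pf_sg, tp_cone]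
    rw [map_sub (tp g _), map_sub (tp g _), hφ, hψ, ih, hb, pf_sg, tp_lb, pf_sg]

/-! ### Convex spaces -/

abbrev Dl (n : ℕ) : Type := stdSimplex ℝ (Fin n)

noncomputable def affK {E : Type} [AddCommGroup E] [Module ℝ E] [TopologicalSpace E]
    [IsTopologicalAddGroup E] [ContinuousSMul ℝ E] (K : Set E) (hK : Convex ℝ K) {n : ℕ}
    (v : Fin n → K) : C(Dl n, K) where
  toFun t := ⟨∑ i, t i • (v i : E), hK.sum_mem (fun i _ => t.2.1 i) t.2.2
    (fun i _ => (v i).2)⟩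
  continuous_toFun := by
    refine Continuous.subtype_mk (continuous_finsetSum _ fun i _ => ?_) _
    exact ((continuous_apply i).comp continuous_subtype_val).smul continuous_const

noncomputable abbrev affD {m n : ℕ} (w : Fin n → Dl m) : C(Dl n, Dl m) :=
  affK _ (convex_stdSimplex ℝ (Fin m)) w

theorem affD_apply {m n : ℕ} (w : Fin n → Dl m) (t : Dl n) (k : Fin m) :
    affD w t k = ∑ i, t i * w i k := by
  change (∑ i, t i • ((w i : Dl m) : Fin m → ℝ)) k = _
  simp [Finset.sum_apply]

class Cvx (S : Type) [TopologicalSpace S] where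
  aff : ∀ {n : ℕ}, (Fin n → S) → C(Dl n, S)
  aff_vert : ∀ {n : ℕ} (v : Fin n → S) (i : Fin n), aff v (stdSimplex.vertex i) = v i
  aff_comp : ∀ {m n : ℕ} (v : Fin m → S) (w : Fin n → Dl m) (t : Dl n),
    aff v (affD w t) = aff (fun k => aff v (w k)) t

noncomputable def cvxK {E : Type} [AddCommGroup E] [Module ℝ E] [TopologicalSpace E]
    [IsTopologicalAddGroup E] [ContinuousSMul ℝ E] (K : Set E) (hK : Convex ℝ K) : Cvx K where
  aff v := affK K hK v
  aff_vert v i := by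
    apply Subtype.ext
    change ∑ j, (stdSimplex.vertex i : Dl _) j • (v j : E) = v i
    rw [Finset.sum_eq_single i]
    · simp [stdSimplex.vertex_coe]
    · intro j _ hj; simp [stdSimplex.vertex_coe, hj]
    · simp
  aff_comp v w t := by
    apply Subtype.ext
    change ∑ j, (affD w t) j • (v j : E) = ∑ k, t k • ∑ j, (w k) j • (v j : E)
    simp_rw [affD_apply, Finset.sum_smul, Finset.smul_sum, mul_smul]
    exact Finset.sum_comm

noncomputable instance (m : ℕ) : Cvx (Dl m) := cvxK _ (convex_stdSimplex ℝ (Fin m))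

noncomputable instance : Cvx unitInterval := cvxK _ (convex_Icc 0 1)

noncomputable instance {S S' : Type} [TopologicalSpace S] [TopologicalSpace S'] [Cvx S] [Cvx S'] :
    Cvx (S × S') where
  aff v := (Cvx.aff (fun k => (v k).1)).prodMk (Cvx.aff (fun k => (v k).2))
  aff_vert v i := by simp [Cvx.aff_vert]
  aff_comp v w t := by
    exact Prod.ext (Cvx.aff_comp _ w t) (Cvx.aff_comp _ w t)

open Cvx

def IsAff {S S' : Type} [TopologicalSpace S] [TopologicalSpace S'] [Cvx S] [Cvx S']
    (f : S → S') : Prop := ∀ (n : ℕ) (v : Fin n → S) (t : Dl n), f (aff v t) = aff (f ∘ v) t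

theorem isAff_aff {S : Type} [TopologicalSpace S] [Cvx S] {m : ℕ} (v : Fin m → S) :
    IsAff (aff v : Dl m → S) := fun _ w t => aff_comp v w t

theorem isAff_idprod {S S' : Type} [TopologicalSpace S] [TopologicalSpace S'] [Cvx S] [Cvx S']
    {f : S → S'} (hf : IsAff f) : IsAff (fun p : unitInterval × S => (p.1, f p.2)) := by
  intro n v t
  exact Prod.ext rfl (hf _ _ _)

/-- barycentre of a tuple -/
noncomputable def bary {S : Type} [TopologicalSpace S] [Cvx S] (n : ℕ) (v : Fin (n + 1) → S) : S :=
  aff v stdSimplex.barycenter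

noncomputable def lSd {S : Type} [TopologicalSpace S] [Cvx S] : ∀ n, L n S →ₗ[ℚ] L n S
  | 0 => LinearMap.id
  | n + 1 => lex fun v => cone (bary n v) (lSd n (lb n (sg v)))

theorem lSd_sg {S : Type} [TopologicalSpace S] [Cvx S] (n : ℕ) (v : Fin (n + 1) → S) :
    lSd (n + 1) (sg v) = cone (bary n v) (lSd n (lb n (sg v))) := lex_sg _ _

theorem lSd_zero {S : Type} [TopologicalSpace S] [Cvx S] (c : L 0 S) : lSd 0 c = c := rfl

attribute [irreducible] lSd

theorem lb_lSd {S : Type} [TopologicalSpace S] [Cvx S] :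
    ∀ n (c : L (n + 1) S), lb n (lSd (n + 1) c) = lSd n (lb n c) := by
  intro n
  induction n with
  | zero =>
    refine LinearMap.congr_fun (f := lb 0 ∘ₗ lSd (0 + 1)) (g := lSd 0 ∘ₗ lb 0) (lext fun v => ?_)
    rw [LinearMap.comp_apply, lSd_sg, lb_cone0]; rfl
  | succ n ih =>
    refine LinearMap.congr_fun (f := lb (n + 1) ∘ₗ lSd (n + 1 + 1)) (g := lSd (n + 1) ∘ₗ lb (n + 1))
      (lext fun v => ?_)
    simp only [LinearMap.comp_apply, lSd_sg, lb_cone, ih, lb_lb, map_zero, sub_zero]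

theorem tp_lSd {S S' : Type} [TopologicalSpace S] [TopologicalSpace S'] [Cvx S] [Cvx S']
    {f : S → S'} (hf : IsAff f) : ∀ n c, tp f n (lSd n c) = lSd n (tp f n c) := by
  intro n
  induction n with
  | zero => intro c; rw [lSd_zero, lSd_zero]
  | succ n ih =>
    refine LinearMap.congr_fun (f := tp f (n + 1) ∘ₗ lSd (n + 1)) (g := lSd (n + 1) ∘ₗ tp f (n + 1))
      (lext fun v => ?_)
    simp only [LinearMap.comp_apply, lSd_sg, pf_sg, tp_cone]
    rw [ih, tp_lb, pf_sg, bary, hf, bary]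

noncomputable def lT {S : Type} [TopologicalSpace S] [Cvx S] (n : ℕ) : L n S →ₗ[ℚ] L (n + 1) S :=
  hop (fun _ => LinearMap.id) lSd bary n

theorem lb_lT {S : Type} [TopologicalSpace S] [Cvx S] (n : ℕ) (c : L (n + 1) S) :
    lb (n + 1) (lT (n + 1) c) + lT n (lb n c) = c - lSd (n + 1) c :=
  lb_hop _ _ _ (LinearMap.ext fun c => (lSd_zero c).symm) (fun _ _ => rfl) lb_lSd n c

theorem tp_lT {S S' : Type} [TopologicalSpace S] [TopologicalSpace S'] [Cvx S] [Cvx S']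
    {f : S → S'} (hf : IsAff f) (n : ℕ) (c : L n S) : tp f (n + 1) (lT n c) = lT n (tp f n c) :=
  tp_hop _ _ _ _ _ _ f f (fun _ _ => rfl) (tp_lSd hf)
    (fun _ _ => by rw [bary, hf, bary]) n c

noncomputable def lP {S : Type} (n : ℕ) : L n S →ₗ[ℚ] L (n + 1) (unitInterval × S) :=
  hop (tp fun x => (1, x)) (tp fun x => (0, x)) (fun _ v => (0, v 0)) n

theorem lb_lP {S : Type} (n : ℕ) (c : L (n + 1) S) :
    lb (n + 1) (lP (n + 1) c) + lP n (lb n c)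
      = tp (fun x => (1, x)) (n + 1) c - tp (fun x => (0, x)) (n + 1) c := by
  refine lb_hop _ _ _ ?_ (fun _ _ => (tp_lb _ _).symm) (fun _ _ => (tp_lb _ _).symm) n c
  refine lext fun v => ?_
  rw [pf_sg, pf_sg]; congr 1; funext i; exact i.elim0

theorem tp_lP {S S' : Type} (f : S → S') (n : ℕ) (c : L n S) :
    tp (fun p : unitInterval × S => (p.1, f p.2)) (n + 1) (lP n c) = lP n (tp f n c) :=
  tp_hop _ _ _ _ _ _ f _ (fun _ _ => by simp only [pf_pf]; rfl)
    (fun _ _ => by simp only [pf_pf]; rfl) (fun _ _ => rfl) n c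

theorem snd_lP {S : Type} (n : ℕ) (c : L n S) :
    tp (Prod.snd : unitInterval × S → S) (n + 1) (lP n c) = 0 := by
  induction n with
  | zero => simp [lP, hop]
  | succ n ih =>
    refine LinearMap.congr_fun (f := tp (Prod.snd : unitInterval × S → S) (n + 2) ∘ₗ lP (n + 1))
      (g := 0) (lext fun v => ?_) c
    rw [LinearMap.comp_apply, lP, hop_sg, tp_cone, map_sub (tp _ _), map_sub (tp _ _)]
    have := ih (lb n (sg v))
    rw [lP] at this
    rw [this, pf_sg, pf_sg, pf_sg, pf_sg]
    simp [Function.comp_def]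

end OC

set_option linter.all false

namespace OC
open Cvx

/-! ### Singular chains -/

abbrev Ch (n : ℕ) (Y : Type) [TopologicalSpace Y] := C(Dl n, Y) →₀ ℚ

section
variable {X Y Z : Type} [TopologicalSpace X] [TopologicalSpace Y] [TopologicalSpace Z]
variable {S : Type} [TopologicalSpace S] [Cvx S]

noncomputable def cm (f : C(Y, Z)) (n : ℕ) : Ch n Y →ₗ[ℚ] Ch n Z := pf fun s => f.comp s

theorem cm_sg (f : C(Y, Z)) {n : ℕ} (s : C(Dl n, Y)) : cm f n (sg s) = sg (f.comp s) := pf_sg _ _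

theorem cm_cm (g : C(Y, Z)) (f : C(X, Y)) {n : ℕ} (c : Ch n X) :
    cm g n (cm f n c) = cm (g.comp f) n c := pf_pf _ _ _

theorem cm_id {n : ℕ} (c : Ch n X) : cm (ContinuousMap.id X) n c = c := pf_id _

noncomputable def rl (n : ℕ) : L n S →ₗ[ℚ] Ch n S := pf aff

theorem rl_sg {n : ℕ} (v : Fin n → S) : rl n (sg v) = sg (aff v) := pf_sg _ _

noncomputable def io (n : ℕ) : Fin n → Dl n := fun i => stdSimplex.vertex i

theorem aff_io (n : ℕ) : aff (io n) = ContinuousMap.id (Dl n) := by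
  ext t k
  change affD (io n) t k = t k
  rw [affD_apply, Finset.sum_eq_single k]
  · simp [io, stdSimplex.vertex_coe]
  · intro j _ hj; simp [io, stdSimplex.vertex_coe, hj.symm]
  · simp

theorem sg_eq {n : ℕ} (s : C(Dl n, Y)) : sg s = cm s n (rl n (sg (io n))) := by
  rw [rl_sg, aff_io, cm_sg]; rfl

theorem rl_tp {S' : Type} [TopologicalSpace S'] [Cvx S'] (f : C(S, S')) (hf : IsAff f) {n : ℕ}
    (c : L n S) : rl n (tp f n c) = cm f n (rl n c) := by
  simp only [rl, cm, tp, pf_pf]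
  congr 1; congr 1; funext v; ext t
  exact (hf n v t).symm

theorem tp_aff_io {n : ℕ} (v : Fin n → S) : tp (aff v) n (sg (io n)) = sg v := by
  rw [tp, pf_sg]; congr 1; funext i; exact aff_vert v i

noncomputable def sing {m n : ℕ} (u : L m (Dl n)) : Ch n Y →ₗ[ℚ] Ch m Y :=
  lex fun s => cm s m (rl m u)

theorem sing_sg {m n : ℕ} (u : L m (Dl n)) (s : C(Dl n, Y)) :
    sing u (sg s) = cm s m (rl m u) := lex_sg _ _

theorem sing_cm {m n : ℕ} (u : L m (Dl n)) (f : C(Y, Z)) (c : Ch n Y) :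
    sing u (cm f n c) = cm f m (sing u c) := by
  refine LinearMap.congr_fun (f := sing u ∘ₗ cm f n) (g := cm f m ∘ₗ sing u) (lext fun s => ?_) c
  simp only [LinearMap.comp_apply, cm_sg, sing_sg, cm_cm]

theorem sing_rl {m n : ℕ} (u : L m (Dl n)) (O : L n S →ₗ[ℚ] L m S)
    (hO : ∀ v, tp (aff v) m u = O (sg v)) (c : L n S) :
    sing u (rl n c) = rl m (O c) := by
  refine LinearMap.congr_fun (f := sing u ∘ₗ rl n) (g := rl m ∘ₗ O) (lext fun v => ?_) c
  simp only [LinearMap.comp_apply, rl_sg, sing_sg]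
  rw [← hO, rl_tp _ (isAff_aff v)]

noncomputable def d (n : ℕ) : Ch (n + 1) Y →ₗ[ℚ] Ch n Y := sing (lb n (sg (io (n + 1))))

theorem d_cm {n : ℕ} (f : C(Y, Z)) (c : Ch (n + 1) Y) : d n (cm f (n + 1) c) = cm f n (d n c) :=
  sing_cm _ _ _

theorem d_rl {n : ℕ} (c : L (n + 1) S) : d n (rl (n + 1) c) = rl n (lb n c) :=
  sing_rl _ _ (fun v => by rw [tp_lb, tp_aff_io]) c

theorem d_d {n : ℕ} (c : Ch (n + 2) Y) : d n (d (n + 1) c) = 0 := by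
  refine LinearMap.congr_fun (f := d n ∘ₗ d (n + 1)) (g := 0) (lext fun s => ?_) c
  rw [LinearMap.comp_apply, sg_eq, d_cm, d_cm, d_rl, d_rl, lb_lb]; simp

noncomputable def Sd (n : ℕ) : Ch n Y →ₗ[ℚ] Ch n Y := sing (lSd n (sg (io n)))

theorem Sd_cm {n : ℕ} (f : C(Y, Z)) (c : Ch n Y) : Sd n (cm f n c) = cm f n (Sd n c) :=
  sing_cm _ _ _

theorem Sd_rl {n : ℕ} (c : L n S) : Sd n (rl n c) = rl n (lSd n c) :=
  sing_rl _ _ (fun v => by rw [tp_lSd (isAff_aff v), tp_aff_io]) c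

noncomputable def Tt (n : ℕ) : Ch n Y →ₗ[ℚ] Ch (n + 1) Y := sing (lT n (sg (io n)))

theorem Tt_cm {n : ℕ} (f : C(Y, Z)) (c : Ch n Y) : Tt n (cm f n c) = cm f (n + 1) (Tt n c) :=
  sing_cm _ _ _

theorem Tt_rl {n : ℕ} (c : L n S) : Tt n (rl n c) = rl (n + 1) (lT n c) :=
  sing_rl _ _ (fun v => by rw [tp_lT (isAff_aff v), tp_aff_io]) c

theorem d_Tt (n : ℕ) (c : Ch (n + 1) Y) :
    d (n + 1) (Tt (n + 1) c) + Tt n (d n c) = c - Sd (n + 1) c := by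
  refine LinearMap.congr_fun (f := d (n + 1) ∘ₗ Tt (n + 1) + Tt n ∘ₗ d n)
    (g := LinearMap.id - Sd (n + 1)) (lext fun s => ?_) c
  simp only [LinearMap.add_apply, LinearMap.sub_apply, LinearMap.comp_apply, LinearMap.id_apply]
  rw [sg_eq s, Tt_cm, d_cm, d_cm, Tt_cm, Sd_cm, Tt_rl, d_rl, d_rl, Tt_rl, Sd_rl, ← map_add,
    ← map_add, lb_lT, map_sub, map_sub]

theorem d_Sd (n : ℕ) (c : Ch (n + 1) Y) : d n (Sd (n + 1) c) = Sd n (d n c) := by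
  refine LinearMap.congr_fun (f := d n ∘ₗ Sd (n + 1)) (g := Sd n ∘ₗ d n) (lext fun s => ?_) c
  simp only [LinearMap.comp_apply]
  rw [sg_eq s, Sd_cm, d_cm, d_cm, Sd_cm, Sd_rl, d_rl, d_rl, Sd_rl, lb_lSd]

/-- product with the interval -/
abbrev idx (f : C(Y, Z)) : C(unitInterval × Y, unitInterval × Z) :=
  (ContinuousMap.id unitInterval).prodMap f

abbrev ix (t : unitInterval) (Y : Type) [TopologicalSpace Y] : C(Y, unitInterval × Y) :=
  (ContinuousMap.const Y t).prodMk (ContinuousMap.id Y)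

noncomputable def Pr (n : ℕ) : Ch n Y →ₗ[ℚ] Ch (n + 1) (unitInterval × Y) :=
  lex fun s => cm (idx s) (n + 1) (rl (n + 1) (lP n (sg (io n))))

theorem Pr_sg (n : ℕ) (s : C(Dl n, Y)) :
    Pr n (sg s) = cm (idx s) (n + 1) (rl (n + 1) (lP n (sg (io n)))) := lex_sg _ _

theorem Pr_cm {n : ℕ} (f : C(Y, Z)) (c : Ch n Y) :
    Pr n (cm f n c) = cm (idx f) (n + 1) (Pr n c) := by
  refine LinearMap.congr_fun (f := Pr n ∘ₗ cm f n) (g := cm (idx f) (n + 1) ∘ₗ Pr n)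
    (lext fun s => ?_) c
  simp only [LinearMap.comp_apply, cm_sg, Pr_sg, cm_cm]
  rfl

theorem Pr_rl {n : ℕ} (c : L n S) : Pr n (rl n c) = rl (n + 1) (lP n c) := by
  refine LinearMap.congr_fun (f := Pr n ∘ₗ rl n) (g := rl (n + 1) ∘ₗ lP n) (lext fun v => ?_) c
  simp only [LinearMap.comp_apply, rl_sg, Pr_sg]
  rw [← tp_aff_io v, ← tp_lP, ← rl_tp]
  · rfl
  · exact isAff_idprod (isAff_aff v)

theorem Pr_zero (c : Ch 0 Y) : Pr 0 c = 0 := by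
  refine LinearMap.congr_fun (f := Pr 0) (g := 0) (lext fun s => ?_) c
  rw [Pr_sg]; simp [lP, hop]

theorem d_Pr (n : ℕ) (c : Ch (n + 1) Y) :
    d (n + 1) (Pr (n + 1) c) + Pr n (d n c) = cm (ix 1 Y) _ c - cm (ix 0 Y) _ c := by
  refine LinearMap.congr_fun (f := d (n + 1) ∘ₗ Pr (n + 1) + Pr n ∘ₗ d n)
    (g := cm (ix 1 Y) _ - cm (ix 0 Y) _) (lext fun s => ?_) c
  simp only [LinearMap.add_apply, LinearMap.sub_apply, LinearMap.comp_apply]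
  rw [sg_eq s, Pr_cm, d_cm, d_cm, Pr_cm, Pr_rl, d_rl, d_rl, Pr_rl, ← map_add,
    ← map_add, lb_lP, map_sub, map_sub, cm_cm, cm_cm]
  have h : ∀ t : unitInterval, cm (idx s) (n + 1) (rl (n + 1) (tp (fun x => (t, x)) (n + 1)
      (sg (io (n + 1))))) = cm ((ix t Y).comp s) (n + 1) (rl (n + 1) (sg (io (n + 1)))) := by
    intro t
    rw [tp, pf_sg, rl_sg, rl_sg, cm_sg, cm_sg, aff_io]
    congr 1
    ext x
    · change (((aff (fun _ => t) : C(Dl (n + 1), unitInterval)) x : unitInterval) : ℝ) = t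
      change ∑ i, x i • (t : ℝ) = t
      rw [← Finset.sum_smul, stdSimplex.sum_eq_one, one_smul]
    · change s (aff (io (n + 1)) x) = s x
      rw [aff_io]; rfl
  rw [h, h]

theorem snd_Pr (n : ℕ) (c : Ch n Y) : cm ContinuousMap.snd (n + 1) (Pr n c) = 0 := by
  refine LinearMap.congr_fun (f := cm ContinuousMap.snd (n + 1) ∘ₗ Pr n) (g := 0)
    (lext fun s => ?_) c
  rw [LinearMap.comp_apply, Pr_sg, cm_cm]
  have : (ContinuousMap.snd : C(unitInterval × Y, Y)).comp (idx s) = s.comp ContinuousMap.snd := rfl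
  rw [this, ← cm_cm, ← rl_tp _ (fun _ _ _ => rfl)]
  have h := snd_lP n (sg (io n))
  rw [show (⇑(ContinuousMap.snd : C(unitInterval × Dl n, Dl n)))
    = (Prod.snd : unitInterval × Dl n → Dl n) from rfl, h]
  simp

/-! ### Supports -/

def sup (A : Set Y) (n : ℕ) : Submodule ℚ (Ch n Y) :=
  Finsupp.supported ℚ ℚ {s : C(Dl n, Y) | ∀ t, s t ∈ A}

theorem sup_ind {T M : Type} [AddCommGroup M] [Module ℚ M] {P : Set T} {f : (T →₀ ℚ) →ₗ[ℚ] M}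
    {N : Submodule ℚ M} (h : ∀ s ∈ P, f (sg s) ∈ N) {c : T →₀ ℚ}
    (hc : c ∈ Finsupp.supported ℚ ℚ P) : f c ∈ N := by
  rw [Finsupp.supported_eq_span_single] at hc
  refine (Submodule.span_le (p := N.comap f)).2 ?_ hc
  rintro _ ⟨s, hs, rfl⟩
  exact h s hs

theorem sg_mem {T : Type} {P : Set T} {s : T} (h : s ∈ P) : sg s ∈ Finsupp.supported ℚ ℚ P :=
  Finsupp.single_mem_supported ℚ 1 h

theorem pf_mem {T T' : Type} (f : T → T') {P : Set T} {P' : Set T'} (h : ∀ s ∈ P, f s ∈ P')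
    {c : T →₀ ℚ} (hc : c ∈ Finsupp.supported ℚ ℚ P) : pf f c ∈ Finsupp.supported ℚ ℚ P' :=
  sup_ind (fun s hs => by rw [pf_sg]; exact sg_mem (h s hs)) hc

theorem cm_sup (f : C(Y, Z)) {A : Set Y} {B : Set Z} (h : ∀ y ∈ A, f y ∈ B) {n : ℕ} {c : Ch n Y}
    (hc : c ∈ sup A n) : cm f n c ∈ sup B n :=
  pf_mem (P := {s : C(Dl n, Y) | ∀ t, s t ∈ A}) (P' := {s : C(Dl n, Z) | ∀ t, s t ∈ B})
    (fun s => f.comp s) (fun _ hs t => h _ (hs t)) hc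

theorem mem_univ {P : Set X} (h : ∀ s, s ∈ P) (c : X →₀ ℚ) : c ∈ Finsupp.supported ℚ ℚ P := by
  rw [Set.eq_univ_of_forall h]; simp

theorem cm_range (f : C(Y, Z)) {B : Set Z} (h : ∀ y, f y ∈ B) {n : ℕ} (c : Ch n Y) :
    cm f n c ∈ sup B n :=
  cm_sup f (A := Set.univ) (fun y _ => h y) (mem_univ (fun _ _ => trivial) c)

theorem sing_sup {m n : ℕ} (u : L m (Dl n)) {A : Set Y} {c : Ch n Y} (hc : c ∈ sup A n) :
    sing u c ∈ sup A m :=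
  sup_ind (fun s hs => by rw [sing_sg]; exact cm_range s hs _) hc

theorem d_sup {n : ℕ} {A : Set Y} {c : Ch (n + 1) Y} (hc : c ∈ sup A (n + 1)) :
    d n c ∈ sup A n := sing_sup _ hc

abbrev inc (A : Set Y) : C(A, Y) := ⟨Subtype.val, continuous_subtype_val⟩

theorem sup_lift {n : ℕ} {A : Set Y} {c : Ch n Y} (hc : c ∈ sup A n) :
    ∃ c' : Ch n A, cm (inc A) n c' = c := by
  have : LinearMap.id (R := ℚ) c ∈ LinearMap.range (cm (inc A) n) := by
    refine sup_ind (fun s hs => ?_) hc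
    refine ⟨sg ⟨fun t => ⟨s t, hs t⟩, by fun_prop⟩, ?_⟩
    rw [cm_sg]; rfl
  exact this

theorem cm_inj (f : C(Y, Z)) (hf : Function.Injective f) {n : ℕ} {c c' : Ch n Y}
    (h : cm f n c = cm f n c') : c = c' := by
  refine Finsupp.mapDomain_injective (f := fun s : C(Dl n, Y) => f.comp s) (fun s s' hs => ?_) h
  ext t
  exact hf (DFunLike.congr_fun hs t)

theorem sup_inter {n : ℕ} {A B : Set Y} {c : Ch n Y} (hA : c ∈ sup A n) (hB : c ∈ sup B n) :
    c ∈ sup (A ∩ B) n := by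
  have : c ∈ sup A n ⊓ sup B n := ⟨hA, hB⟩
  rw [sup, sup, ← Finsupp.supported_inter] at this
  exact Finsupp.supported_mono (fun s hs t => ⟨hs.1 t, hs.2 t⟩) this

theorem sup_mono {n : ℕ} {A B : Set Y} (h : A ⊆ B) : sup A n ≤ sup B n :=
  Finsupp.supported_mono fun _ hs t => h (hs t)

/-! ### Small chains -/

def mesh (k : ℕ) (δ : ℝ) (n : ℕ) : Submodule ℚ (L n (Dl k)) :=
  Finsupp.supported ℚ ℚ {v : Fin n → Dl k | ∀ i j, dist (v i) (v j) ≤ δ}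

theorem dist_aff {k n : ℕ} (v : Fin n → Dl k) (p : Dl k) (r : ℝ) (h : ∀ i, dist (v i) p ≤ r)
    (t : Dl n) : dist (aff v t) p ≤ r := by
  have := (convex_closedBall (p : Fin k → ℝ) r).sum_mem (t := Finset.univ) (w := fun i => t i)
    (z := fun i => ((v i : Dl k) : Fin k → ℝ)) (fun i _ => t.2.1 i) t.2.2 (fun i _ => h i)
  exact this

theorem dist_bary {k n : ℕ} (v : Fin (n + 1) → Dl k) (δ : ℝ) (h : ∀ i j, dist (v i) (v j) ≤ δ)
    (i : Fin (n + 1)) : dist (v i) (bary n v) ≤ n / (n + 1) * δ := by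
  have e : ((v i : Dl k) : Fin k → ℝ) - (bary n v : Dl k)
      = ∑ j, (1 / (n + 1 : ℝ)) • (((v i : Dl k) : Fin k → ℝ) - (v j : Dl k)) := by
    have : ((bary n v : Dl k) : Fin k → ℝ)
      = ∑ j, (1 / (n + 1 : ℝ)) • ((v j : Dl k) : Fin k → ℝ) := by
      change ∑ j, (stdSimplex.barycenter : Dl (n + 1)) j • ((v j : Dl k) : Fin k → ℝ) = _
      refine Finset.sum_congr rfl fun j _ => ?_
      congr 1
      exact (stdSimplex.barycenter_apply j).trans (by simp)
    rw [this]
    simp only [smul_sub, Finset.sum_sub_distrib]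
    congr 1
    rw [Finset.sum_const, Finset.card_univ, Fintype.card_fin, ← Nat.cast_smul_eq_nsmul ℝ, smul_smul]
    push_cast
    rw [mul_one_div_cancel (by positivity), one_smul]
  rw [Subtype.dist_eq, dist_eq_norm]
  change ‖((v i : Dl k) : Fin k → ℝ) - (bary n v : Dl k)‖ ≤ _
  rw [e, Fin.sum_univ_succAbove _ i]
  simp only [sub_self, smul_zero, zero_add]
  refine (norm_sum_le _ _).trans ?_
  refine (Finset.sum_le_sum (g := fun _ => (1 / (n + 1 : ℝ)) * δ) fun j _ => ?_).trans ?_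
  · rw [norm_smul, Real.norm_of_nonneg (by positivity), ← dist_eq_norm]
    exact mul_le_mul_of_nonneg_left (h _ _) (by positivity)
  · simp; apply le_of_eq; ring

theorem lSd_mesh {k : ℕ} : ∀ (n : ℕ) (δ : ℝ) (hδ : 0 ≤ δ) (c : L n (Dl k)), c ∈ mesh k δ n →
    lSd n c ∈ mesh k (n / (n + 1) * δ) n := by
  intro n
  induction n with
  | zero => intro δ _ c _; exact mem_univ (fun v i => i.elim0) _
  | succ n ih =>
    intro δ hδ c hc
    refine sup_ind (fun v hv => ?_) hc
    rw [lSd_sg]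
    have hq : (n / (n + 1) * δ : ℝ) ≤ ((n + 1 : ℕ) / ((n + 1 : ℕ) + 1) * δ) := by
      refine mul_le_mul_of_nonneg_right ?_ hδ
      rw [div_le_div_iff₀ (by positivity) (by positivity)]; push_cast; nlinarith
    have h1 : lb n (sg v) ∈ mesh k δ n := by
      rw [lb_sg]
      exact Submodule.sum_mem _ fun j _ => Submodule.smul_mem _ _ (sg_mem fun a b => hv _ _)
    have h2 : lSd n (lb n (sg v)) ∈
        Finsupp.supported ℚ ℚ {w : Fin n → Dl k | ∀ i, w i ∈ Set.range (aff v)} := by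
      rw [← tp_aff_io v, ← tp_lb, ← tp_lSd (isAff_aff v)]
      exact pf_mem (P := Set.univ) _ (fun w _ i => ⟨w i, rfl⟩) (by simp)
    have h3 := Submodule.mem_inf.2 ⟨ih δ hδ _ h1, h2⟩
    rw [mesh, ← Finsupp.supported_inter] at h3
    refine pf_mem _ (fun w hw => ?_) h3
    have hb : ∀ i, dist (w i) (bary n v) ≤ n / (n + 1) * δ := by
      intro i
      obtain ⟨t, ht⟩ := hw.2 i
      rw [← ht]
      exact dist_aff v _ _ (dist_bary v δ hv) t
    intro i j
    refine le_trans ?_ hq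
    have h0 : (0 : ℝ) ≤ n / (n + 1) * δ := by positivity
    refine Fin.cases ?_ (fun i => ?_) i <;> refine Fin.cases ?_ (fun j => ?_) j
    · simpa using h0
    · simpa [dist_comm] using hb j
    · simpa using hb i
    · simpa using hw.1 i j

theorem lSd_iter_mesh {k : ℕ} (n N : ℕ) (c : L n (Dl k)) (hc : c ∈ mesh k 1 n) :
    (lSd n)^[N] c ∈ mesh k ((n / (n + 1) : ℝ) ^ N) n := by
  induction N with
  | zero => simpa using hc
  | succ N ih =>
    rw [Function.iterate_succ_apply', pow_succ, mul_comm]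
    exact lSd_mesh n _ (by positivity) _ ih

theorem small_one {A B : Set Y} (hA : IsOpen A) (hB : IsOpen B) (hAB : ∀ y, y ∈ A ∨ y ∈ B) {n : ℕ}
    (s : C(Dl (n + 1), Y)) : ∃ N, (Sd (n + 1))^[N] (sg s) ∈ sup A (n + 1) ⊔ sup B (n + 1) := by
  obtain ⟨ε, hε, hl⟩ := lebesgue_number_lemma_of_metric (s := (Set.univ : Set (Dl (n + 1))))
    (c := fun b : Bool => if b then s ⁻¹' A else s ⁻¹' B) isCompact_univ
    (by intro b; cases b
        · simpa using hB.preimage s.continuous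
        · simpa using hA.preimage s.continuous)
    (by intro t _
        rcases hAB (s t) with h | h
        · exact Set.mem_iUnion.2 ⟨true, by simpa using h⟩
        · exact Set.mem_iUnion.2 ⟨false, by simpa using h⟩)
  obtain ⟨N, hN⟩ := exists_pow_lt_of_lt_one hε
    (show (((n + 1 : ℕ) : ℝ) / ((n + 1 : ℕ) + 1) : ℝ) < 1 by
      rw [div_lt_one (by positivity)]; linarith)
  refine ⟨N, ?_⟩
  have h1 : (Sd (n + 1))^[N] (sg s) = cm s _ (rl _ ((lSd (n + 1))^[N] (sg (io (n + 1))))) := by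
    clear hN
    induction N with
    | zero => exact sg_eq s
    | succ N ih =>
      rw [Function.iterate_succ_apply', ih, Sd_cm, Sd_rl, Function.iterate_succ_apply']
  rw [h1]
  have h2 := lSd_iter_mesh (n + 1) N (sg (io (n + 1))) (sg_mem fun i j => by
    have hx := (io (n + 1) i).2; have hy := (io (n + 1) j).2
    exact (Metric.dist_le_diam_of_mem (bounded_stdSimplex _) hx hy).trans diam_stdSimplex_le)
  rw [sup, sup, ← Finsupp.supported_union]
  refine sup_ind (f := cm s (n + 1) ∘ₗ rl (n + 1)) (fun v hv => ?_) h2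
  rw [LinearMap.comp_apply, rl_sg, cm_sg]
  obtain ⟨b, hb⟩ := hl (v 0) trivial
  have hm : ∀ t, aff v t ∈ Metric.ball (v 0) ε := fun t =>
    (dist_aff v (v 0) _ (fun i => hv i 0) t).trans_lt hN
  cases b
  · exact sg_mem (Or.inr fun t => by simpa using hb (hm t))
  · exact sg_mem (Or.inl fun t => by simpa using hb (hm t))

theorem small_chains {A B : Set Y} (hA : IsOpen A) (hB : IsOpen B) (hAB : ∀ y, y ∈ A ∨ y ∈ B)
    {n : ℕ} (c : Ch (n + 1) Y) (hc : d n c ∈ sup A n ⊔ sup B n) :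
    ∃ a ∈ sup A (n + 1), ∃ b ∈ sup B (n + 1), ∃ e, c = a + b + d (n + 1) e := by
  have sm : ∀ {m n : ℕ} (u : L m (Dl n)) (c : Ch n Y), c ∈ sup A n ⊔ sup B n →
      sing u c ∈ sup A m ⊔ sup B m := by
    intro m n u c hc
    obtain ⟨a, ha, b, hb, rfl⟩ := Submodule.mem_sup.1 hc
    rw [map_add]
    exact Submodule.add_mem_sup (sing_sup u ha) (sing_sup u hb)
  have smi : ∀ {n : ℕ} (c : Ch n Y) (N : ℕ), c ∈ sup A n ⊔ sup B n →
      (Sd n)^[N] c ∈ sup A n ⊔ sup B n := by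
    intro n c N hc
    induction N with
    | zero => exact hc
    | succ N ih => rw [Function.iterate_succ_apply']; exact sm _ _ ih
  have iadd : ∀ (N : ℕ) (c c' : Ch (n + 1) Y), (Sd (n + 1))^[N] (c + c')
      = (Sd (n + 1))^[N] c + (Sd (n + 1))^[N] c' := fun N c c' =>
    iterate_map_add (Sd (n + 1)) N c c'
  have hN : ∃ N, (Sd (n + 1))^[N] c ∈ sup A (n + 1) ⊔ sup B (n + 1) := by
    clear hc
    induction c using Finsupp.induction_linear with
    | zero => exact ⟨0, by simp⟩
    | add f g hf hg =>
      obtain ⟨N, hN⟩ := hf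
      obtain ⟨N', hN'⟩ := hg
      refine ⟨N + N', ?_⟩
      rw [iadd]
      refine add_mem ?_ ?_
      · rw [add_comm N N', Function.iterate_add_apply]; exact smi _ _ hN
      · rw [Function.iterate_add_apply]; exact smi _ _ hN'
    | single s q =>
      obtain ⟨N, hN⟩ := small_one hA hB hAB s
      refine ⟨N, ?_⟩
      have : Finsupp.single s q = q • sg s := by simp
      rw [this]
      have h2 : (Sd (n + 1))^[N] (q • sg s) = q • (Sd (n + 1))^[N] (sg s) := by
        rw [← Module.End.coe_pow, map_smul]
      rw [h2]
      exact Submodule.smul_mem _ _ hN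
  have it : ∀ N, ∃ s ∈ sup A (n + 1) ⊔ sup B (n + 1), ∃ e,
      c = (Sd (n + 1))^[N] c + s + d (n + 1) e := by
    intro N
    induction N with
    | zero => exact ⟨0, by simp, 0, by simp⟩
    | succ N ih =>
      obtain ⟨s, hs, e, h⟩ := ih
      have hd : d n ((Sd (n + 1))^[N] c) ∈ sup A n ⊔ sup B n := by
        have : d n ((Sd (n + 1))^[N] c) = (Sd n)^[N] (d n c) := by
          clear h
          induction N with
          | zero => rfl
          | succ N ih => rw [Function.iterate_succ_apply', d_Sd, ih, Function.iterate_succ_apply']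
        rw [this]; exact smi _ _ hc
      refine ⟨s + Tt n (d n ((Sd (n + 1))^[N] c)), add_mem hs (sm _ _ hd),
        e + Tt (n + 1) ((Sd (n + 1))^[N] c), ?_⟩
      rw [Function.iterate_succ_apply', map_add]
      generalize (Sd (n + 1))^[N] c = x at *
      have h3 : Sd (n + 1) x = x - (d (n + 1) (Tt (n + 1) x) + Tt n (d n x)) := by
        rw [d_Tt]; abel
      rw [h3]
      conv_lhs => rw [h]
      abel
  obtain ⟨N, hN⟩ := hN
  obtain ⟨s, hs, e, h⟩ := it N
  obtain ⟨a, ha, b, hb, hab⟩ := Submodule.mem_sup.1 (add_mem hN hs)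
  exact ⟨a, ha, b, hb, e, by rw [hab]; exact h⟩

end
end OC

set_option linter.all false

namespace OC
open Cvx

/-! ### Homology -/

section
variable {X Y Z : Type} [TopologicalSpace X] [TopologicalSpace Y] [TopologicalSpace Z]

def Zc (i : ℕ) (Y : Type) [TopologicalSpace Y] : Submodule ℚ (Ch (i + 1) Y) where
  carrier := {c | i = 0 ∨ d i c = 0}
  zero_mem' := Or.inr (map_zero _)
  add_mem' := by
    rintro a b (h | h) (h' | h')
    · exact Or.inl h
    · exact Or.inl h
    · exact Or.inl h'
    · exact Or.inr (by rw [map_add, h, h', add_zero])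
  smul_mem' := by
    rintro q a (h | h)
    · exact Or.inl h
    · exact Or.inr (by rw [map_smul, h, smul_zero])

theorem mem_Zc {i : ℕ} {c : Ch (i + 1) Y} : c ∈ Zc i Y ↔ (i = 0 ∨ d i c = 0) := Iff.rfl

theorem Zc_of {i : ℕ} {c : Ch (i + 1) Y} (h : d i c = 0) : c ∈ Zc i Y := Or.inr h

theorem d_mem_Zc {i : ℕ} (e : Ch (i + 2) Y) : d (i + 1) e ∈ Zc i Y := Zc_of (d_d e)

def H (i : ℕ) (Y : Type) [TopologicalSpace Y] : Type :=
  Zc i Y ⧸ (LinearMap.range (d (Y := Y) (i + 1))).submoduleOf (Zc i Y)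

noncomputable instance (i : ℕ) : AddCommGroup (H i Y) := inferInstanceAs (AddCommGroup (_ ⧸ _))
noncomputable instance (i : ℕ) : Module ℚ (H i Y) := inferInstanceAs (Module ℚ (_ ⧸ _))

noncomputable def hk (i : ℕ) (Y : Type) [TopologicalSpace Y] : Zc i Y →ₗ[ℚ] H i Y :=
  Submodule.mkQ _

theorem hk_surj (i : ℕ) : Function.Surjective (hk i Y) := Submodule.mkQ_surjective _

theorem hk_eq_zero {i : ℕ} (z : Zc i Y) : hk i Y z = 0 ↔ ∃ e, d (i + 1) e = z.1 := by
  exact (Submodule.Quotient.mk_eq_zero _).trans Iff.rfl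

theorem hk_eq {i : ℕ} (z z' : Zc i Y) : hk i Y z = hk i Y z' ↔ ∃ e, d (i + 1) e = z.1 - z'.1 := by
  rw [← sub_eq_zero, ← map_sub, hk_eq_zero]; rfl

/-- descend a chain level map -/
noncomputable def hlift {i : ℕ} {M : Type} [AddCommGroup M] [Module ℚ M] (f : Zc i Y →ₗ[ℚ] M)
    (hf : ∀ e, f ⟨d (i + 1) e, d_mem_Zc e⟩ = 0) : H i Y →ₗ[ℚ] M :=
  Submodule.liftQ _ f (by
    rintro ⟨z, hz⟩ h
    obtain ⟨e, rfl⟩ := h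
    exact hf e)

theorem hlift_hk {i : ℕ} {M : Type} [AddCommGroup M] [Module ℚ M] (f : Zc i Y →ₗ[ℚ] M)
    (hf : ∀ e, f ⟨d (i + 1) e, d_mem_Zc e⟩ = 0) (z : Zc i Y) : hlift f hf (hk i Y z) = f z :=
  Submodule.liftQ_apply _ _ _

theorem cm_Zc {i : ℕ} (f : C(Y, Z)) {c : Ch (i + 1) Y} (hc : c ∈ Zc i Y) :
    cm f _ c ∈ Zc i Z := by
  rcases hc with h | h
  · exact Or.inl h
  · exact Or.inr (by rw [d_cm, h, map_zero])

theorem Zc_inc {i : ℕ} (f : C(Y, Z)) (hf : Function.Injective f) {c : Ch (i + 1) Y}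
    (hc : cm f _ c ∈ Zc i Z) : c ∈ Zc i Y := by
  rcases hc with h | h
  · exact Or.inl h
  · exact Or.inr (cm_inj f hf (by rw [← d_cm, h, map_zero]))

noncomputable def Zm (f : C(Y, Z)) (i : ℕ) : Zc i Y →ₗ[ℚ] Zc i Z :=
  (cm f (i + 1)).restrict fun _ hc => cm_Zc f hc

noncomputable def Hm (f : C(Y, Z)) (i : ℕ) : H i Y →ₗ[ℚ] H i Z :=
  hlift (hk i Z ∘ₗ Zm f i) fun e => (hk_eq_zero _).2 ⟨cm f _ e, d_cm _ _⟩

theorem Hm_hk (f : C(Y, Z)) (i : ℕ) (z : Zc i Y) :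
    Hm f i (hk i Y z) = hk i Z ⟨cm f _ z.1, cm_Zc f z.2⟩ := hlift_hk _ _ _

theorem Hm_comp (g : C(Y, Z)) (f : C(X, Y)) {i : ℕ} (x : H i X) :
    Hm g i (Hm f i x) = Hm (g.comp f) i x := by
  obtain ⟨z, rfl⟩ := hk_surj i x
  rw [Hm_hk, Hm_hk, Hm_hk]
  congr 2; exact cm_cm _ _ _

theorem Hm_id {i : ℕ} (x : H i X) : Hm (ContinuousMap.id X) i x = x := by
  obtain ⟨z, rfl⟩ := hk_surj i x
  rw [Hm_hk]
  congr 1; exact Subtype.ext (cm_id _)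

theorem d_Pr_cyc {i : ℕ} {c : Ch (i + 1) Y} (hc : c ∈ Zc i Y) :
    d (i + 1) (Pr (i + 1) c) = cm (ix 1 Y) _ c - cm (ix 0 Y) _ c := by
  rw [← d_Pr]
  rcases hc with h | h
  · subst h; rw [Pr_zero, add_zero]
  · rw [h, map_zero, add_zero]

theorem cm_homot {f g : C(Y, Z)} (h : f.Homotopic g) {i : ℕ} {c : Ch (i + 1) Y} (hc : c ∈ Zc i Y) :
    ∃ e, d (i + 1) e = cm g _ c - cm f _ c := by
  obtain ⟨F⟩ := h
  refine ⟨cm F.toContinuousMap _ (Pr (i + 1) c), ?_⟩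
  rw [d_cm, d_Pr_cyc hc, map_sub, cm_cm, cm_cm]
  congr 3 <;> ext y <;> simp

theorem Hm_homot {f g : C(Y, Z)} (h : f.Homotopic g) {i : ℕ} (x : H i Y) : Hm f i x = Hm g i x := by
  obtain ⟨z, rfl⟩ := hk_surj i x
  rw [Hm_hk, Hm_hk, eq_comm, hk_eq]
  exact cm_homot h z.2

/-! ### Paths and the circle class -/

/-- product of a path with a chain -/
noncomputable def Pp {K : Type} [TopologicalSpace K] (p : C(unitInterval, K)) (n : ℕ) :
    Ch n Y →ₗ[ℚ] Ch (n + 1) (K × Y) := cm (p.prodMap (ContinuousMap.id Y)) (n + 1) ∘ₗ Pr n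

abbrev kx {K : Type} [TopologicalSpace K] (k : K) (Y : Type) [TopologicalSpace Y] : C(Y, K × Y) :=
  (ContinuousMap.const Y k).prodMk (ContinuousMap.id Y)

theorem d_Pp {K : Type} [TopologicalSpace K] (p : C(unitInterval, K)) {i : ℕ} {c : Ch (i + 1) Y}
    (hc : c ∈ Zc i Y) : d (i + 1) (Pp p (i + 1) c) = cm (kx (p 1) Y) _ c - cm (kx (p 0) Y) _ c := by
  rw [Pp, LinearMap.comp_apply, d_cm, d_Pr_cyc hc, map_sub, cm_cm, cm_cm]; rfl

theorem snd_Pp {K : Type} [TopologicalSpace K] (p : C(unitInterval, K)) {n : ℕ} (c : Ch n Y) :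
    cm ContinuousMap.snd _ (Pp p n c) = 0 := by
  rw [Pp, LinearMap.comp_apply, cm_cm]; exact snd_Pr n c

theorem Pp_sup {K : Type} [TopologicalSpace K] (p : C(unitInterval, K)) {n : ℕ} (c : Ch n Y)
    {A : Set (K × Y)} (h : ∀ t y, (p t, y) ∈ A) : Pp p n c ∈ sup A (n + 1) :=
  cm_range _ (fun _ => h _ _) _

theorem contr {K : Type} [TopologicalSpace K] [ContractibleSpace K] {i : ℕ}
    {z : Ch (i + 1) (K × Y)} (hz : z ∈ Zc i (K × Y)) (h : ∃ b, d (i + 1) b = cm ContinuousMap.snd _ z) :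
    ∃ e, d (i + 1) e = z := by
  obtain ⟨k, hk⟩ := id_nullhomotopic K
  obtain ⟨F⟩ := hk
  have hh : ((kx k Y).comp ContinuousMap.snd).Homotopic (ContinuousMap.id (K × Y)) := by
    refine ContinuousMap.Homotopic.symm ⟨⟨⟨fun q => (F (q.1, q.2.1), q.2.2), by fun_prop⟩, ?_, ?_⟩⟩
    · intro x; simp
    · intro x; simp
  obtain ⟨e, he⟩ := cm_homot hh hz
  obtain ⟨b, hb⟩ := h
  refine ⟨e + cm (kx k Y) _ b, ?_⟩
  rw [map_add, he, d_cm, hb, cm_cm, cm_id]; abel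

noncomputable def ee : C(unitInterval, Circle) :=
  ⟨fun t => Circle.exp (2 * Real.pi * t), by fun_prop⟩

theorem ee_zero : ee 0 = 1 := by simp [ee]
theorem ee_one : ee 1 = 1 := by simp [ee]

theorem Pp_ee_Zc {i : ℕ} {c : Ch (i + 1) Y} (hc : c ∈ Zc i Y) :
    Pp ee (i + 1) c ∈ Zc (i + 1) (Circle × Y) := by
  apply Zc_of; rw [d_Pp ee hc, ee_zero, ee_one, sub_self]

theorem Pp_ee_bd {i : ℕ} (b : Ch (i + 2) Y) :
    Pp ee (i + 1) (d (i + 1) b) = d (i + 2) (- Pp ee (i + 2) b) := by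
  have := d_Pr (i + 1) b
  rw [Pp, LinearMap.comp_apply, eq_sub_of_add_eq' this, map_sub, map_sub, cm_cm, cm_cm, map_neg, Pp,
    LinearMap.comp_apply, d_cm, sub_eq_neg_self]
  have h : (ee.prodMap (ContinuousMap.id Y)).comp (ix 1 Y)
      = (ee.prodMap (ContinuousMap.id Y)).comp (ix 0 Y) := by
    ext y <;> simp [ee_zero, ee_one]
  rw [h, sub_self]

/-- the cross product with the fundamental class of the circle -/
noncomputable def sig (i : ℕ) (Y : Type) [TopologicalSpace Y] : H i Y →ₗ[ℚ] H (i + 1) (Circle × Y) :=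
  hlift (hk _ _ ∘ₗ (Pp ee (i + 1)).restrict fun _ hc => Pp_ee_Zc hc) fun e =>
    (hk_eq_zero _).2 ⟨_, (Pp_ee_bd e).symm⟩

theorem sig_hk (i : ℕ) (z : Zc i Y) :
    sig i Y (hk i Y z) = hk _ _ ⟨Pp ee (i + 1) z.1, Pp_ee_Zc z.2⟩ := hlift_hk _ _ _

noncomputable abbrev cx (f : C(Y, Z)) : C(Circle × Y, Circle × Z) := (ContinuousMap.id Circle).prodMap f

theorem sig_nat (f : C(Y, Z)) {i : ℕ} (x : H i Y) :
    sig i Z (Hm f i x) = Hm (cx f) (i + 1) (sig i Y x) := by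
  obtain ⟨z, rfl⟩ := hk_surj i x
  rw [Hm_hk, sig_hk, sig_hk, Hm_hk]
  congr 2
  simp only [Pp, LinearMap.comp_apply, Pr_cm, cm_cm]
  rfl

theorem snd_sig {i : ℕ} (x : H i Y) : Hm ContinuousMap.snd (i + 1) (sig i Y x) = 0 := by
  obtain ⟨z, rfl⟩ := hk_surj i x
  rw [sig_hk, Hm_hk, hk_eq_zero]
  exact ⟨0, by simp [snd_Pp]⟩

theorem const_sig (f : C(Circle × Y, Z)) (h : ∀ θ y, f (θ, y) = f (1, y)) {i : ℕ} (x : H i Y) :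
    Hm f (i + 1) (sig i Y x) = 0 := by
  have : f = (f.comp (kx 1 Y)).comp ContinuousMap.snd := by ext ⟨θ, y⟩; exact h θ y
  rw [this, ← Hm_comp, snd_sig, map_zero]

noncomputable def dg (Y : Type) [TopologicalSpace Y] : C(Circle × Y, Circle × (Circle × Y)) :=
  ⟨fun p => (p.1, p), by fun_prop⟩
noncomputable def dg1 (Y : Type) [TopologicalSpace Y] : C(Circle × Y, Circle × (Circle × Y)) :=
  ⟨fun p => (p.1, (1, p.2)), by fun_prop⟩
noncomputable def dg2 (Y : Type) [TopologicalSpace Y] : C(Circle × Y, Circle × (Circle × Y)) :=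
  ⟨fun p => (1, p), by fun_prop⟩

/-- pasting of paths in a contractible space -/
theorem paste {K : Type} [TopologicalSpace K] [ContractibleSpace K] (p q r : C(unitInterval, K))
    (h0 : r 0 = p 0) (h1 : p 1 = q 0) (h2 : r 1 = q 1) {i : ℕ} {c : Ch (i + 1) Y}
    (hc : c ∈ Zc i Y) :
    ∃ e, d (i + 2) e = Pp p (i + 1) c + Pp q (i + 1) c - Pp r (i + 1) c := by
  refine contr (Zc_of ?_) ⟨0, ?_⟩
  · rw [map_sub, map_add, d_Pp _ hc, d_Pp _ hc, d_Pp _ hc, h0, h1, h2]; abel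
  · simp only [map_sub, map_add, snd_Pp]; simp

theorem dg_sig {i : ℕ} (x : H i Y) : Hm (dg Y) (i + 1) (sig i Y x)
    = Hm (dg1 Y) (i + 1) (sig i Y x) + Hm (dg2 Y) (i + 1) (sig i Y x) := by
  obtain ⟨z, rfl⟩ := hk_surj i x
  obtain ⟨e, he⟩ := paste (K := ℝ × ℝ) ⟨fun t => ((t : ℝ), (0 : ℝ)), by fun_prop⟩
    ⟨fun t => ((1 : ℝ), (t : ℝ)), by fun_prop⟩ ⟨fun t => ((t : ℝ), (t : ℝ)), by fun_prop⟩
    (by simp) (by simp) (by simp) z.2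
  simp only [sig_hk, Hm_hk]
  rw [eq_comm, ← map_add, hk_eq]
  let E : C((ℝ × ℝ) × Y, Circle × (Circle × Y)) :=
    ⟨fun q => (Circle.exp (2 * Real.pi * q.1.1), (Circle.exp (2 * Real.pi * q.1.2), q.2)), by
      fun_prop⟩
  refine ⟨cm E _ e, ?_⟩
  rw [d_cm, he]
  simp only [map_sub, map_add, Pp, LinearMap.comp_apply, cm_cm, Submodule.coe_add]
  have h1 : E.comp (ContinuousMap.prodMap ⟨fun t : unitInterval => ((t : ℝ), (0 : ℝ)), by fun_prop⟩
      (ContinuousMap.id Y)) = (dg1 Y).comp (ee.prodMap (ContinuousMap.id Y)) := by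
    ext q : 1; simp [E, dg1, ee]
  have h2 : E.comp (ContinuousMap.prodMap ⟨fun t : unitInterval => ((1 : ℝ), (t : ℝ)), by fun_prop⟩
      (ContinuousMap.id Y)) = (dg2 Y).comp (ee.prodMap (ContinuousMap.id Y)) := by
    ext q : 1; simp [E, dg2, ee]; rfl
  rw [h1, h2]; rfl

/-- F(α,α,y) = F(α,1,y) + F(1,α,y) -/
theorem diag_sig (F : C(Circle × (Circle × Y), Z)) {i : ℕ} (x : H i Y) :
    Hm (F.comp (dg Y)) (i + 1) (sig i Y x)
    = Hm (F.comp (dg1 Y)) (i + 1) (sig i Y x) + Hm (F.comp (dg2 Y)) (i + 1) (sig i Y x) := by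
  rw [← Hm_comp, ← Hm_comp, ← Hm_comp, dg_sig, map_add]

theorem inv_sig (F : C(Circle × Y, Z)) {i : ℕ} (x : H i Y) :
    Hm (F.comp ⟨fun p => (p.1⁻¹, p.2), by fun_prop⟩) (i + 1) (sig i Y x)
      = - Hm F (i + 1) (sig i Y x) := by
  have h := diag_sig (F.comp ⟨fun p : Circle × (Circle × Y) => (p.1 * p.2.1⁻¹, p.2.2), by fun_prop⟩) x
  rw [const_sig _ (fun θ y => by simp [dg])] at h
  rw [eq_neg_iff_add_eq_zero]
  refine (h.trans ((add_comm _ _).trans ?_)).symm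
  congr 3 <;> ext p <;> simp [dg1, dg2]

theorem sq_sig (F : C(Circle × Y, Z)) {i : ℕ} (x : H i Y) :
    Hm (F.comp ⟨fun p => (p.1 * p.1, p.2), by fun_prop⟩) (i + 1) (sig i Y x)
      = (2 : ℚ) • Hm F (i + 1) (sig i Y x) := by
  have h := diag_sig (F.comp ⟨fun p : Circle × (Circle × Y) => (p.1 * p.2.1, p.2.2), by fun_prop⟩) x
  rw [two_smul]
  refine Eq.trans ?_ (h.trans ?_)
  · congr 2
  · congr 3 <;> ext p <;> simp [dg1, dg2]

end
end OC

set_option linter.all false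

namespace OC
open Cvx

section
variable {X Y Z : Type} [TopologicalSpace X] [TopologicalSpace Y] [TopologicalSpace Z]

/-! ### Splitting chains over disjoint opens -/

instance (n : ℕ) : PreconnectedSpace (Dl n) :=
  Subtype.preconnectedSpace (convex_stdSimplex ℝ (Fin n)).isPreconnected

instance (n : ℕ) : Nonempty (Dl (n + 1)) := ⟨⟨_, single_mem_stdSimplex ℝ 0⟩⟩

theorem sup_bot {n : ℕ} {c : Ch (n + 1) Y} (hc : c ∈ sup (∅ : Set Y) (n + 1)) : c = 0 := by
  have : LinearMap.id (R := ℚ) c ∈ (⊥ : Submodule ℚ (Ch (n + 1) Y)) :=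
    sup_ind (fun s hs => (hs (Classical.arbitrary (Dl (n + 1)))).elim) hc
  simpa using this

theorem sup_sum {ι : Type} [Fintype ι] {B : ι → Set Y} (hB : ∀ j k, j ≠ k → Disjoint (B j) (B k))
    {n : ℕ} {f : ι → Ch (n + 1) Y} (hf : ∀ j, f j ∈ sup (B j) (n + 1)) {A : Set Y}
    (h : ∑ j, f j ∈ sup A (n + 1)) (j : ι) : f j ∈ sup A (n + 1) := by
  rw [sup, Finsupp.mem_supported'] at h ⊢
  intro s hs
  by_contra h0
  have h1 : ∀ k ≠ j, f k s = 0 := by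
    intro k hk
    by_contra h2
    have e1 := hf j; have e2 := hf k
    rw [sup, Finsupp.mem_supported'] at e1 e2
    have t : Dl (n + 1) := Classical.arbitrary _
    exact Set.disjoint_left.1 (hB k j hk) (by_contra fun h' => h2 (e2 s fun h3 => h' (h3 t)))
      (by_contra fun h' => h0 (e1 s fun h3 => h' (h3 t)))
  have := h s hs
  rw [Finsupp.finset_sum_apply, Finset.sum_eq_single j (fun k _ hk => h1 k hk) (by simp)] at this
  exact h0 this

theorem sup_iUnion {ι : Type} [Fintype ι] {B : ι → Set Y} (hB : ∀ j k, j ≠ k → Disjoint (B j) (B k))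
    (ho : ∀ j, IsOpen (B j)) {n : ℕ} {c : Ch (n + 1) Y} (hc : c ∈ sup (⋃ j, B j) (n + 1)) :
    ∃ f : ι → Ch (n + 1) Y, (∀ j, f j ∈ sup (B j) (n + 1)) ∧ ∑ j, f j = c := by
  classical
  have : LinearMap.id (R := ℚ) c ∈ ⨆ j, sup (B j) (n + 1) := by
    refine sup_ind (fun s hs => ?_) hc
    obtain ⟨j, hj⟩ := Set.mem_iUnion.1 (hs (Classical.arbitrary _))
    refine Submodule.mem_iSup_of_mem j (sg_mem (T := C(Dl (n + 1), Y)) ?_)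
    have hcl : IsClopen (s ⁻¹' B j) := by
      refine ⟨⟨?_⟩, (ho j).preimage s.continuous⟩
      have : (s ⁻¹' B j)ᶜ = s ⁻¹' ⋃ k : {k // k ≠ j}, B k := by
        ext t
        simp only [Set.mem_compl_iff, Set.mem_preimage, Set.mem_iUnion]
        constructor
        · intro h
          obtain ⟨k, hk⟩ := Set.mem_iUnion.1 (hs t)
          exact ⟨⟨k, fun e => h (e ▸ hk)⟩, hk⟩
        · rintro ⟨⟨k, hk⟩, h⟩ h'
          exact Set.disjoint_left.1 (hB k j hk) h h'
      rw [this]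
      exact (isOpen_iUnion fun k : {k // k ≠ j} => ho k.1).preimage s.continuous
    have := hcl.eq_univ ⟨_, hj⟩
    exact fun t => (this ▸ Set.mem_univ t : t ∈ s ⁻¹' B j)
  rw [LinearMap.id_apply, Submodule.mem_iSup_iff_exists_finsupp] at this
  obtain ⟨f, hf, h⟩ := this
  exact ⟨f, hf, by rw [← h, Finsupp.sum_fintype _ _ (fun _ => rfl)]⟩

/-! ### Cycles over star shaped pieces -/

abbrev sect (S : Set ℂ) (Q : Set ℂ) (Y : Type) : Set (Q × Y) := {p | p.1.1 ∈ S}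

theorem loc {S Q : Set ℂ} (hS : ContractibleSpace S) (k : Q) (hk : k.1 ∈ S) (hSQ : S ⊆ Q)
    {i : ℕ} {z : Ch (i + 1) (Q × Y)} (hz : z ∈ Zc i (Q × Y)) (hz' : z ∈ sup (sect S Q Y) (i + 1)) :
    ∃ f ∈ sup (sect S Q Y) (i + 2), d (i + 1) f = z - cm (kx k Y) _ (cm ContinuousMap.snd _ z) ∧
      cm ContinuousMap.snd _ f = 0 := by
  obtain ⟨z1, rfl⟩ := sup_lift hz'
  let k' : S := ⟨k.1, hk⟩
  let a : C(sect S Q Y, S × Y) := ⟨fun p => (⟨p.1.1.1, p.2⟩, p.1.2), by fun_prop⟩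
  let b : C(S × Y, Q × Y) := ⟨fun p => (⟨p.1.1, hSQ p.1.2⟩, p.2), by fun_prop⟩
  have hab : b.comp a = inc _ := rfl
  have hbk : b.comp (kx k' Y) = kx k Y := rfl
  have hsb : ContinuousMap.snd.comp b = (ContinuousMap.snd : C(S × Y, Y)) := rfl
  set z2 := cm a _ z1 with hz2
  have e1 : cm (inc _) _ z1 = cm b _ z2 := by rw [hz2, cm_cm]; rfl
  have hzz : z2 ∈ Zc i (S × Y) := cm_Zc a (Zc_inc (inc _) Subtype.val_injective hz)
  have e2 : cm ContinuousMap.snd _ (cm b _ z2) = cm ContinuousMap.snd _ z2 := by rw [cm_cm, hsb]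
  rw [e1, e2, ← hbk, ← cm_cm]
  obtain ⟨f, hf⟩ := contr (K := S) (Y := Y)
    (z := z2 - cm (kx k' Y) _ (cm ContinuousMap.snd _ z2))
    (sub_mem hzz (cm_Zc _ (cm_Zc _ hzz))) ⟨0, by
      rw [map_sub, cm_cm (f := kx _ _)]
      exact (by rw [map_zero, eq_comm, sub_eq_zero]; exact (cm_id _).symm)⟩
  let g : Ch (i + 2) (S × Y) := f - cm (kx k' Y) _ (cm ContinuousMap.snd _ f)
  refine ⟨cm b _ g, cm_range _ (fun p => p.1.2) _, ?_, ?_⟩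
  · rw [d_cm, ← map_sub]
    congr 1
    rw [map_sub, hf, d_cm, d_cm, hf, map_sub, map_sub]
    have : cm ContinuousMap.snd (i + 1) (cm (kx k' Y) (i + 1)
        (cm (ContinuousMap.snd : C(S × Y, Y)) _ z2)) = cm ContinuousMap.snd _ z2 := by
      rw [cm_cm (f := kx _ _)]; exact cm_id _
    rw [this]; abel
  · rw [cm_cm, hsb, map_sub, cm_cm (f := kx _ _), sub_eq_zero]; exact (cm_id _).symm

/-! ### Half circles -/

noncomputable def eu : C(unitInterval, Circle) := ⟨fun t => Circle.exp (Real.pi * t), by fun_prop⟩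
noncomputable def ed : C(unitInterval, Circle) :=
  ⟨fun t => Circle.exp (Real.pi + Real.pi * t), by fun_prop⟩

theorem halves {i : ℕ} {c : Ch (i + 1) Y} (hc : c ∈ Zc i Y) :
    ∃ e, d (i + 2) e = Pp eu (i + 1) c + Pp ed (i + 1) c - Pp ee (i + 1) c := by
  obtain ⟨e, he⟩ := paste (K := ℝ) ⟨fun t => Real.pi * t, by fun_prop⟩
    ⟨fun t => Real.pi + Real.pi * t, by fun_prop⟩ ⟨fun t => 2 * Real.pi * t, by fun_prop⟩
    (by simp) (by simp) (by simp; ring) hc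
  refine ⟨cm ((⟨fun t => Circle.exp t, by fun_prop⟩ : C(ℝ, Circle)).prodMap (ContinuousMap.id Y)) _ e, ?_⟩
  rw [d_cm, he]
  simp only [map_sub, map_add, Pp, LinearMap.comp_apply, cm_cm]
  rfl

theorem Pp_cm {K K' : Type} [TopologicalSpace K] [TopologicalSpace K'] (g : C(K, K'))
    (p : C(unitInterval, K)) {n : ℕ} (c : Ch n Y) :
    cm (g.prodMap (ContinuousMap.id Y)) _ (Pp p n c) = Pp (g.comp p) n c := by
  simp only [Pp, LinearMap.comp_apply, cm_cm]; rfl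

theorem eu0 : eu 0 = 1 := by simp [eu]
theorem eu1 : (eu 1 : ℂ) = -1 := by simp [eu]
theorem ed0 : (ed 0 : ℂ) = -1 := by simp [ed]
theorem ed1 : ed 1 = 1 := by
  apply Circle.ext; simp [ed, add_mul, Complex.exp_add]
theorem eu_im (t) : 0 ≤ (eu t : ℂ).im := by
  simp only [eu, ContinuousMap.coe_mk, Circle.coe_exp, Complex.exp_ofReal_mul_I_im]
  exact Real.sin_nonneg_of_nonneg_of_le_pi (by have := t.2.1; positivity)
    (by nlinarith [t.2.2, Real.pi_pos])
theorem ed_im (t) : (ed t : ℂ).im ≤ 0 := by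
  simp only [ed, ContinuousMap.coe_mk, Circle.coe_exp, Complex.exp_ofReal_mul_I_im]
  rw [add_comm, Real.sin_add_pi, neg_nonpos]
  exact Real.sin_nonneg_of_nonneg_of_le_pi (by have := t.2.1; positivity)
    (by nlinarith [t.2.2, Real.pi_pos])

end
end OC

set_option linter.all false

namespace OC
open Cvx

section
variable {X Y Z : Type} [TopologicalSpace X] [TopologicalSpace Y] [TopologicalSpace Z]

/-- classes of the form [circle] × y -/
noncomputable def SG : (i : ℕ) → (Y : Type) → [TopologicalSpace Y] → Submodule ℚ (H i (Circle × Y))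
  | 0, _, _ => ⊥
  | i + 1, Y, _ => LinearMap.range (sig i Y)

abbrev Cst : Set ℂ := {z | z ≠ 0}
noncomputable def cc : C(Circle, Cst) := ⟨fun t => ⟨t, t.coe_ne_zero⟩, by fun_prop⟩
noncomputable abbrev ccx (Y : Type) [TopologicalSpace Y] : C(Circle × Y, Cst × Y) :=
  cc.prodMap (ContinuousMap.id Y)

theorem star_half (s : ℝ) (hs : s * s = 1) : StarConvex ℝ (s • Complex.I) {z : ℂ | 0 < s * z.im ∨ z.re ≠ 0} := by
  rintro z hz a b ha hb hab
  simp only [Set.mem_setOf_eq, Complex.add_im, Complex.add_re, Complex.smul_im, Complex.smul_re,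
    Complex.I_re, Complex.I_im, smul_eq_mul, mul_zero, zero_add, mul_one] at hz ⊢
  have h1 : s * (a * s + b * z.im) = a + b * (s * z.im) := by linear_combination a * hs
  rw [h1]
  rcases hb.eq_or_lt with h | h
  · left; subst h; simp; linarith
  · rcases hz with h' | h'
    · left; positivity
    · right; exact mul_ne_zero h.ne' h'

theorem contr_half (s : ℝ) (hs : s * s = 1) :
    ContractibleSpace ({z : ℂ | 0 < s * z.im ∨ z.re ≠ 0} : Set ℂ) :=
  (star_half s hs).contractibleSpace ⟨s • Complex.I, Or.inl (by simp [hs])⟩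

theorem contr_side (s : ℝ) (hs : s * s = 1) : ContractibleSpace ({z : ℂ | 0 < s * z.re} : Set ℂ) := by
  refine Convex.contractibleSpace (fun x hx y hy a b ha hb hab => ?_) ⟨s, by simp [hs]⟩
  simp only [Set.mem_setOf_eq, Complex.add_re, Complex.smul_re, smul_eq_mul] at *
  have : s * (a * x.re + b * y.re) = a * (s * x.re) + b * (s * y.re) := by ring
  rw [this]
  rcases ha.eq_or_lt with h | h
  · subst h; simp at hab; subst hab; simpa using hy
  · positivity

theorem klem {i : ℕ} (x : H i (Cst × Y)) (hx : Hm ContinuousMap.snd i x = 0) :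
    ∃ w ∈ SG i Y, Hm (ccx Y) i w = x := by
  obtain ⟨⟨z, hz⟩, rfl⟩ := hk_surj i x
  rw [Hm_hk, hk_eq_zero] at hx
  obtain ⟨b, hb⟩ := hx
  simp only at hb
  set US : Set ℂ := {z : ℂ | 0 < (1 : ℝ) * z.im ∨ z.re ≠ 0} with hUS
  set DS : Set ℂ := {z : ℂ | 0 < (-1 : ℝ) * z.im ∨ z.re ≠ 0} with hDS
  have hSQ : ∀ s : ℝ, {z : ℂ | 0 < s * z.im ∨ z.re ≠ 0} ⊆ Cst := by
    rintro s z (h | h) rfl <;> simp at h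
  have hU : IsOpen (sect US Cst Y) := by
    apply IsOpen.union
    · exact isOpen_lt (f := fun _ => (0 : ℝ)) (g := fun p : Cst × Y => _ * p.1.1.im) (by fun_prop) (by fun_prop)
    · exact isOpen_ne_fun (f := fun p : Cst × Y => p.1.1.re) (by fun_prop) continuous_const
  have hD : IsOpen (sect DS Cst Y) := by
    apply IsOpen.union
    · exact isOpen_lt (f := fun _ => (0 : ℝ)) (g := fun p : Cst × Y => _ * p.1.1.im) (by fun_prop) (by fun_prop)
    · exact isOpen_ne_fun (f := fun p : Cst × Y => p.1.1.re) (by fun_prop) continuous_const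
  have hUD : ∀ y : Cst × Y, y ∈ sect US Cst Y ∨ y ∈ sect DS Cst Y := by
    rintro ⟨⟨w, hw⟩, y⟩
    simp only [Set.mem_setOf_eq, hUS, hDS]
    by_contra! h
    exact hw (Complex.ext h.1.2 (by simp; linarith [h.1.1, h.2.1]))
  have hdz : d i z ∈ sup (sect US Cst Y) i ⊔ sup (sect DS Cst Y) i := by
    rcases hz with h | h
    · subst h; exact Submodule.mem_sup_left (mem_univ (fun s t => (by have := t.2.2; simp at this)) _)
    · rw [h]; exact zero_mem _
  obtain ⟨u, hu, v, hv, e0, hc⟩ := small_chains hU hD hUD z hdz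
  have hp1 : ((1 : ℝ) * 1 = 1) := by norm_num
  have hm1 : ((-1 : ℝ) * -1 = 1) := by norm_num
  have one_U : (1 : ℂ) ∈ US := by simp [hUS]
  have one_D : (1 : ℂ) ∈ DS := by simp [hDS]
  have mone_U : (-1 : ℂ) ∈ US := by simp [hUS]
  have mone_D : (-1 : ℂ) ∈ DS := by simp [hDS]
  let k1 : Cst := ⟨1, one_ne_zero⟩
  let km : Cst := ⟨-1, by simp⟩
  have snd_kx : ∀ (k : Cst) {n : ℕ} (c : Ch n Y), cm ContinuousMap.snd n (cm (kx k Y) n c) = c := by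
    intro k n c; rw [cm_cm (f := kx _ _)]; exact cm_id _
  have hsz : cm ContinuousMap.snd _ u + cm ContinuousMap.snd _ v
      = d (i + 1) (b - cm ContinuousMap.snd _ e0) := by
    rw [map_sub, hb, d_cm, hc, map_add, map_add]; abel
  rcases i with _ | i
  · refine ⟨0, zero_mem _, ?_⟩
    rw [map_zero, eq_comm, hk_eq_zero]
    obtain ⟨f, -, hf, -⟩ := loc (contr_half 1 hp1) k1 one_U (hSQ 1) (Or.inl rfl) hu
    obtain ⟨g, -, hg, -⟩ := loc (contr_half (-1) hm1) k1 one_D (hSQ (-1)) (Or.inl rfl) hv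
    refine ⟨f + g + cm (kx k1 Y) _ (b - cm ContinuousMap.snd _ e0) + e0, ?_⟩
    rw [map_add, map_add, map_add, hf, hg, d_cm, ← hsz, map_add]
    simp only [hc]; abel
  have hz0 : d (i + 1) z = 0 := by
    rcases hz with h | h
    · simp at h
    · exact h
  have huv : d (i + 1) u = - d (i + 1) v := by
    rw [eq_neg_iff_add_eq_zero, ← map_add, ← add_zero (u + v), ← sub_self (d (i + 2) e0), ← add_sub_assoc, ← hc,
      map_sub, hz0, d_d, sub_self]
  let RL : Bool → Set (Cst × Y) := fun b => sect {z | 0 < (bif b then (1 : ℝ) else -1) * z.re} Cst Y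
  have hRL : ∀ j k, j ≠ k → Disjoint (RL j) (RL k) := by
    intro j k hjk
    rw [Set.disjoint_left]
    rintro p h1 h2
    simp only [RL, Set.mem_setOf_eq] at h1 h2
    cases j <;> cases k <;> simp at hjk h1 h2 <;> linarith
  have hRLo : ∀ j, IsOpen (RL j) := fun j =>
    isOpen_lt (f := fun _ => (0 : ℝ)) (g := fun p : Cst × Y => _ * p.1.1.re) (by fun_prop) (by fun_prop)
  have hdu : d (i + 1) u ∈ sup (⋃ j, RL j) (i + 1) := by
    refine sup_mono ?_ (sup_inter (d_sup hu) (huv ▸ neg_mem (d_sup hv)))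
    rintro ⟨w, y⟩ ⟨h1, h2⟩
    simp only [Set.mem_setOf_eq, hUS, hDS] at h1 h2
    rw [Set.mem_iUnion]
    have : w.1.re ≠ 0 := by
      rcases h1 with h1 | h1
      · rcases h2 with h2 | h2
        · linarith
        · exact h2
      · exact h1
    rcases lt_or_gt_of_ne this with h | h
    · exact ⟨false, by simp [RL, h]⟩
    · exact ⟨true, by simp [RL, h]⟩
  obtain ⟨f, hf, hfs⟩ := sup_iUnion hRL hRLo hdu
  have hfZ : ∀ j, f j ∈ Zc i (Cst × Y) := by
    rcases i with _ | i
    · exact fun _ => Or.inl rfl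
    · intro j
      refine Zc_of (sup_bot (sup_sum hRL (fun j => d_sup (hf j)) (A := ∅) ?_ j))
      rw [← map_sum, hfs, d_d]; exact zero_mem _
  rw [Fintype.sum_bool] at hfs
  obtain ⟨fR, hR, hdR, hsR⟩ := loc (contr_side 1 hp1) k1 (by simp [k1])
    (by rintro z h rfl; simp at h) (hfZ true) (hf true)
  obtain ⟨fL, hL, hdL, hsL⟩ := loc (contr_side (-1) hm1) km (by simp [km])
    (by rintro z h rfl; simp at h) (hfZ false) (hf false)
  set c := cm (ContinuousMap.snd : C(Cst × Y, Y)) _ (f true) with hcdef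
  set cL := cm (ContinuousMap.snd : C(Cst × Y, Y)) _ (f false) with hcL
  have hcZ : c ∈ Zc i Y := cm_Zc _ (hfZ true)
  have hccL : cL = d (i + 1) (cm ContinuousMap.snd _ u) - c := by
    rw [d_cm, ← hfs, map_add]; abel
  have hccL' : cL = - d (i + 1) (cm ContinuousMap.snd _ v) - c := by
    rw [hccL, d_cm, d_cm, huv, map_neg]
  have q0 : (cc.comp eu) 0 = k1 := by simp [eu0, cc, k1]
  have q1 : (cc.comp eu) 1 = km := by simp [eu1, cc, km]
  have q2 : (cc.comp ed) 0 = km := by simp [ed0, cc, km]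
  have q3 : (cc.comp ed) 1 = k1 := by simp [ed1, cc, k1]
  have hRU : ∀ (b : Bool) (s : ℝ), sect {z | 0 < (bif b then (1 : ℝ) else -1) * z.re} Cst Y ⊆
      sect {z : ℂ | 0 < s * z.im ∨ z.re ≠ 0} Cst Y := by
    rintro b s ⟨w, y⟩ h
    refine Or.inr fun h0 => ?_
    simp only [Set.mem_setOf_eq] at h
    rw [h0] at h; simp at h
  have im0 : ∀ (θ : Circle), (θ : ℂ).im = 0 → (θ : ℂ).re ≠ 0 := fun θ h h' =>
    θ.coe_ne_zero (Complex.ext h' h)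
  have hPU : Pp (cc.comp eu) (i + 1) c ∈ sup (sect US Cst Y) (i + 2) := by
    refine Pp_sup _ _ fun t y => ?_
    rcases (eu_im t).lt_or_eq with h | h
    · exact Or.inl (by simpa [cc] using h)
    · exact Or.inr (im0 _ h.symm)
  have hPD : Pp (cc.comp ed) (i + 1) c ∈ sup (sect DS Cst Y) (i + 2) := by
    refine Pp_sup _ _ fun t y => ?_
    rcases (ed_im t).lt_or_eq with h | h
    · exact Or.inl (by simpa [cc] using h)
    · exact Or.inr (im0 _ h)
  have kmU : ∀ {n} (c : Ch n Y), cm (kx km Y) n c ∈ sup (sect US Cst Y) n := fun c =>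
    cm_range _ (fun _ => mone_U) _
  have kmD : ∀ {n} (c : Ch n Y), cm (kx km Y) n c ∈ sup (sect DS Cst Y) n := fun c =>
    cm_range _ (fun _ => mone_D) _
  obtain ⟨gU, -, hgU, -⟩ := loc (contr_half 1 hp1) k1 one_U (hSQ 1)
    (z := u - fR - fL - cm (kx km Y) _ (cm ContinuousMap.snd _ u) + Pp (cc.comp eu) (i + 1) c)
    (Zc_of (by
      simp only [map_add, map_sub]
      rw [← hfs, hdR, hdL, d_Pp _ hcZ, d_cm, q0, q1, hccL, map_sub]; abel))
    (add_mem (sub_mem (sub_mem (sub_mem hu (sup_mono (hRU true 1) hR))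
      (sup_mono (hRU false 1) hL)) (kmU _)) hPU)
  obtain ⟨gD, -, hgD, -⟩ := loc (contr_half (-1) hm1) k1 one_D (hSQ (-1))
    (z := v + fR + fL - cm (kx km Y) _ (cm ContinuousMap.snd _ v) + Pp (cc.comp ed) (i + 1) c)
    (Zc_of (by
      simp only [map_add, map_sub]
      rw [← neg_neg (d (i + 1) v), ← huv, ← hfs, hdR, hdL, d_Pp _ hcZ, d_cm, q2, q3, hccL', map_sub,
        map_neg]; abel))
    (add_mem (sub_mem (add_mem (add_mem hv (sup_mono (hRU true (-1)) hR))
      (sup_mono (hRU false (-1)) hL)) (kmD _)) hPD)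
  simp only [map_add, map_sub, snd_Pp, hsR, hsL, snd_kx] at hgU hgD
  simp only [sub_zero, add_zero, sub_self, map_zero] at hgU hgD
  obtain ⟨h, hh⟩ := halves hcZ
  refine ⟨sig i Y (hk i Y ⟨-c, neg_mem hcZ⟩), ⟨_, rfl⟩, ?_⟩
  rw [sig_hk, Hm_hk, eq_comm, hk_eq]
  simp only [map_neg]
  refine ⟨gU + gD + cm (kx km Y) _ (b - cm ContinuousMap.snd _ e0) + e0 - cm (ccx Y) _ h, ?_⟩
  simp only [map_add, map_sub (d (i + 2))]
  rw [hgU, hgD, d_cm, ← hsz, map_add, d_cm, hh, map_sub, map_add, Pp_cm, Pp_cm, Pp_cm, hc]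
  abel

end
end OC

set_option linter.all false

namespace OC
open Cvx

section
variable {X Y Z : Type} [TopologicalSpace X] [TopologicalSpace Y] [TopologicalSpace Z]

/-! ### Torus classes -/

theorem d_Pp' {K : Type} [TopologicalSpace K] (p : C(unitInterval, K)) {n : ℕ} (c : Ch (n + 1) Y) :
    d (n + 1) (Pp p (n + 1) c) = cm (kx (p 1) Y) _ c - cm (kx (p 0) Y) _ c - Pp p n (d n c) := by
  rw [Pp, LinearMap.comp_apply, d_cm, eq_sub_of_add_eq (d_Pr n c), map_sub, map_sub, cm_cm, cm_cm]; rfl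

noncomputable def s2 (i : ℕ) (Y : Type) [TopologicalSpace Y] : H i Y →ₗ[ℚ] H (i + 2) (Circle × (Circle × Y)) :=
  sig (i + 1) _ ∘ₗ sig i Y

def sw (K : Type) [TopologicalSpace K] (Y : Type) [TopologicalSpace Y] : C(K × (K × Y), K × (K × Y)) :=
  ⟨fun p => (p.2.1, (p.1, p.2.2)), by fun_prop⟩

theorem sw_s2 {i : ℕ} (x : H i Y) : Hm (sw Circle Y) (i + 2) (s2 i Y x) = - s2 i Y x := by
  obtain ⟨⟨c, hc⟩, rfl⟩ := hk_surj i x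
  let ι : C(unitInterval, ℝ) := ⟨fun t => t, by fun_prop⟩
  have h1 : ∀ a : ℝ, cm (sw ℝ Y) _ (cm (kx a (ℝ × Y)) _ (Pp ι (i + 1) c)) = Pp ι _ (cm (kx a Y) _ c) := by
    intro a; simp only [Pp, LinearMap.comp_apply, cm_cm, Pr_cm]; rfl
  have h2 : ∀ a : ℝ, cm (sw ℝ Y) _ (Pp ι _ (cm (kx a Y) _ c)) = cm (kx a (ℝ × Y)) _ (Pp ι (i + 1) c) := by
    intro a; simp only [Pp, LinearMap.comp_apply, cm_cm, Pr_cm]; rfl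
  obtain ⟨e, he⟩ := contr (K := ℝ) (Y := ℝ × Y) (i := i + 2)
    (z := Pp ι (i + 2) (Pp ι (i + 1) c) + cm (sw ℝ Y) _ (Pp ι (i + 2) (Pp ι (i + 1) c))) (Zc_of (by
      rw [map_add, d_cm, d_Pp', d_Pp _ hc]
      simp only [map_sub, h1, h2]; abel)) ⟨0, by
      rw [map_zero, map_add, snd_Pp, zero_add, cm_cm]
      have : (ContinuousMap.snd).comp (sw ℝ Y) = (ContinuousMap.id ℝ).prodMap (ContinuousMap.snd : C(ℝ × Y, Y)) := rfl
      rw [this]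
      have h : ∀ w : Ch (i + 2) (ℝ × Y), cm ((ContinuousMap.id ℝ).prodMap (ContinuousMap.snd : C(ℝ × Y, Y))) _
        (Pp ι (i + 2) w) = Pp ι _ (cm ContinuousMap.snd _ w) := by
        intro w; simp only [Pp, LinearMap.comp_apply, cm_cm, Pr_cm]; rfl
      rw [h, snd_Pp, map_zero]⟩
  rw [eq_neg_iff_add_eq_zero, s2, LinearMap.comp_apply, sig_hk, sig_hk, Hm_hk, ← map_add, hk_eq_zero]
  let E : C(ℝ × (ℝ × Y), Circle × (Circle × Y)) :=
    ⟨fun q => (Circle.exp (2 * Real.pi * q.1), (Circle.exp (2 * Real.pi * q.2.1), q.2.2)), by fun_prop⟩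
  refine ⟨cm E _ e, ?_⟩
  rw [d_cm, he, map_add]
  refine (add_comm _ _).trans ?_
  simp only [Pp, LinearMap.comp_apply, cm_cm, Pr_cm, Submodule.coe_add]; rfl

/-- push-forward of torus classes -/
noncomputable def Tc (F : C(Circle × (Circle × Y), Z)) {i : ℕ} (x : H i Y) : H (i + 2) Z :=
  Hm F (i + 2) (s2 i Y x)

theorem Tc_homot {F G : C(Circle × (Circle × Y), Z)} (h : F.Homotopic G) {i : ℕ} (x : H i Y) :
    Tc F x = Tc G x := Hm_homot h _

theorem Tc_swap (F G : C(Circle × (Circle × Y), Z)) (h : ∀ α β y, G (α, (β, y)) = F (β, (α, y)))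
    {i : ℕ} (x : H i Y) : Tc G x = - Tc F x := by
  have : G = F.comp (sw Circle Y) := by ext ⟨α, β, y⟩; exact h _ _ _
  rw [Tc, this, ← Hm_comp, sw_s2, map_neg]; rfl

theorem Tc_mul (F : C(Circle × (Circle × Y), Z)) (h : ∀ α β y, F (α, (β, y)) = F (1, (α * β, y)))
    {i : ℕ} (x : H i Y) : Tc F x = 0 := by
  have := Tc_swap F F (fun α β y => by rw [h, h β α, mul_comm]) x
  rw [eq_neg_iff_add_eq_zero, ← two_smul ℚ] at this
  exact (smul_eq_zero.1 this).resolve_left (by norm_num)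

theorem Tc_shear (F G : C(Circle × (Circle × Y), Z)) (h : ∀ α β y, G (α, (β, y)) = F (α, (α * β, y)))
    {i : ℕ} (x : H i Y) : Tc G x = Tc F x := by
  have := diag_sig (Y := Circle × Y) (F.comp ⟨fun p : Circle × (Circle × (Circle × Y)) =>
    (p.1, (p.2.1 * p.2.2.1, p.2.2.2)), by fun_prop⟩) (sig i Y x)
  refine Eq.trans ?_ (this.trans ((congrArg₂ (· + ·) ?_ ?_).trans (add_zero (Tc F x))))
  · rw [Tc]; congr 2; ext p; exact h _ _ _
  · rw [Tc]; congr 2; ext ⟨α, β, y⟩; simp [dg1]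
  · exact Tc_mul _ (fun α β y => by simp [dg2]) x

theorem Tc_shear' (F G : C(Circle × (Circle × Y), Z)) (h : ∀ α β y, G (α, (β, y)) = F (α * β, (β, y)))
    {i : ℕ} (x : H i Y) : Tc G x = Tc F x := by
  have h1 := Tc_swap F (F.comp (sw _ _)) (fun _ _ _ => rfl) x
  have h2 := Tc_swap G (G.comp (sw _ _)) (fun _ _ _ => rfl) x
  have h3 := Tc_shear (F.comp (sw _ _)) (G.comp (sw _ _)) (fun α β y => by simp [sw, h, mul_comm]) x
  rw [h1, h2] at h3; exact neg_injective h3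

/-! ### Pair of pants -/

abbrev Qp : Set ℂ := {z | z ≠ 0 ∧ z ≠ 1 / 2}

theorem contr_pants (s : ℝ) (hs : s * s = 1) : ContractibleSpace ({z : ℂ | 0 ≤ s * z.im} ∩ Qp : Set ℂ) := by
  refine StarConvex.contractibleSpace (x := s • Complex.I) ?_ ⟨1, by simp, by norm_num [Qp]⟩
  rintro z ⟨hz, hz1⟩ a b ha hb hab
  have him : s * (a • s • Complex.I + b • z).im = a + b * (s * z.im) := by
    simp; linear_combination a * hs
  have hz' : (0 : ℝ) ≤ s * z.im := hz
  refine ⟨?_, ?_⟩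
  · rw [Set.mem_setOf_eq, him]; positivity
  · rcases ha.eq_or_lt with h | h
    · subst h; simp at hab; subst hab; simpa using hz1
    · have : (a • s • Complex.I + b • z).im ≠ 0 := by
        intro h0; rw [h0] at him
        have : 0 < a + b * (s * z.im) := by positivity
        simp at him; linarith
      constructor
      · intro h0; rw [h0] at this; simp at this
      · intro h0; rw [h0] at this; simp at this

/-- circle of radius r about x0 -/
noncomputable def gq (x0 r : ℝ) (h : ∀ θ : Circle, (x0 + r * θ : ℂ) ∈ Qp) : C(Circle, Qp) :=
  ⟨fun θ => ⟨x0 + r * θ, h θ⟩, by fun_prop⟩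

theorem gq_mem (x0 r : ℝ) (h0 : |x0| ≠ |r|) (h1 : |1 / 2 - x0| ≠ |r|) (θ : Circle) :
    (x0 + r * θ : ℂ) ∈ Qp := by
  have hr : ‖(r * θ : ℂ)‖ = |r| := by
    rw [norm_mul, Circle.norm_coe, Complex.norm_real, Real.norm_eq_abs, mul_one]
  constructor
  · intro h
    have : (r * θ : ℂ) = ((-x0 : ℝ) : ℂ) := by push_cast; linear_combination h
    rw [this, Complex.norm_real, Real.norm_eq_abs, abs_neg] at hr; exact h0 hr
  · intro h
    have : (r * θ : ℂ) = ((1 / 2 - x0 : ℝ) : ℂ) := by push_cast; linear_combination h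
    rw [this, Complex.norm_real, Real.norm_eq_abs] at hr; exact h1 hr

theorem pants_mem (x : ℝ) (h0 : x ≠ 0) (h1 : x ≠ 1 / 2) : (x : ℂ) ∈ Qp :=
  ⟨by exact_mod_cast h0, fun h => h1 (by
    have h2 : (x : ℂ) = ((1 / 2 : ℝ) : ℂ) := by rw [h]; norm_num
    exact_mod_cast h2)⟩

theorem pants (F : C(Qp × Y, Z)) {i : ℕ} (x : H i Y) (hI h0 h1) :
    Hm (F.comp ((gq 0 1 hI).prodMap (ContinuousMap.id Y))) (i + 1) (sig i Y x)
    = Hm (F.comp ((gq 0 (1 / 8) h0).prodMap (ContinuousMap.id Y))) (i + 1) (sig i Y x)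
    + Hm (F.comp ((gq (1 / 2) (1 / 8) h1).prodMap (ContinuousMap.id Y))) (i + 1) (sig i Y x) := by
  rw [← Hm_comp, ← Hm_comp, ← Hm_comp, ← map_add]
  congr 1
  obtain ⟨⟨c, hc⟩, rfl⟩ := hk_surj i x
  simp only [sig_hk, Hm_hk]
  rw [← map_add, hk_eq]
  obtain ⟨e, he⟩ := halves hc
  set gI := gq 0 1 hI with hgI
  set g0 := gq 0 (1 / 8) h0 with hg0
  set g1 := gq (1 / 2) (1 / 8) h1 with hg1
  let S1 : C(unitInterval, Qp) := ⟨fun t => ⟨((1 - 3 / 8 * t : ℝ) : ℂ), pants_mem _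
    (by have := t.2.2; intro h; linarith) (by have := t.2.2; intro h; linarith)⟩, by fun_prop⟩
  let S2 : C(unitInterval, Qp) := ⟨fun t => ⟨((3 / 8 - 1 / 4 * t : ℝ) : ℂ), pants_mem _
    (by have := t.2.2; intro h; linarith) (by have := t.2.1; intro h; linarith)⟩, by fun_prop⟩
  let S3 : C(unitInterval, Qp) := ⟨fun t => ⟨((-1 / 8 - 7 / 8 * t : ℝ) : ℂ), pants_mem _
    (by have := t.2.1; intro h; linarith) (by have := t.2.1; intro h; linarith)⟩, by fun_prop⟩
  have a1 : (S1 0) = (gI.comp eu) 0 := Subtype.ext (by simp [S1, hgI, gq, eu0])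
  have a2 : (S1 1) = (g1.comp eu) 0 := Subtype.ext (by simp [S1, hg1, gq, eu0]; norm_num)
  have a3 : (S2 0) = (g1.comp eu) 1 := Subtype.ext (by simp [S2, hg1, gq, eu1]; norm_num)
  have a4 : (S2 1) = (g0.comp eu) 0 := Subtype.ext (by simp [S2, hg0, gq, eu0]; norm_num)
  have a5 : (S3 0) = (g0.comp eu) 1 := Subtype.ext (by simp [S3, hg0, gq, eu1]; norm_num)
  have a6 : (S3 1) = (gI.comp eu) 1 := Subtype.ext (by simp [S3, hgI, gq, eu1]; norm_num)
  have b1 : ∀ g : C(Circle, Qp), (g.comp ed) 0 = (g.comp eu) 1 := fun g => congrArg g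
    (Circle.ext (by rw [ed0, eu1]))
  have b2 : ∀ g : C(Circle, Qp), (g.comp ed) 1 = (g.comp eu) 0 := fun g => congrArg g
    (by rw [ed1, eu0])
  have sp : ∀ (s : ℝ) (p : C(unitInterval, Qp)), (∀ t, 0 ≤ s * (p t).1.im) →
      Pp p (i + 1) c ∈ sup (sect ({z : ℂ | 0 ≤ s * z.im} ∩ Qp) Qp Y) (i + 2) := fun s p h =>
    Pp_sup _ _ fun t y => ⟨h t, (p t).2⟩
  have s1 : ∀ s t, 0 ≤ s * (S1 t).1.im := fun s t => by simp only [S1, ContinuousMap.coe_mk, Complex.ofReal_im]; simp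
  have s2 : ∀ s t, 0 ≤ s * (S2 t).1.im := fun s t => by simp only [S2, ContinuousMap.coe_mk, Complex.ofReal_im]; simp
  have s3 : ∀ s t, 0 ≤ s * (S3 t).1.im := fun s t => by simp only [S3, ContinuousMap.coe_mk, Complex.ofReal_im]; simp
  have gim : ∀ (x0 r : ℝ) h θ, (gq x0 r h θ).1.im = r * (θ : ℂ).im := fun x0 r h θ => by simp [gq]
  have su : ∀ (x0 r : ℝ) h, 0 < r → ∀ t, 0 ≤ (1 : ℝ) * (((gq x0 r h).comp eu) t).1.im := fun x0 r h hr t => by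
    rw [ContinuousMap.comp_apply, gim, one_mul]; exact mul_nonneg hr.le (eu_im t)
  have sd : ∀ (x0 r : ℝ) h, 0 < r → ∀ t, 0 ≤ (-1 : ℝ) * (((gq x0 r h).comp ed) t).1.im := fun x0 r h hr t => by
    rw [ContinuousMap.comp_apply, gim]; nlinarith [ed_im t]
  have p1 : (1 : ℂ) ∈ Qp := by norm_num [Qp]
  obtain ⟨U, -, hU, -⟩ := loc (contr_pants 1 (by norm_num)) ⟨1, p1⟩ ⟨by simp, p1⟩ Set.inter_subset_right
    (z := Pp S1 (i + 1) c + Pp (g1.comp eu) (i + 1) c + Pp S2 (i + 1) c + Pp (g0.comp eu) (i + 1) c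
      + Pp S3 (i + 1) c - Pp (gI.comp eu) (i + 1) c) (Zc_of (by
        simp only [map_add, map_sub, d_Pp _ hc, a1, a2, a3, a4, a5, a6]; abel))
    (sub_mem (add_mem (add_mem (add_mem (add_mem (sp _ _ (s1 _)) (sp _ _ (su _ _ _ (by norm_num))))
      (sp _ _ (s2 _))) (sp _ _ (su _ _ _ (by norm_num)))) (sp _ _ (s3 _))) (sp _ _ (su _ _ _ (by norm_num))))
  obtain ⟨D, -, hD, -⟩ := loc (contr_pants (-1) (by norm_num)) ⟨1, p1⟩ ⟨by simp, p1⟩ Set.inter_subset_right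
    (z := Pp (g1.comp ed) (i + 1) c - Pp S1 (i + 1) c - Pp S2 (i + 1) c + Pp (g0.comp ed) (i + 1) c
      - Pp S3 (i + 1) c - Pp (gI.comp ed) (i + 1) c) (Zc_of (by
        simp only [map_add, map_sub, d_Pp _ hc, a1, a2, a3, a4, a5, a6, b1, b2]; abel))
    (sub_mem (sub_mem (add_mem (sub_mem (sub_mem (sp _ _ (sd _ _ _ (by norm_num))) (sp _ _ (s1 _)))
      (sp _ _ (s2 _))) (sp _ _ (sd _ _ _ (by norm_num)))) (sp _ _ (s3 _))) (sp _ _ (sd _ _ _ (by norm_num))))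
  simp only [map_add, map_sub, snd_Pp] at hU hD
  simp only [sub_zero, add_zero, map_zero] at hU hD
  refine ⟨cm (g0.prodMap (ContinuousMap.id Y)) _ e + cm (g1.prodMap (ContinuousMap.id Y)) _ e
    - cm (gI.prodMap (ContinuousMap.id Y)) _ e - U - D, ?_⟩
  simp only [map_add, map_sub, d_cm, he, hU, hD, Pp_cm, Submodule.coe_add]
  abel

end
end OC

set_option linter.all false

namespace OC
open Cvx

section
variable {X Y Z : Type} [TopologicalSpace X] [TopologicalSpace Y] [TopologicalSpace Z]

theorem sup_pre (f : C(Y, Z)) (hf : Function.Injective f) {A : Set Z} {n : ℕ} {c : Ch n Y}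
    (h : cm f n c ∈ sup A n) : c ∈ sup (f ⁻¹' A) n := by
  rw [sup, Finsupp.mem_supported'] at h ⊢
  intro s hs
  have := h (f.comp s) hs
  have hi : Function.Injective fun s : C(Dl n, Y) => f.comp s := fun s s' hs => by
    ext t; exact hf (DFunLike.congr_fun hs t)
  rwa [show cm f n c = Finsupp.mapDomain (fun s : C(Dl n, Y) => f.comp s) c from rfl,
    Finsupp.mapDomain_apply hi] at this

/-- removing a family of punctures -/
theorem L0 {E : Type} [TopologicalSpace E] {A : Set E} (hA : IsOpen A) {m : ℕ} {B : Fin m → Set E}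
    (hBo : ∀ j, IsOpen (B j)) (hBd : ∀ j k, j ≠ k → Disjoint (B j) (B k))
    (hAB : ∀ e, e ∈ A ∨ e ∈ ⋃ j, B j) (φ : Fin m → C(ℂ × Y, E)) (ψ : ∀ j, C(B j, ℂ × Y))
    (h1 : ∀ j b, φ j (ψ j b) = b.1) (h2 : ∀ j b, b.1 ∈ A → (ψ j b).1 ≠ 0)
    (h3 : ∀ j w y, w ≠ 0 → φ j (w, y) ∈ A) {i : ℕ} (x : H i A) (hx : Hm (inc A) i x = 0) :
    ∃ w : Fin m → H i (Circle × Y), (∀ j, w j ∈ SG i Y) ∧ x = ∑ j, Hm (⟨fun p => ⟨φ j (p.1, p.2),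
      h3 j _ _ p.1.coe_ne_zero⟩, by fun_prop⟩ : C(Circle × Y, A)) i (w j) := by
  obtain ⟨⟨z, hz⟩, rfl⟩ := hk_surj i x
  rw [Hm_hk, hk_eq_zero] at hx
  obtain ⟨c, hc⟩ := hx
  simp only at hc
  obtain ⟨a, ha, b, hb, e', hcab⟩ := small_chains hA (isOpen_iUnion hBo) hAB c
    (Submodule.mem_sup_left (hc ▸ cm_range _ (fun y => y.2) _))
  obtain ⟨f, hf, hfb⟩ := sup_iUnion hBd hBo hb
  have hsum : ∑ j, d (i + 1) (f j) = cm (inc A) _ z - d (i + 1) a := by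
    rw [← map_sum, hfb, ← hc, hcab, map_add, map_add, d_d]; abel
  have hfA : ∀ j, d (i + 1) (f j) ∈ sup A (i + 1) := by
    refine sup_sum hBd (fun j => d_sup (hf j)) ?_
    rw [hsum]
    exact sub_mem (cm_range _ (fun y => y.2) _) (d_sup ha)
  choose f' hf' using fun j => sup_lift (hf j)
  obtain ⟨a', rfl⟩ := sup_lift ha
  let ic : C(Cst × Y, ℂ × Y) := (inc Cst).prodMap (ContinuousMap.id Y)
  have hic : Function.Injective ic := fun p q h => Prod.ext (Subtype.ext (congrArg (fun q => q.1) h : _))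
    (congrArg (fun q : ℂ × Y => q.2) h : _)
  have hq : ∀ j, ∃ q : Ch (i + 1) (Cst × Y), cm ic _ q = d (i + 1) (cm (ψ j) _ (f' j)) := by
    intro j
    have e1 : d (i + 1) (f' j) ∈ sup (inc (B j) ⁻¹' A) (i + 1) := by
      refine sup_pre (inc (B j)) Subtype.val_injective ?_
      rw [← d_cm, hf']; exact hfA j
    have e2 : cm (ψ j) _ (d (i + 1) (f' j)) ∈ sup {p : ℂ × Y | p.1 ≠ 0} (i + 1) :=
      cm_sup _ (fun b hb => h2 j b hb) e1
    obtain ⟨q, hq⟩ := sup_lift e2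
    refine ⟨cm ⟨fun p => (⟨p.1.1, p.2⟩, p.1.2), by fun_prop⟩ _ q, ?_⟩
    rw [cm_cm, d_cm, ← hq]; rfl
  choose q hq using hq
  have hqZ : ∀ j, q j ∈ Zc i (Cst × Y) := fun j =>
    Zc_inc ic hic (by rw [hq]; exact d_mem_Zc _)
  have hk' := fun j => klem (hk _ _ ⟨q j, hqZ j⟩) (by
    rw [Hm_hk, hk_eq_zero]
    refine ⟨cm ContinuousMap.snd _ (cm (ψ j) _ (f' j)), ?_⟩
    rw [d_cm, ← hq, cm_cm]; rfl)
  choose w hw hwq using hk'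
  refine ⟨w, hw, ?_⟩
  let φA : Fin m → C(Cst × Y, A) := fun j => ⟨fun p => ⟨φ j (p.1, p.2), h3 j _ _ p.1.2⟩, by fun_prop⟩
  have e3 : ∀ j, Hm (⟨fun p => ⟨φ j (p.1, p.2), h3 j _ _ p.1.coe_ne_zero⟩, by fun_prop⟩ :
      C(Circle × Y, A)) i (w j) = hk i A ⟨cm (φA j) _ (q j), cm_Zc _ (hqZ j)⟩ := by
    intro j
    exact ((Hm_comp (φA j) (ccx Y) (w j)).symm.trans (congrArg _ (hwq j))).trans (Hm_hk _ _ _)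
  simp only [e3]
  rw [← map_sum, hk_eq]
  refine ⟨a', cm_inj (inc A) Subtype.val_injective ?_⟩
  simp only [AddSubmonoidClass.coe_finset_sum, map_sub, map_sum]
  rw [← d_cm, eq_sub_iff_add_eq, ← eq_sub_iff_add_eq', ← hsum]
  refine Finset.sum_congr rfl fun j _ => ?_
  rw [cm_cm, ← hf', d_cm]
  have : (inc A).comp (φA j) = (φ j).comp ic := rfl
  rw [this, ← cm_cm, hq, ← d_cm, cm_cm, ← d_cm]
  have : (φ j).comp (ψ j) = inc (B j) := ContinuousMap.ext fun b => h1 j b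
  rw [this]

/-! ### Configuration spaces -/

variable {B : Type} [TopologicalSpace B]

abbrev Es {r : ℕ} (s : Fin r → C(B, ℂ)) (m : ℕ) : Set (B × (Fin m → ℂ)) :=
  {p | Function.Injective p.2 ∧ ∀ k l, p.2 k ≠ s l p.1}

variable {r : ℕ} {s : Fin r → C(B, ℂ)} {m : ℕ}

def pm (s : Fin r → C(B, ℂ)) (γ : Equiv.Perm (Fin m)) : C(Es s m, Es s m) :=
  ⟨fun p => ⟨(p.1.1, fun k => p.1.2 (γ k)), p.2.1.comp γ.injective, fun k l => p.2.2 _ _⟩, by fun_prop⟩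

noncomputable def Iq (s : Fin r → C(B, ℂ)) (m i : ℕ) : Submodule ℚ (H i (Es s m)) :=
  Submodule.span ℚ {x | ∃ γ y, x = Hm (pm s γ) i y - y}

abbrev HQ (s : Fin r → C(B, ℂ)) (m i : ℕ) : Type := H i (Es s m) ⧸ Iq s m i

noncomputable abbrev cl (s : Fin r → C(B, ℂ)) (m i : ℕ) : H i (Es s m) →ₗ[ℚ] HQ s m i := (Iq s m i).mkQ

theorem cl_pm (γ : Equiv.Perm (Fin m)) {i : ℕ} (x : H i (Es s m)) : cl s m i (Hm (pm s γ) i x) = cl s m i x :=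
  (Submodule.Quotient.eq _).2 (Submodule.subset_span ⟨γ, x, rfl⟩)

theorem cl_map {i i' r' m' : ℕ} {B' : Type} [TopologicalSpace B'] {t : Fin r' → C(B', ℂ)}
    (T : H i (Es s m) →ₗ[ℚ] H i' (Es t m'))
    (hT : ∀ γ, ∃ γ', ∀ x, T (Hm (pm s γ) i x) = Hm (pm t γ') i' (T x)) {x y : H i (Es s m)}
    (h : cl s m i x = cl s m i y) : cl t m' i' (T x) = cl t m' i' (T y) := by
  rw [← sub_eq_zero, ← map_sub, ← map_sub]
  have h' : x - y ∈ Iq s m i := (Submodule.Quotient.eq _).1 h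
  have : Iq s m i ≤ LinearMap.ker (cl t m' i' ∘ₗ T) := by
    refine Submodule.span_le.2 ?_
    rintro _ ⟨γ, x, rfl⟩
    obtain ⟨γ', h⟩ := hT γ
    rw [SetLike.mem_coe, LinearMap.mem_ker, LinearMap.comp_apply, map_sub, h, map_sub, cl_pm, sub_self]
  exact this h'

noncomputable def Nm (s : Fin r → C(B, ℂ)) (m i : ℕ) : H i (Es s m) →ₗ[ℚ] H i (Es s m) :=
  ∑ γ : Equiv.Perm (Fin m), Hm (pm s γ) i

theorem cl_Nm {i : ℕ} (x : H i (Es s m)) : cl s m i (Nm s m i x) = (m.factorial : ℚ) • cl s m i x := by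
  rw [Nm, LinearMap.sum_apply, map_sum]
  simp only [cl_pm]
  rw [Finset.sum_const, Finset.card_univ, Fintype.card_perm, Fintype.card_fin, Nat.cast_smul_eq_nsmul]

theorem Nm_Iq {i : ℕ} {x : H i (Es s m)} (h : cl s m i x = 0) : Nm s m i x = 0 := by
  have h' : x ∈ Iq s m i := (Submodule.Quotient.mk_eq_zero _).1 h
  have : Iq s m i ≤ LinearMap.ker (Nm s m i) := by
    refine Submodule.span_le.2 ?_
    rintro _ ⟨γ, x, rfl⟩
    simp only [SetLike.mem_coe, LinearMap.mem_ker, map_sub, sub_eq_zero, Nm, LinearMap.sum_apply, Hm_comp]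
    exact Fintype.sum_equiv (Equiv.mulLeft γ) _ _ fun γ' => rfl
  exact this h'

/-! ### Removing a section -/

section
variable (s : Fin (r + 1) → C(B, ℂ))

noncomputable def rho (m : ℕ) (p : B × (Fin m → ℂ)) : ℝ :=
  (∏ l : Fin r, min 1 ‖s l.succ p.1 - s 0 p.1‖) * ∏ k, min 1 ‖p.2 k - s 0 p.1‖

theorem rho_cont (m : ℕ) : Continuous (rho s m) := by
  unfold rho
  refine Continuous.mul (continuous_finset_prod _ fun l _ => ?_) (continuous_finset_prod _ fun l _ => ?_) <;> fun_prop

theorem prod_le_fac {ι : Type} [Fintype ι] (f : ι → ℝ) (j : ι) (h : ∀ i, 0 ≤ f i) (h1 : ∀ i, f i ≤ 1) :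
    ∏ i, f i ≤ f j := by
  classical
  rw [← Finset.mul_prod_erase _ _ (Finset.mem_univ j)]
  exact mul_le_of_le_one_right (h j) (Finset.prod_le_one (fun i _ => h i) fun i _ => h1 i)

theorem rho_nonneg (m : ℕ) (p) : 0 ≤ rho s m p := by unfold rho; positivity

theorem rho_le_one (m : ℕ) (p) : rho s m p ≤ 1 := by
  unfold rho
  exact mul_le_one₀ (Finset.prod_le_one (fun _ _ => by positivity) fun _ _ => min_le_left _ _)
    (by positivity) (Finset.prod_le_one (fun _ _ => by positivity) fun _ _ => min_le_left _ _)

theorem rho_le_z {m : ℕ} (p : B × (Fin m → ℂ)) (k : Fin m) : rho s m p ≤ ‖p.2 k - s 0 p.1‖ :=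
  (mul_le_of_le_one_left (by positivity)
    (Finset.prod_le_one (fun _ _ => by positivity) fun _ _ => min_le_left _ _)).trans
    ((prod_le_fac _ k (fun _ => by positivity) fun _ => min_le_left _ _).trans (min_le_right _ _))

theorem rho_le_s {m : ℕ} (p : B × (Fin m → ℂ)) (l : Fin r) : rho s m p ≤ ‖s l.succ p.1 - s 0 p.1‖ :=
  (mul_le_of_le_one_right (by positivity)
    (Finset.prod_le_one (fun _ _ => by positivity) fun _ _ => min_le_left _ _)).trans
    ((prod_le_fac _ l (fun _ => by positivity) fun _ => min_le_left _ _).trans (min_le_right _ _))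

variable {s}

theorem rho_pos' (hs : ∀ b, Function.Injective fun l => s l b) {m : ℕ} {p : B × (Fin m → ℂ)} (h : ∀ k, p.2 k ≠ s 0 p.1) : 0 < rho s m p := by
  unfold rho
  refine mul_pos (Finset.prod_pos fun l _ => lt_min one_pos (norm_pos_iff.2 (sub_ne_zero.2 fun h => ?_)))
    (Finset.prod_pos fun k _ => lt_min one_pos (norm_pos_iff.2 (sub_ne_zero.2 (h k))))
  exact Fin.succ_ne_zero l (hs p.1 h)

theorem rho_pos (hs : ∀ b, Function.Injective fun l => s l b) {m : ℕ} (p : Es s m) : 0 < rho s m p := rho_pos' hs fun k => p.2.2 k 0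

end
end
end OC

set_option linter.all false

namespace OC
open Cvx

section
variable {B : Type} [TopologicalSpace B] {r m : ℕ}

theorem cons_cont {Y : Type} [TopologicalSpace Y] {f : Y → ℂ} {g : Y → Fin m → ℂ} (hf : Continuous f)
    (hg : Continuous g) : Continuous fun y => (Fin.cons (f y) (g y) : Fin (m + 1) → ℂ) := by
  refine continuous_pi fun k => ?_
  refine Fin.cases ?_ (fun k => ?_) k
  · simpa using hf
  · simp only [Fin.cons_succ]; exact (continuous_apply k).comp hg

theorem cons_inj {x : ℂ} {z : Fin m → ℂ} (h : ∀ k, x ≠ z k) (hz : Function.Injective z) :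
    Function.Injective (Fin.cons x z : Fin (m + 1) → ℂ) :=
  Fin.cons_injective_iff.2 ⟨fun ⟨k, hk⟩ => h k hk.symm, hz⟩

noncomputable def shr (w : ℂ) : ℂ := w / (max 1 (2 * ‖w‖) : ℝ)
theorem shr_cont : Continuous shr := by
  unfold shr
  refine continuous_id.div (by fun_prop) fun w => ?_
  have : (0 : ℝ) < max 1 (2 * ‖w‖) := lt_max_of_lt_left one_pos
  exact_mod_cast this.ne'
theorem shr_le (w : ℂ) : ‖shr w‖ ≤ 1 / 2 := by
  have : (0 : ℝ) < max 1 (2 * ‖w‖) := lt_max_of_lt_left one_pos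
  rw [shr, norm_div, Complex.norm_real, Real.norm_eq_abs, abs_of_pos this, div_le_div_iff₀ this two_pos]
  linarith [le_max_right 1 (2 * ‖w‖)]
theorem shr_ne {w : ℂ} (h : w ≠ 0) : shr w ≠ 0 := by
  have : (0 : ℝ) < max 1 (2 * ‖w‖) := lt_max_of_lt_left one_pos
  exact div_ne_zero h (by exact_mod_cast this.ne')
theorem shr_eq {w : ℂ} (h : ‖w‖ ≤ 1 / 2) : shr w = w := by
  rw [shr, max_eq_left (by linarith)]; simp
theorem shr_circ (w : Circle) : shr w = w / 2 := by
  rw [shr, Circle.norm_coe]; norm_num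

variable {s : Fin (r + 1) → C(B, ℂ)}

abbrev tl (s : Fin (r + 1) → C(B, ℂ)) : Fin r → C(B, ℂ) := fun l => s l.succ

theorem near (hs : ∀ b, Function.Injective fun l => s l b) (p : Es s m) {x : ℂ}
    (hx : ‖x - s 0 p.1.1‖ ≤ rho s m p / 2) : (∀ k, x ≠ p.1.2 k) ∧ ∀ l, x ≠ tl s l p.1.1 := by
  have h0 := rho_pos hs p
  refine ⟨fun k h => ?_, fun l h => ?_⟩
  · have := rho_le_z s p.1 k; rw [← h] at this; linarith
  · have := rho_le_s s p.1 l; rw [show s l.succ p.1.1 = x from h.symm] at this; linarith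

theorem near_mem (hs : ∀ b, Function.Injective fun l => s l b) (p : Es s m) {w : ℂ} (hw : ‖w‖ ≤ 1 / 2) :
    ‖s 0 p.1.1 + rho s m p * w - s 0 p.1.1‖ ≤ rho s m p / 2 := by
  have h0 := rho_pos hs p
  rw [add_sub_cancel_left, norm_mul, Complex.norm_real, Real.norm_eq_abs, abs_of_pos h0]
  nlinarith

/-- inserting a point near the first section -/
noncomputable def phi0 (hs : ∀ b, Function.Injective fun l => s l b) (m : ℕ) :
    C(ℂ × Es s m, Es (tl s) (m + 1)) :=
  ⟨fun q => ⟨(q.2.1.1, Fin.cons (s 0 q.2.1.1 + rho s m q.2 * shr q.1) q.2.1.2),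
    cons_inj (near hs q.2 (near_mem hs q.2 (shr_le _))).1 q.2.2.1, fun k l => by
      refine Fin.cases ?_ (fun k => ?_) k
      · exact (near hs q.2 (near_mem hs q.2 (shr_le _))).2 l
      · exact q.2.2.2 k l.succ⟩, by
    refine Continuous.subtype_mk (Continuous.prodMk (by fun_prop) (cons_cont ?_ (by fun_prop))) _
    have := rho_cont s m
    have := shr_cont
    fun_prop⟩

theorem circ_half (θ : Circle) : ‖(θ / 2 : ℂ)‖ ≤ 1 / 2 := by rw [norm_div, Circle.norm_coe]; simp

noncomputable def tau (hs : ∀ b, Function.Injective fun l => s l b) (m : ℕ) :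
    C(Circle × Es s m, Es s (m + 1)) :=
  ⟨fun q => ⟨(q.2.1.1, Fin.cons (s 0 q.2.1.1 + rho s m q.2 * (q.1 / 2)) q.2.1.2),
    cons_inj (near hs q.2 (near_mem hs q.2 (circ_half _))).1 q.2.2.1, fun k l => by
      refine Fin.cases ?_ (fun k => ?_) k
      · refine Fin.cases ?_ (fun l => ?_) l
        · simp only [Fin.cons_zero, ne_eq, add_eq_left]
          have := (rho_pos hs q.2).ne'
          simp [this]
        · exact (near hs q.2 (near_mem hs q.2 (circ_half _))).2 l
      · exact q.2.2.2 k l⟩, by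
    refine Continuous.subtype_mk (Continuous.prodMk (by fun_prop) (cons_cont ?_ (by fun_prop))) _
    have := rho_cont s m
    fun_prop⟩

def incl (s : Fin (r + 1) → C(B, ℂ)) (m : ℕ) : C(Es s m, Es (tl s) m) :=
  ⟨fun p => ⟨p.1, p.2.1, fun k l => p.2.2 k l.succ⟩, by fun_prop⟩

theorem L1a (hs : ∀ b, Function.Injective fun l => s l b) {i : ℕ} (x : H i (Es s (m + 1)))
    (hx : Hm (incl s (m + 1)) i x = 0) : ∃ w ∈ SG i (Es s m),
      cl s (m + 1) i x = cl s (m + 1) i (Hm (tau hs m) i w) := by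
  let E := Es (tl s) (m + 1)
  let A : Set E := {p | ∀ k, p.1.2 k ≠ s 0 p.1.1}
  let B0 : Set E := {p | ‖p.1.2 0 - s 0 p.1.1‖ < rho s m (p.1.1, fun k => p.1.2 k.succ) / 2}
  let Bj : Fin (m + 1) → Set E := fun j => pm (tl s) (Equiv.swap 0 j) ⁻¹' B0
  have hrc := rho_cont s m
  have hB0 : IsOpen B0 := isOpen_lt (f := fun p : E => ‖p.1.2 0 - s 0 p.1.1‖)
    (g := fun p : E => rho s m (p.1.1, fun k => p.1.2 k.succ) / 2) (by fun_prop) (by fun_prop)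
  have hB0A : ∀ p ∈ B0, ∀ k : Fin m, ‖p.1.2 0 - s 0 p.1.1‖ < ‖p.1.2 k.succ - s 0 p.1.1‖ := by
    intro p hp k
    have h1 := rho_le_z s (p.1.1, fun k => p.1.2 k.succ) k
    have h2 : ‖p.1.2 0 - s 0 p.1.1‖ < rho s m (p.1.1, fun k => p.1.2 k.succ) / 2 := hp
    have h3 := norm_nonneg (p.1.2 0 - s 0 p.1.1)
    simp only at h1
    linarith
  have hBjA : ∀ j, ∀ p ∈ Bj j, ∀ k ≠ j, ‖p.1.2 j - s 0 p.1.1‖ < ‖p.1.2 k - s 0 p.1.1‖ := by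
    intro j p hp k hk
    have hk0 : Equiv.swap 0 j k ≠ 0 := fun h => hk (by
      rw [Equiv.swap_apply_eq_iff, Equiv.swap_apply_left] at h; exact h)
    obtain ⟨k', hk'⟩ := Fin.exists_succ_eq.2 hk0
    have h1 := hB0A _ hp k'
    simp only [pm, ContinuousMap.coe_mk, Equiv.swap_apply_left, hk', Equiv.swap_apply_self] at h1
    exact h1
  let psi0 : C(B0, ℂ × Es s m) := ⟨fun p => ((p.1.1.2 0 - s 0 p.1.1.1) / (rho s m (p.1.1.1, fun k => p.1.1.2 k.succ) : ℝ),
    ⟨(p.1.1.1, fun k => p.1.1.2 k.succ), fun a b h => Fin.succ_injective _ (p.1.2.1 h), fun k l => by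
      refine Fin.cases ?_ (fun l => ?_) l
      · intro h
        have := hB0A _ p.2 k
        simp only at h
        rw [h, sub_self, norm_zero] at this
        exact absurd this (norm_nonneg _).not_gt
      · exact p.1.2.2 k.succ l⟩), by
    refine Continuous.prodMk (Continuous.div (by fun_prop) (by fun_prop) fun p => ?_) (by fun_prop)
    have h2 : ‖p.1.1.2 0 - s 0 p.1.1.1‖ < rho s m (p.1.1.1, fun k => p.1.1.2 k.succ) / 2 := p.2
    have h3 := norm_nonneg (p.1.1.2 0 - s 0 p.1.1.1)
    have : 0 < rho s m (p.1.1.1, fun k => p.1.1.2 k.succ) := by linarith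
    exact_mod_cast this.ne'⟩
  have hpp0 : ∀ p, phi0 hs m (psi0 p) = p.1 := by
    intro p
    have h2 : ‖p.1.1.2 0 - s 0 p.1.1.1‖ < rho s m (p.1.1.1, fun k => p.1.1.2 k.succ) / 2 := p.2
    have h3 := norm_nonneg (p.1.1.2 0 - s 0 p.1.1.1)
    have h4 : 0 < rho s m (p.1.1.1, fun k => p.1.1.2 k.succ) := by linarith
    refine Subtype.ext (Prod.ext rfl (funext fun k => ?_))
    refine Fin.cases ?_ (fun k => rfl) k
    simp only [phi0, psi0, ContinuousMap.coe_mk, Fin.cons_zero]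
    rw [shr_eq, mul_div_cancel₀]
    · ring
    · exact_mod_cast h4.ne'
    · rw [norm_div, Complex.norm_real, Real.norm_eq_abs, abs_of_pos h4, div_le_iff₀ h4]; linarith
  have hphi : ∀ w y, w ≠ 0 → phi0 hs m (w, y) ∈ A := by
    intro w y hw k
    refine Fin.cases ?_ (fun k => ?_) k
    · have := (rho_pos hs y).ne'
      simp [phi0, shr_ne hw, this]
    · exact y.2.2 k 0
  let hAf : C(Es s (m + 1), A) := ⟨fun p => ⟨incl s _ p, fun k => p.2.2 k 0⟩, by fun_prop⟩
  let hAb : C(A, Es s (m + 1)) := ⟨fun p => ⟨p.1.1, p.1.2.1, fun k l => by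
    refine Fin.cases (p.2 k) (fun l => p.1.2.2 k l) l⟩, by fun_prop⟩
  have hsq : ∀ j (p : E), pm (tl s) (Equiv.swap 0 j) (pm (tl s) (Equiv.swap 0 j) p) = p := fun j p =>
    Subtype.ext (Prod.ext rfl (funext fun k => by simp [pm]))
  obtain ⟨w, hw, hxw⟩ := L0 (E := E) (A := A) (m := m + 1) (B := Bj) (Y := Es s m)
    (by
      have : A = ⋂ k, {p : E | p.1.2 k ≠ s 0 p.1.1} := by ext; simp [A]
      rw [this]
      exact isOpen_iInter_of_finite fun k => isOpen_ne_fun (by fun_prop) (by fun_prop))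
    (fun j => hB0.preimage (pm _ _).continuous)
    (fun j k hjk => Set.disjoint_left.2 fun p hj hk => (hBjA j p hj k hjk.symm).not_gt (hBjA k p hk j hjk))
    (fun p => by
      by_cases hp : p ∈ A
      · exact Or.inl hp
      · right
        simp only [A, Set.mem_setOf_eq, not_forall, not_not] at hp
        obtain ⟨j, hj⟩ := hp
        refine Set.mem_iUnion.2 ⟨j, ?_⟩
        show ‖p.1.2 (Equiv.swap 0 j 0) - s 0 p.1.1‖ < rho s m (p.1.1, fun k : Fin m => p.1.2 (Equiv.swap 0 j k.succ)) / 2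
        rw [Equiv.swap_apply_left, hj, sub_self, norm_zero]
        refine half_pos (rho_pos' hs fun k h => ?_)
        have h1 := p.2.1 (h.trans hj.symm)
        rw [Equiv.swap_apply_eq_iff, Equiv.swap_apply_right] at h1
        exact Fin.succ_ne_zero _ h1)
    (fun j => (pm _ (Equiv.swap 0 j)).comp (phi0 hs m))
    (fun j => psi0.comp ⟨fun p => ⟨pm _ (Equiv.swap 0 j) p.1, p.2⟩, by fun_prop⟩)
    (fun j p => by
      simp only [ContinuousMap.comp_apply, hpp0, ContinuousMap.coe_mk, hsq])
    (fun j p hp => by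
      have h2 : ‖p.1.1.2 (Equiv.swap 0 j 0) - s 0 p.1.1.1‖ < rho s m (p.1.1.1, fun k : Fin m => p.1.1.2 (Equiv.swap 0 j k.succ)) / 2 := p.2
      have h3 := norm_nonneg (p.1.1.2 (Equiv.swap 0 j 0) - s 0 p.1.1.1)
      have h4 : 0 < rho s m (p.1.1.1, fun k : Fin m => p.1.1.2 (Equiv.swap 0 j k.succ)) := by linarith
      refine div_ne_zero (sub_ne_zero.2 (hp _)) ?_
      exact_mod_cast h4.ne')
    (fun j w y hw k => hphi w y hw _) (Hm hAf i x) (by rw [Hm_comp]; exact hx)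
  refine ⟨∑ j, w j, sum_mem fun j _ => hw j, ?_⟩
  have hx' : x = Hm hAb i (Hm hAf i x) := by
    rw [Hm_comp]; exact (Hm_id x).symm
  rw [hx', hxw]
  simp only [map_sum]
  refine Finset.sum_congr rfl fun j _ => ?_
  rw [← cl_pm (Equiv.swap 0 j) (Hm (tau hs m) i (w j)), Hm_comp, Hm_comp]
  congr 3
  ext q : 1
  refine Subtype.ext (Prod.ext rfl (funext fun k => ?_))
  simp only [hAb, pm, tau, phi0, ContinuousMap.comp_apply, ContinuousMap.coe_mk, shr_circ]

theorem L1 (hs : ∀ b, Function.Injective fun l => s l b) {i : ℕ} (x : H i (Es s (m + 1)))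
    (hx : cl (tl s) (m + 1) i (Hm (incl s (m + 1)) i x) = 0) : ∃ w ∈ SG i (Es s m),
      cl s (m + 1) i x = cl s (m + 1) i (Hm (tau hs m) i w) := by
  have h1 : Hm (incl s (m + 1)) i (Nm s (m + 1) i x) = 0 := by
    rw [← Nm_Iq hx]
    simp only [Nm, LinearMap.sum_apply, map_sum, Hm_comp]; rfl
  obtain ⟨w, hw, h⟩ := L1a hs _ h1
  have h0 : ((m + 1).factorial : ℚ) ≠ 0 := by exact_mod_cast Nat.factorial_ne_zero _
  refine ⟨((m + 1).factorial : ℚ)⁻¹ • w, Submodule.smul_mem _ _ hw, ?_⟩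
  rw [cl_Nm] at h
  rw [map_smul, map_smul, ← h, inv_smul_smul₀ h0]

theorem L1z {i : ℕ} (x : H i (Es s 0)) (hx : cl (tl s) 0 i (Hm (incl s 0) i x) = 0) : x = 0 := by
  have h1 := Nm_Iq hx
  have h2 : ∀ y, Nm (tl s) 0 i y = y := by
    intro y
    simp only [Nm, LinearMap.sum_apply, Fintype.sum_unique]
    exact Eq.trans (by congr 2) (Hm_id y)
  rw [h2] at h1
  let b : C(Es (tl s) 0, Es s 0) := ⟨fun p => ⟨p.1, p.2.1, fun k => k.elim0⟩, by fun_prop⟩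
  have := congrArg (Hm b i) h1
  rw [Hm_comp, map_zero] at this
  exact (Hm_id x).symm.trans this

end
end OC

set_option linter.all false

namespace OC
open Cvx

section
variable {B Y V : Type} [TopologicalSpace B] [TopologicalSpace Y] [TopologicalSpace V] {r m : ℕ}

theorem es_hom {s : Fin r → C(B, ℂ)} (F G : C(Y, Es s m)) (h : unitInterval × Y → Fin m → ℂ) (hc : Continuous h)
    (h0 : ∀ y, h (0, y) = (F y).1.2) (h1 : ∀ y, h (1, y) = (G y).1.2) (hb : ∀ y, (F y).1.1 = (G y).1.1)
    (hi : ∀ t y, Function.Injective (h (t, y))) (hs : ∀ t y k l, h (t, y) k ≠ s l (F y).1.1) : F.Homotopic G :=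
  ⟨⟨⟨fun p => ⟨((F p.2).1.1, h p), hi _ _, fun k l => hs _ _ k l⟩, by fun_prop⟩,
    fun y => Subtype.ext (Prod.ext rfl (h0 y)), fun y => Subtype.ext (Prod.ext (hb y) (h1 y))⟩⟩

noncomputable def e1 (B : Type) [TopologicalSpace B] : Fin 1 → C(B, ℂ) := fun _ => ContinuousMap.const B 0
noncomputable abbrev e0 (B : Type) [TopologicalSpace B] : Fin 0 → C(B, ℂ) := tl (e1 B)
theorem he1 (b : B) : Function.Injective fun l => e1 B l b := Function.injective_of_subsingleton _

def mk0 (g : C(Y, B)) (f : Y → Fin m → ℂ) (hf : Continuous f) (hi : ∀ y, Function.Injective (f y)) :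
    C(Y, Es (e0 B) m) := ⟨fun y => ⟨(g y, f y), hi y, fun k l => l.elim0⟩, by fun_prop⟩

/-- segment avoids zero -/
def sd (u v : ℂ) : Prop := ∀ t : ℝ, 0 ≤ t → t ≤ 1 → (1 - t) * u + t * v ≠ 0

theorem sd_neg {u v : ℂ} (h : sd u v) : sd (-u) (-v) := fun t h0 h1 e =>
  h t h0 h1 (by linear_combination -e)
theorem sd_re {u v : ℂ} (hu : 0 < u.re) (hv : 0 < v.re) : sd u v := fun t h0 h1 e => by
  have := congrArg Complex.re e
  simp at this
  rcases h0.eq_or_lt with rfl | h0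
  · simp at this; linarith
  · nlinarith [mul_nonneg (sub_nonneg.2 h1) hu.le, mul_pos h0 hv]
theorem sd_mul {u : ℂ} {a b : ℝ} (ha : 0 < a) (hb : 0 < b) (hu : u ≠ 0) : sd (a * u) (b * u) := fun t h0 h1 e => by
  have : (((1 - t) * a + t * b : ℝ) : ℂ) * u = 0 := by push_cast; linear_combination e
  rcases mul_eq_zero.1 this with h | h
  · have h2 : (1 - t) * a + t * b = 0 := by exact_mod_cast h
    rcases h0.eq_or_lt with rfl | h0
    · linarith
    · nlinarith [mul_nonneg (sub_nonneg.2 h1) ha.le, mul_pos h0 hb]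
  · exact hu h
theorem sd_self {u : ℂ} (hu : u ≠ 0) : sd u u := by
  have := sd_mul one_pos one_pos hu
  simpa using this
theorem sd_near {x y u : ℂ} {r : ℝ} (hx : ‖x‖ < r) (hy : ‖y‖ < r) (hu : r ≤ ‖u‖) : sd (x - u) (y - u) := fun t h0 h1 e => by
  have : u = (1 - t) * x + t * y := by linear_combination -e
  have h2 : ‖u‖ ≤ (1 - t) * ‖x‖ + t * ‖y‖ := by
    rw [this]
    refine (norm_add_le _ _).trans (le_of_eq ?_)
    rw [norm_mul, norm_mul, Complex.norm_real, Real.norm_of_nonneg h0, show (1 - t : ℂ) = ((1 - t : ℝ) : ℂ) by push_cast; rfl,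
      Complex.norm_real, Real.norm_of_nonneg (by linarith)]
  rcases h0.eq_or_lt with rfl | h0
  · linarith
  · nlinarith [mul_nonneg (sub_nonneg.2 h1) (sub_pos.2 hx).le, mul_pos h0 (sub_pos.2 hy)]

def PS (u v : Fin m → ℂ) : Prop := ∀ i j, i ≠ j → sd (u i - u j) (v i - v j)

theorem PS_cons {x y : ℂ} {u v : Fin m → ℂ} (h : ∀ k, sd (x - u k) (y - v k)) (huv : PS u v) :
    PS (Fin.cons x u : Fin (m + 1) → ℂ) (Fin.cons y v : Fin (m + 1) → ℂ) := by
  intro i j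
  refine Fin.cases ?_ (fun i => ?_) i <;> refine Fin.cases ?_ (fun j => ?_) j
  · intro h; exact absurd rfl h
  · intro _; simpa using h j
  · intro _; have := sd_neg (h i); simpa using this
  · intro hij; simpa using huv i j (fun h => hij (by rw [h]))

theorem PS_self {u : Fin m → ℂ} (h : Function.Injective u) : PS u u := fun i j hij =>
  sd_self (sub_ne_zero.2 fun e => hij (h e))

theorem line0 (F G : C(Y, Es (e0 B) m)) (hb : ∀ y, (F y).1.1 = (G y).1.1)
    (h : ∀ y, PS (F y).1.2 (G y).1.2) : F.Homotopic G := by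
  refine es_hom F G (fun p k => (1 - (p.1 : ℝ)) * (F p.2).1.2 k + (p.1 : ℝ) * (G p.2).1.2 k) (by fun_prop) ?_ ?_ hb ?_
    (fun _ _ _ l => l.elim0)
  · intro y; ext k; simp
  · intro y; ext k; simp
  · intro t y i j e
    by_contra hij
    refine h y i j hij t t.2.1 t.2.2 ?_
    simp only at e
    linear_combination e

theorem cl_homot {s : Fin r → C(B, ℂ)} {F G : C(Y, Es s m)} (γ : Equiv.Perm (Fin m)) (h : F.Homotopic ((pm s γ).comp G)) {i : ℕ} (x : H i Y) :
    cl s m i (Hm F i x) = cl s m i (Hm G i x) := by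
  rw [Hm_homot h, ← Hm_comp, cl_pm]

/-! ### Jacobi -/

abbrev Tri : Set (ℂ × ℂ) := {p | p.1 ≠ 0 ∧ p.2 ≠ 0 ∧ p.1 ≠ p.2 ∧ ‖p.1‖ < 1 / 2 ∧ ‖p.2‖ < 1 / 2}

noncomputable abbrev rh (v : Es (e1 B) m) : ℝ := rho (e1 B) m v
theorem rh_pos (v : Es (e1 B) m) : 0 < rh v := rho_pos he1 v
theorem rh_le (v : Es (e1 B) m) (k) : rh v ≤ ‖v.1.2 k‖ := by
  have := rho_le_z (e1 B) v.1 k; simpa [e1] using this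
theorem rh_cont : Continuous (fun v : Es (e1 B) m => rh v) := (rho_cont _ _).comp continuous_subtype_val

theorem rh_ne {x : ℂ} {v : Es (e1 B) m} (hx : ‖x‖ < 1) (k) : (rh v : ℂ) * x ≠ v.1.2 k := fun e => by
  have h1 := rh_le v k
  have h2 := rh_pos v
  rw [← e, norm_mul, Complex.norm_real, Real.norm_of_nonneg h2.le] at h1
  nlinarith

theorem inj3 {v : Es (e1 B) m} {x y w : ℂ} (h1 : x ≠ y) (h2 : x ≠ w) (h3 : y ≠ w) (hx : ‖x‖ < 1) (hy : ‖y‖ < 1) (hw : ‖w‖ < 1) :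
    Function.Injective (Fin.cons (rh v * x) (Fin.cons (rh v * y) (Fin.cons (rh v * w) v.1.2)) : Fin (m + 3) → ℂ) := by
  have h0 : (rh v : ℂ) ≠ 0 := by exact_mod_cast (rh_pos v).ne'
  refine cons_inj (fun k => ?_) (cons_inj (fun k => ?_) (cons_inj (fun k => rh_ne hw k) v.2.1))
  · refine Fin.cases ?_ (fun k => Fin.cases ?_ (fun k => ?_) k) k
    · simpa [h0] using h1
    · simpa [h0] using h2
    · exact rh_ne hx k
  · refine Fin.cases ?_ (fun k => ?_) k
    · simpa [h0] using h3
    · exact rh_ne hy k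

noncomputable def c3 (v : Es (e1 B) m) (x y w : ℂ) : Fin (m + 3) → ℂ :=
  Fin.cons (rh v * x) (Fin.cons (rh v * y) (Fin.cons (rh v * w) v.1.2))

theorem c3_cont {f : Y → Es (e1 B) m} {x y w : Y → ℂ} (hf : Continuous f) (hx : Continuous x) (hy : Continuous y) (hw : Continuous w) :
    Continuous fun p => c3 (f p) (x p) (y p) (w p) := by
  have := (rh_cont (B := B) (m := m)).comp hf
  simp only [Function.comp_def] at this
  exact cons_cont (by fun_prop) (cons_cont (by fun_prop) (cons_cont (by fun_prop) (by fun_prop)))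

noncomputable def KT (f : C(Y, Tri)) (g : C(Y, Es (e1 B) m)) : C(Y, Es (e0 B) (m + 3)) :=
  mk0 ⟨fun y => (g y).1.1, by fun_prop⟩ (fun y => c3 (g y) 0 (f y).1.1 (f y).1.2)
    (c3_cont (by fun_prop) (by fun_prop) (by fun_prop) (by fun_prop)) fun y =>
    inj3 (f y).2.1.symm (f y).2.2.1.symm (f y).2.2.2.1 (by simp) (by linarith [(f y).2.2.2.2.1]) (by linarith [(f y).2.2.2.2.2])

theorem KT_homot {f f' : C(Y, Tri)} (h : f.Homotopic f') (g : C(Y, Es (e1 B) m)) : (KT f g).Homotopic (KT f' g) := by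
  obtain ⟨h⟩ := h
  exact ⟨⟨KT h.toContinuousMap (g.comp ContinuousMap.snd), fun y => by simp [KT, mk0], fun y => by simp [KT, mk0]⟩⟩

theorem KT_swap {f f' : C(Y, Tri)} (h : ∀ y, (f' y).1 = ((f y).1.2, (f y).1.1)) (g : C(Y, Es (e1 B) m)) {i : ℕ} (x : H i Y) :
    cl _ _ i (Hm (KT f g) i x) = cl _ _ i (Hm (KT f' g) i x) := by
  refine cl_homot (Equiv.swap (Fin.succ 0) (Fin.succ (Fin.succ 0))) ?_ x
  convert ContinuousMap.Homotopic.refl _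
  ext y : 1
  refine Subtype.ext (Prod.ext rfl (funext fun k => ?_))
  simp only [KT, mk0, pm, ContinuousMap.comp_apply, ContinuousMap.coe_mk, h, c3]
  refine Fin.cases ?_ (fun k => Fin.cases ?_ (fun k => Fin.cases ?_ (fun k => ?_) k) k) k
  · rw [Equiv.swap_apply_of_ne_of_ne (by rw [Ne, Fin.ext_iff]; simp only [Fin.val_succ, Fin.val_zero]; omega) (by rw [Ne, Fin.ext_iff]; simp only [Fin.val_succ, Fin.val_zero]; omega)]; simp
  · rw [Equiv.swap_apply_left]; rfl
  · rw [Equiv.swap_apply_right]; rfl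
  · rw [Equiv.swap_apply_of_ne_of_ne (by rw [Ne, Fin.ext_iff]; simp only [Fin.val_succ, Fin.val_zero]; omega) (by rw [Ne, Fin.ext_iff]; simp only [Fin.val_succ, Fin.val_zero]; omega)]; simp

theorem KT_cyc {f f' : C(Y, Tri)} (h : ∀ y, (f' y).1 = ((f y).1.2 - (f y).1.1, - (f y).1.1)) (g : C(Y, Es (e1 B) m)) {i : ℕ} (x : H i Y) :
    cl _ _ i (Hm (KT f g) i x) = cl _ _ i (Hm (KT f' g) i x) := by
  -- permutation 0 ↦ 2, 1 ↦ 0, 2 ↦ 1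
  refine cl_homot ((Equiv.swap 0 (Fin.succ 0)) * (Equiv.swap 0 (Fin.succ (Fin.succ 0)))) ?_ x
  refine es_hom _ _ (fun p => c3 (g p.2) (- (p.1 : ℝ) * (f p.2).1.1) ((f p.2).1.1 - (p.1 : ℝ) * (f p.2).1.1) ((f p.2).1.2 - (p.1 : ℝ) * (f p.2).1.1))
    (c3_cont (by fun_prop) (by fun_prop) (by fun_prop) (by fun_prop)) ?_ ?_ ?_ ?_ (fun _ _ _ l => l.elim0)
  · intro y; simp [KT, mk0]
  · intro y
    funext k
    simp only [KT, mk0, pm, ContinuousMap.comp_apply, ContinuousMap.coe_mk, h, c3]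
    refine Fin.cases ?_ (fun k => Fin.cases ?_ (fun k => Fin.cases ?_ (fun k => ?_) k) k) k
    · rw [Equiv.Perm.mul_apply, Equiv.swap_apply_left, Equiv.swap_apply_of_ne_of_ne (by rw [Ne, Fin.ext_iff]; simp only [Fin.val_succ, Fin.val_zero]; omega) (by rw [Ne, Fin.ext_iff]; simp only [Fin.val_succ, Fin.val_zero]; omega)]
      show _ = (rh (g y) : ℂ) * - (f y).1.1
      simp
    · rw [Equiv.Perm.mul_apply, Equiv.swap_apply_of_ne_of_ne (x := Fin.succ (0 : Fin (m + 2))) (by rw [Ne, Fin.ext_iff]; simp only [Fin.val_succ, Fin.val_zero]; omega) (by rw [Ne, Fin.ext_iff]; simp only [Fin.val_succ, Fin.val_zero]; omega), Equiv.swap_apply_right]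
      show (rh (g y) : ℂ) * ((f y).1.1 - _) = (rh (g y) : ℂ) * 0
      simp
    · rw [Equiv.Perm.mul_apply, Equiv.swap_apply_right, Equiv.swap_apply_left]
      show (rh (g y) : ℂ) * ((f y).1.2 - _) = (rh (g y) : ℂ) * _
      simp
    · rw [Equiv.Perm.mul_apply, Equiv.swap_apply_of_ne_of_ne (x := k.succ.succ.succ) (by rw [Ne, Fin.ext_iff]; simp only [Fin.val_succ, Fin.val_zero]; omega) (by rw [Ne, Fin.ext_iff]; simp only [Fin.val_succ, Fin.val_zero]; omega), Equiv.swap_apply_of_ne_of_ne (by rw [Ne, Fin.ext_iff]; simp only [Fin.val_succ, Fin.val_zero]; omega) (by rw [Ne, Fin.ext_iff]; simp only [Fin.val_succ, Fin.val_zero]; omega)]; simp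
  · intro y; rfl
  · intro t y
    have ht : ‖((t : ℝ) : ℂ)‖ ≤ 1 := by rw [Complex.norm_real, Real.norm_of_nonneg t.2.1]; exact t.2.2
    obtain ⟨h1, h2, h3, h4, h5⟩ := (f y).2
    have h6 : ‖((t : ℝ) : ℂ) * (f y).1.1‖ < 1 / 2 := by
      rw [norm_mul]; nlinarith [norm_nonneg (f y).1.1]
    refine inj3 ?_ ?_ ?_ ?_ ?_ ?_
    · intro e; exact h1 (by linear_combination -e)
    · intro e; exact h2 (by linear_combination -e)
    · intro e; exact h3 (by linear_combination e)
    · rw [neg_mul, norm_neg]; linarith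
    · exact (norm_sub_le _ _).trans_lt (by linarith)
    · exact (norm_sub_le _ _).trans_lt (by linarith)

noncomputable def TT (u w : C(Y, Circle)) (c e : C(Y, ℝ)) (h : ∀ y, 0 < c y ∧ c y < e y ∧ e y < 1 / 2) : C(Y, Tri) :=
  ⟨fun y => ⟨(c y * u y, e y * w y), by
    obtain ⟨h1, h2, h3⟩ := h y
    have a1 : ‖(c y * u y : ℂ)‖ = c y := by rw [norm_mul, Circle.norm_coe, Complex.norm_real, Real.norm_of_nonneg h1.le, mul_one]
    have a2 : ‖(e y * w y : ℂ)‖ = e y := by rw [norm_mul, Circle.norm_coe, Complex.norm_real, Real.norm_of_nonneg (h1.trans h2).le, mul_one]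
    refine ⟨?_, ?_, ?_, ?_, ?_⟩
    · rw [← norm_pos_iff, a1]; exact h1
    · rw [← norm_pos_iff, a2]; linarith
    · intro e; simp only at e; rw [e, a2] at a1; linarith
    · rw [a1]; linarith
    · rw [a2]; exact h3⟩, by fun_prop⟩

theorem TT_homot {u u' w w' : C(Y, Circle)} (hu : u.Homotopic u') (hw : w.Homotopic w') (c e c' e' : C(Y, ℝ)) (h h') :
    (TT u w c e h).Homotopic (TT u' w' c' e' h') := by
  obtain ⟨hu⟩ := hu
  obtain ⟨hw⟩ := hw
  let l (c c' : C(Y, ℝ)) : C(unitInterval × Y, ℝ) := ⟨fun p => (1 - (p.1 : ℝ)) * c p.2 + p.1 * c' p.2, by fun_prop⟩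
  refine ⟨⟨TT hu.toContinuousMap hw.toContinuousMap (l c c') (l e e') ?_, ?_, ?_⟩⟩
  · rintro ⟨t, y⟩
    obtain ⟨h1, h2, h3⟩ := h y
    obtain ⟨h1', h2', h3'⟩ := h' y
    have ht := t.2.1
    have ht' := t.2.2
    simp only [l, ContinuousMap.coe_mk]
    rcases ht.eq_or_lt with e | h0
    · rw [← e]; norm_num; exact h y
    · refine ⟨?_, ?_, ?_⟩ <;> nlinarith
  · intro y; simp [TT, l]
  · intro y; simp [TT, l]

theorem neg_homot (w w' : C(Y, Circle)) (h : ∀ y, (w' y : ℂ) = - w y) : w'.Homotopic w := by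
  refine ⟨⟨⟨fun p => Circle.exp (Real.pi * (1 - (p.1 : ℝ))) * w p.2, by fun_prop⟩, fun y => ?_, fun y => ?_⟩⟩
  · ext; simp [h]
  · simp

/-- The Jacobi identity: `[[x,x],x]=0`. -/
theorem jacobi {i : ℕ} (x : H i (Es (e1 B) m)) (c e : C(Circle × (Circle × Es (e1 B) m), ℝ)) (h) :
    cl _ _ _ (Tc (KT (TT ⟨fun p => p.1, by fun_prop⟩ ⟨fun p => p.2.1, by fun_prop⟩ c e h) ⟨fun p => p.2.2, by fun_prop⟩) x) = 0 := by
  let V := Es (e1 B) m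
  let p1 : C(Circle × (Circle × V), Circle) := ⟨fun p => p.1, by fun_prop⟩
  let p2 : C(Circle × (Circle × V), Circle) := ⟨fun p => p.2.1, by fun_prop⟩
  let p3 : C(Circle × (Circle × V), V) := ⟨fun p => p.2.2, by fun_prop⟩
  let p12 : C(Circle × (Circle × V), Circle) := ⟨fun p => p.1 * p.2.1, by fun_prop⟩
  let c0 : C(Circle × (Circle × V), ℝ) := .const _ (1 / 32)
  let k0 : C(Circle × (Circle × V), ℝ) := .const _ (1 / 8)
  have h0 : ∀ y, 0 < c0 y ∧ c0 y < k0 y ∧ k0 y < 1 / 2 := fun y => by simp [c0, k0]; norm_num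
  let N := KT (TT p1 p2 c0 k0 h0) p3
  have hN : Tc (KT (TT p1 p2 c e h) p3) x = Tc N x := Tc_homot (KT_homot (TT_homot (.refl _) (.refl _) _ _ _ _ _ _) _) x
  refine (congrArg _ hN).trans ?_
  let kp : Qp → ℝ := fun w => 1 / (8 * (2 + ‖(w : ℂ)‖))
  have hkc : Continuous kp := by
    refine continuous_const.div (by fun_prop) fun w => ?_
    positivity
  have hkp : ∀ w, 0 < kp w := fun w => by simp only [kp]; positivity
  have hk1 : ∀ w, kp w * (2 + ‖(w : ℂ)‖) = 1 / 8 := fun w => by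
    simp only [kp]; field_simp
  have hkn : ∀ w : Qp, ‖(kp w : ℂ)‖ = kp w := fun w => by rw [Complex.norm_real, Real.norm_of_nonneg (hkp w).le]
  let T : C(Qp × (Circle × V), Tri) := ⟨fun p => ⟨(kp p.1 * (p.2.1 / 2), kp p.1 * (p.2.1 * p.1)), by
    have a := hkn p.1
    have b := hkp p.1
    have cc := hk1 p.1
    have dd := norm_nonneg (p.1 : ℂ)
    have b' : (kp p.1 : ℂ) ≠ 0 := by exact_mod_cast b.ne'
    have nz : (p.2.1 : ℂ) ≠ 0 := p.2.1.coe_ne_zero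
    refine ⟨?_, ?_, ?_, ?_, ?_⟩
    · simpa using b'
    · simpa [b'] using p.1.2.1
    · intro e
      refine p.1.2.2 ?_
      have := mul_left_cancel₀ nz (mul_left_cancel₀ b' (e.symm.trans (by simp only; ring : _ = (kp p.1 : ℂ) * (p.2.1 * (1 / 2)))))
      exact this
    · rw [norm_mul, norm_div, Circle.norm_coe, a]; norm_num; nlinarith
    · rw [norm_mul, norm_mul, Circle.norm_coe, a]; nlinarith⟩, by fun_prop⟩
  let gT : C(Qp × (Circle × V), V) := ⟨fun p => p.2.2, by fun_prop⟩
  have P := pants (KT T gT) (sig i V x) (gq_mem 0 1 (by norm_num) (by norm_num [abs_of_pos]))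
    (gq_mem 0 (1 / 8) (by norm_num [abs_of_pos]) (by norm_num [abs_of_pos])) (gq_mem (1 / 2) (1 / 8) (by norm_num [abs_of_pos]) (by norm_num [abs_of_pos]))
  set gI := gq 0 1 (gq_mem 0 1 (by norm_num) (by norm_num [abs_of_pos])) with hgI
  set g0 := gq 0 (1 / 8) (gq_mem 0 (1 / 8) (by norm_num [abs_of_pos]) (by norm_num [abs_of_pos])) with hg0
  set g1 := gq (1 / 2) (1 / 8) (gq_mem (1 / 2) (1 / 8) (by norm_num [abs_of_pos]) (by norm_num [abs_of_pos])) with hg1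
  have e : ∀ g : C(Circle, Qp), (KT T gT).comp (g.prodMap (ContinuousMap.id (Circle × V))) =
      KT (T.comp (g.prodMap (ContinuousMap.id (Circle × V)))) p3 := fun g => rfl
  rw [e, e, e] at P
  have P' := congrArg (cl _ _ _) P
  rw [map_add] at P'
  -- the normalised torus
  let NN (u w : C(Circle × (Circle × V), Circle)) := KT (TT u w c0 k0 h0) p3
  have hN1 : Tc (NN p12 p2) x = Tc N x := Tc_shear' N (NN p12 p2) (fun α β y => rfl) x
  have hN2 : Tc (NN p2 p12) x = - Tc N x := by
    rw [← Tc_shear N (NN p1 p12) (fun α β y => rfl) x]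
    exact Tc_swap (NN p1 p12) (NN p2 p12) (fun α β y => by simp [NN, KT, TT, mk0, p1, p2, p12, p3, mul_comm, c0, k0]) x
  have hnI : ∀ α, ‖((gI α : Qp) : ℂ)‖ = 1 := fun α => by simp [gI, gq]; exact Circle.norm_coe α
  let kg (g : C(Circle, Qp)) (q : ℝ) : C(Circle × (Circle × V), ℝ) := ⟨fun p => kp (g p.1) * q, by fun_prop⟩
  have hkg : ∀ g p, kg g (1 / 2) p < 1 / 2 := fun g p => by
    simp only [kg, ContinuousMap.coe_mk]
    nlinarith [hkp (g p.1), hk1 (g p.1), norm_nonneg ((g p.1 : Qp) : ℂ)]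
  have hI : Hm (KT (T.comp (gI.prodMap (ContinuousMap.id (Circle × V)))) p3) _ (s2 i V x) = - Tc N x := by
    rw [← hN2]
    refine Tc_homot (KT_homot ?_ _) x
    have : T.comp (gI.prodMap (ContinuousMap.id (Circle × V))) = TT p2 p12 (kg gI (1 / 2)) (kg gI 1) (fun p => by
        simp only [kg, ContinuousMap.coe_mk]
        have := hk1 (gI p.1)
        rw [hnI] at this
        refine ⟨?_, ?_, ?_⟩ <;> linarith) := by
      ext p : 1
      refine Subtype.ext (Prod.ext ?_ ?_)
      · simp [T, TT, p2, kg]; ring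
      · simp [T, TT, p12, kg, gI, gq]; exact Or.inl (mul_comm _ _)
    rw [this]
    exact TT_homot (.refl _) (.refl _) _ _ _ _ _ _
  have hz : cl _ _ _ (Hm (KT (T.comp (g0.prodMap (ContinuousMap.id (Circle × V)))) p3) _ (s2 i V x)) = cl _ _ _ (Tc N x) := by
    have h' : ∀ p, 0 < kg g0 (1 / 8) p ∧ kg g0 (1 / 8) p < kg g0 (1 / 2) p ∧ kg g0 (1 / 2) p < 1 / 2 := fun p => by
      refine ⟨?_, ?_, hkg _ _⟩ <;> simp only [kg, ContinuousMap.coe_mk] <;> linarith [hkp (g0 p.1)]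
    rw [KT_swap (f' := TT p12 p2 (kg g0 (1 / 8)) (kg g0 (1 / 2)) h'), ← hN1]
    · exact congrArg _ (Tc_homot (KT_homot (TT_homot (.refl _) (.refl _) _ _ _ _ _ _) _) x)
    · intro p
      refine (Prod.ext ?_ ?_)
      · simp [T, TT, p12, kg, g0, gq]; ring
      · simp [T, TT, p2, kg]; ring
  have ho : cl _ _ _ (Hm (KT (T.comp (g1.prodMap (ContinuousMap.id (Circle × V)))) p3) _ (s2 i V x)) = cl _ _ _ (Tc N x) := by
    have h' : ∀ p, 0 < kg g1 (1 / 8) p ∧ kg g1 (1 / 8) p < kg g1 (1 / 2) p ∧ kg g1 (1 / 2) p < 1 / 2 := fun p => by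
      refine ⟨?_, ?_, hkg _ _⟩ <;> simp only [kg, ContinuousMap.coe_mk] <;> linarith [hkp (g1 p.1)]
    let q2 : C(Circle × (Circle × V), Circle) := ⟨fun p => Circle.exp Real.pi * p.2.1, by fun_prop⟩
    rw [KT_cyc (f' := TT p12 q2 (kg g1 (1 / 8)) (kg g1 (1 / 2)) h'), ← hN1]
    · exact congrArg _ (Tc_homot (KT_homot (TT_homot (.refl _) (neg_homot _ _ fun p => by simp [q2, p2]) _ _ _ _ _ _) _) x)
    · intro p
      refine (Prod.ext ?_ ?_)
      · simp [T, TT, p12, kg, g1, gq]; ring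
      · simp [T, TT, q2, kg]; ring
  have P2 : cl _ _ _ (- Tc N x) = cl _ _ _ (Tc N x) + cl _ _ _ (Tc N x) := by
    rw [← hI]; nth_rw 1 [← hz]; rw [← ho]; exact P'
  rw [map_neg, neg_eq_iff_add_eq_zero] at P2
  have : (3 : ℚ) • cl (e0 B) (m + 3) (i + 2) (Tc N x) = 0 := by rw [← P2]; module
  exact (smul_eq_zero.1 this).resolve_left (by norm_num)

end
end OC

set_option linter.all false

namespace OC
open Cvx

section
variable {B Y V : Type} [TopologicalSpace B] [TopologicalSpace Y] [TopologicalSpace V] {r m : ℕ}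

theorem PS_shift {u v : Fin m → ℂ} (h : Function.Injective u) (hv : ∀ i j, v i - v j = u i - u j) : PS u v := fun i j hij => by
  rw [hv]; exact PS_self h i j hij

theorem cons_add (x c : ℂ) (u : Fin m → ℂ) : (fun k => (Fin.cons x u : Fin (m + 1) → ℂ) k + c) = Fin.cons (x + c) (fun k => u k + c) := by
  funext k; refine Fin.cases ?_ (fun k => ?_) k <;> simp

theorem circ_re (θ : Circle) : -1 ≤ (θ : ℂ).re ∧ (θ : ℂ).re ≤ 1 := by
  have := Complex.abs_re_le_norm θ
  rw [Circle.norm_coe] at this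
  exact abs_le.1 this

theorem nat_inj (c : ℂ) : Function.Injective fun k : Fin m => -((k : ℕ) : ℂ) - c := fun i j h => by
  simp only [sub_left_inj, neg_inj, Nat.cast_inj] at h; exact Fin.ext h

noncomputable def pP (m : ℕ) : C(B, Es (e0 B) m) :=
  mk0 (.id B) (fun _ k => -((k : ℕ) : ℂ) - 0) (by fun_prop) fun _ => nat_inj _

theorem d_inj (θ : Circle) : Function.Injective (Fin.cons 0 (Fin.cons ((θ : ℂ) / 2) (fun k : Fin m => -((k : ℕ) : ℂ) - 1)) : Fin (m + 2) → ℂ) := by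
  have hθ := circ_re θ
  refine cons_inj (fun k => Fin.cases (fun e => by simpa using e.symm) (fun k e => ?_) k) (cons_inj (fun k e => ?_) (nat_inj _))
  · have := congrArg Complex.re e
    simp at this
    have h : (0 : ℝ) ≤ (k : ℕ) := Nat.cast_nonneg _
    linarith
  · have := congrArg Complex.re e
    simp at this
    have h : (0 : ℝ) ≤ (k : ℕ) := Nat.cast_nonneg _
    linarith

noncomputable def Dd (m : ℕ) : C(Circle × B, Es (e0 B) (m + 2)) :=
  mk0 .snd (fun p => Fin.cons 0 (Fin.cons ((p.1 : ℂ) / 2) (fun k : Fin m => -((k : ℕ) : ℂ) - 1)))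
    (cons_cont (by fun_prop) (cons_cont (by fun_prop) (by fun_prop))) fun p => d_inj p.1

noncomputable def DS : (m i : ℕ) → Submodule ℚ (H i (Es (e0 B) m))
  | 0, _ => ⊥
  | 1, _ => ⊥
  | m + 2, i => (SG i B).map (Hm (Dd m) i)

noncomputable def jj (m : ℕ) : C(Es (e1 B) m, Es (e0 B) (m + 1)) :=
  mk0 ⟨fun p => p.1.1, by fun_prop⟩ (fun p => Fin.cons 0 p.1.2) (cons_cont (by fun_prop) (by fun_prop))
    fun p => cons_inj (fun k => (p.2.2 k 0).symm) p.2.1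

noncomputable def tt (m : ℕ) : C(Es (e0 B) (m + 1), Es (e1 B) m) :=
  ⟨fun p => ⟨(p.1.1, fun k => p.1.2 k.succ - p.1.2 0), fun a b h => by
    simp only [sub_left_inj] at h; exact Fin.succ_injective _ (p.2.1 h), fun k l h => by
    simp only [e1, ContinuousMap.const_apply, sub_eq_zero] at h
    exact Fin.succ_ne_zero _ (p.2.1 h)⟩, by fun_prop⟩

theorem jt {i : ℕ} (x : H i (Es (e0 B) (m + 1))) : Hm (jj m) i (Hm (tt m) i x) = x := by
  rw [Hm_comp]
  refine (Hm_homot ?_ x).trans (Hm_id x)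
  refine es_hom _ _ (fun p k => p.2.1.2 k - (1 - (p.1 : ℝ)) * p.2.1.2 0) (by fun_prop) ?_ ?_ ?_ ?_ (fun _ _ _ l => l.elim0)
  · intro y; funext k
    refine Fin.cases ?_ (fun k => ?_) k <;> simp [jj, tt, mk0]
  · intro y; funext k; simp
  · intro y; rfl
  · intro t y a b h; simp only [sub_left_inj] at h; exact y.2.1 h

noncomputable def Lz (z : Fin m → ℂ) : ℝ := 1 + ∑ k, ‖z k‖
theorem Lz_ge (z : Fin m → ℂ) (k) : 1 + ‖z k‖ ≤ Lz z :=
  add_le_add le_rfl (Finset.single_le_sum (f := fun k => ‖z k‖) (fun _ _ => norm_nonneg _) (Finset.mem_univ k))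
theorem Lz_one (z : Fin m → ℂ) : 1 ≤ Lz z := le_add_of_nonneg_right (Finset.sum_nonneg fun _ _ => norm_nonneg _)
theorem Lz_cont : Continuous (Lz (m := m)) := by unfold Lz; fun_prop

noncomputable def ss (ζ : Circle) (m : ℕ) : C(Es (e0 B) m, Es (e1 B) m) :=
  ⟨fun p => ⟨(p.1.1, fun k => p.1.2 k + ζ * Lz p.1.2), fun a b h => by
    simp only [add_left_inj] at h; exact p.2.1 h, fun k l h => by
    simp only [e1, ContinuousMap.const_apply] at h
    have h1 := Lz_ge p.1.2 k
    rw [eq_neg_of_add_eq_zero_left h, norm_neg, norm_mul, Circle.norm_coe, Complex.norm_real, one_mul,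
      Real.norm_of_nonneg (by linarith [Lz_one p.1.2])] at h1
    linarith⟩, by have := Lz_cont (m := m); fun_prop⟩

theorem ss_homot : (ss (B := B) (Circle.exp Real.pi) m).Homotopic (ss 1 m) :=
  ⟨⟨⟨fun p => ss (Circle.exp (Real.pi * (1 - (p.1 : ℝ)))) m p.2, by
    have := Lz_cont (m := m)
    simp only [ss, ContinuousMap.coe_mk]; fun_prop⟩, fun y => by simp, fun y => by simp⟩⟩

theorem incl_ss (ζ : Circle) {i : ℕ} (x : H i (Es (e0 B) m)) : Hm (incl (e1 B) m) i (Hm (ss ζ m) i x) = x := by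
  rw [Hm_comp]
  refine (Hm_homot ?_ x).trans (Hm_id x)
  have := Lz_cont (m := m)
  refine es_hom _ _ (fun p k => p.2.1.2 k + (1 - (p.1 : ℝ)) * (ζ * Lz p.2.1.2)) (by fun_prop) ?_ ?_ ?_ ?_ (fun _ _ _ l => l.elim0)
  · intro y; funext k; simp [incl, ss]
  · intro y; funext k; simp
  · intro y; rfl
  · intro t y a b h; simp only [add_left_inj] at h; exact y.2.1 h

/-! equivariance -/

theorem cl_Hm {s : Fin r → C(B, ℂ)} {r' m' : ℕ} {t : Fin r' → C(B, ℂ)} (f : C(Es s m, Es t m'))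
    (hf : ∀ γ, ∃ γ', ∀ p, f (pm s γ p) = pm t γ' (f p)) {i : ℕ} {x y : H i (Es s m)} (h : cl s m i x = cl s m i y) :
    cl t m' i (Hm f i x) = cl t m' i (Hm f i y) := by
  refine cl_map (Hm f i) (fun γ => ?_) h
  obtain ⟨γ', h⟩ := hf γ
  refine ⟨γ', fun x => ?_⟩
  rw [Hm_comp, Hm_comp]
  congr 2
  ext p : 1; exact h p

theorem Lz_perm (γ : Equiv.Perm (Fin m)) (z : Fin m → ℂ) : Lz (fun k => z (γ k)) = Lz z := by
  unfold Lz; congr 1; exact Equiv.sum_comp γ fun k => ‖z k‖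

theorem ss_eqv (ζ : Circle) (γ) : ∃ γ', ∀ p, ss (B := B) ζ m (pm _ γ p) = pm _ γ' (ss ζ m p) :=
  ⟨γ, fun p => by simp [ss, pm, Lz_perm γ p.1.2]⟩

theorem cons_perm (γ : Equiv.Perm (Fin m)) (x : ℂ) (z : Fin m → ℂ) :
    (Fin.cons x (fun k => z (γ k)) : Fin (m + 1) → ℂ) = fun k => (Fin.cons x z : Fin (m + 1) → ℂ) (Equiv.Perm.decomposeFin.symm (0, γ) k) := by
  funext k; refine Fin.cases ?_ (fun k => ?_) k <;> simp

theorem jj_eqv (γ) : ∃ γ', ∀ p, jj (B := B) m (pm _ γ p) = pm _ γ' (jj m p) :=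
  ⟨Equiv.Perm.decomposeFin.symm (0, γ), fun p => by simp only [jj, mk0, pm, ContinuousMap.coe_mk]; exact Subtype.ext (Prod.ext rfl (cons_perm γ 0 p.1.2))⟩

theorem rho_perm (s : Fin (r + 1) → C(B, ℂ)) (γ : Equiv.Perm (Fin m)) (p : B × (Fin m → ℂ)) :
    rho s m (p.1, fun k => p.2 (γ k)) = rho s m p := by
  unfold rho; congr 1; exact Equiv.prod_comp γ fun k => min 1 ‖p.2 k - s 0 p.1‖

theorem tau_eqv {s : Fin (r + 1) → C(B, ℂ)} (hs : ∀ b, Function.Injective fun l => s l b) (γ : Equiv.Perm (Fin m)) :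
    ∃ γ', ∀ q : Circle × Es s m, tau hs m (q.1, pm s γ q.2) = pm s γ' (tau hs m q) :=
  ⟨Equiv.Perm.decomposeFin.symm (0, γ), fun q => by
    simp only [tau, pm, ContinuousMap.coe_mk]
    refine Subtype.ext (Prod.ext rfl ((cons_perm γ _ q.2.1.2).trans ?_))
    simp only [rho_perm s γ q.2.1]⟩

/-- add a small circle about the first section -/
noncomputable def Ta {s : Fin (r + 1) → C(B, ℂ)} (hs : ∀ b, Function.Injective fun l => s l b) (m i : ℕ) :
    H i (Es s m) →ₗ[ℚ] H (i + 1) (Es s (m + 1)) := Hm (tau hs m) (i + 1) ∘ₗ sig i _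

theorem Ta_cl {s : Fin (r + 1) → C(B, ℂ)} (hs : ∀ b, Function.Injective fun l => s l b) {i : ℕ}
    {x y : H i (Es s m)} (h : cl s m i x = cl s m i y) : cl s (m + 1) (i + 1) (Ta hs m i x) = cl s (m + 1) (i + 1) (Ta hs m i y) := by
  refine cl_map _ (fun γ => ?_) h
  obtain ⟨γ', h⟩ := tau_eqv hs γ
  refine ⟨γ', fun x => ?_⟩
  rw [Ta, LinearMap.comp_apply, LinearMap.comp_apply, sig_nat, Hm_comp, Hm_comp]
  congr 2
  ext p : 1; exact h p

theorem dec1 (ζ : Circle) {i : ℕ} (y : H i (Es (e1 B) (m + 1))) : ∃ w ∈ SG i (Es (e1 B) m),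
    cl _ _ _ y = cl _ _ _ (Hm (ss ζ _) i (Hm (incl (e1 B) _) i y)) + cl _ _ _ (Hm (tau he1 m) i w) := by
  obtain ⟨w, hw, h⟩ := L1 he1 (y - Hm (ss ζ _) i (Hm (incl (e1 B) _) i y)) (by rw [map_sub, incl_ss, sub_self, map_zero])
  exact ⟨w, hw, by rw [← h, map_sub]; abel⟩

theorem dec0 (ζ : Circle) {i : ℕ} (y : H i (Es (e1 B) 0)) : y = Hm (ss ζ _) i (Hm (incl (e1 B) _) i y) :=
  sub_eq_zero.1 (L1z _ (by rw [map_sub, incl_ss, sub_self, map_zero]))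

noncomputable abbrev mo : Circle := Circle.exp Real.pi
theorem mo_mul (x : ℂ) : (mo : ℂ) * x = - x := by simp [mo]

/-! normal forms -/
theorem cl_line {F G : C(Y, Es (e0 B) m)} (γ : Equiv.Perm (Fin m)) (hb : ∀ y, (F y).1.1 = (G y).1.1)
    (h : ∀ y, PS (F y).1.2 (fun k => (G y).1.2 (γ k))) {i : ℕ} (x : H i Y) :
    cl _ _ _ (Hm F i x) = cl _ _ _ (Hm G i x) := cl_homot γ (line0 _ _ hb h) x

theorem term1 {i : ℕ} (b : H i B) : Hm (jj m) i (Hm (ss mo m) i (Hm (pP m) i b)) = Hm (pP (m + 1)) i b := by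
  rw [Hm_comp, Hm_comp]
  refine Hm_homot (line0 (B := B) (Y := B) (m := m + 1) _ _ ?_ fun y => ?_) b
  · intro y; rfl
  have e : ((pP (m + 1) y : Es (e0 B) (m + 1)).1.2) = Fin.cons 0 (fun k : Fin m => -((k : ℕ) : ℂ) - 1) := by
    funext k; refine Fin.cases ?_ (fun k => ?_) k <;> simp [pP, mk0]; ring
  rw [e]
  simp only [jj, ss, mk0, ContinuousMap.comp_apply, ContinuousMap.coe_mk]
  set L := Lz ((pP m y : Es (e0 B) m).1.2) with hL
  have h1 : 1 ≤ L := Lz_one _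
  refine PS_cons (fun k => sd_re ?_ ?_) (PS_shift (fun a b h => ?_) fun a b => ?_)
  · rw [mo_mul]; simp [pP, mk0]; positivity
  · simp; positivity
  · simp only [add_left_inj] at h; exact nat_inj _ h
  · simp [pP, mk0]

theorem term2 {i : ℕ} (w : H i (Circle × B)) :
    cl _ _ _ (Hm (jj (m + 2)) i (Hm (ss mo (m + 2)) i (Hm (Dd m) i w))) = cl _ _ _ (Hm (Dd (m + 1)) i w) := by
  rw [Hm_homot ss_homot, Hm_comp, Hm_comp]
  refine cl_line (B := B) (Y := Circle × B) (m := m + 3) (finRotate (m + 3))⁻¹ ?_ (fun y => ?_) w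
  · intro y; rfl
  have e : (fun k => (Dd (m + 1) y : Es (e0 B) (m + 3)).1.2 ((finRotate (m + 3))⁻¹ k)) =
      Fin.cons (-((m : ℕ) : ℂ) - 1) (Fin.cons 0 (Fin.cons ((y.1 : ℂ) / 2) (fun k : Fin m => -((k : ℕ) : ℂ) - 1))) := by
    have e1 : (fun k : Fin (m + 1) => -((k : ℕ) : ℂ) - 1) = Fin.snoc (α := fun _ => ℂ) (fun k : Fin m => -((k : ℕ) : ℂ) - 1) (-((m : ℕ) : ℂ) - 1) := by
      funext k; refine Fin.lastCases ?_ (fun k => ?_) k <;> simp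
    simp only [pm, Dd, mk0, ContinuousMap.comp_apply, ContinuousMap.coe_mk]
    rw [e1, Fin.cons_snoc_eq_snoc_cons, Fin.cons_snoc_eq_snoc_cons, Fin.snoc_eq_cons_rotate]
    funext k
    show (Fin.cons _ _ : Fin (m + 3) → ℂ) (finRotate (m + 3) ((finRotate (m + 3))⁻¹ k)) = _
    exact congrArg _ (Equiv.apply_symm_apply _ _)
  rw [e]
  simp only [jj, ss, mk0, Dd, ContinuousMap.comp_apply, ContinuousMap.coe_mk]
  set z : Fin (m + 2) → ℂ := Fin.cons 0 (Fin.cons ((y.1 : ℂ) / 2) (fun k : Fin m => -((k : ℕ) : ℂ) - 1)) with hz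
  set L := Lz z with hL
  have h1 : 1 ≤ L := Lz_one _
  have hy := circ_re y.1
  refine PS_cons (fun k => ?_) (PS_shift (fun a b h => ?_) fun a b => ?_)
  · rw [← neg_sub, ← neg_sub (z k)]
    refine sd_neg (sd_re ?_ ?_)
    · have h2 := Lz_ge z k
      have h3 := (abs_le.1 (Complex.abs_re_le_norm (z k))).1
      simp; linarith
    · refine Fin.cases ?_ (fun k => Fin.cases ?_ (fun k => ?_) k) k
      · simp [z]; positivity
      · simp [z]; have : (0 : ℝ) ≤ m := by positivity
        linarith
      · have : ((k : ℕ) : ℝ) < m := by exact_mod_cast k.2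
        simp [z]
  · simp only [add_left_inj] at h; exact d_inj y.1 h
  · simp

theorem term3a {i : ℕ} (b : H i B) :
    Hm (jj (m + 1)) _ (Ta he1 m i (Hm (ss mo m) i (Hm (pP m) i b))) = Hm (Dd m) _ (sig i B b) := by
  rw [Ta, LinearMap.comp_apply, Hm_comp, sig_nat, sig_nat, Hm_comp, Hm_comp]
  refine Hm_homot (line0 (B := B) (Y := Circle × B) (m := m + 2) _ _ ?_ fun y => ?_) _
  · intro y; rfl
  have hy := circ_re y.1
  simp only [jj, ss, mk0, Dd, tau, ContinuousMap.comp_apply, ContinuousMap.coe_mk, cx, ContinuousMap.prodMap_apply, Prod.map, ContinuousMap.id_apply]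
  set L := Lz ((pP m y.2 : Es (e0 B) m).1.2) with hL
  have h1 : 1 ≤ L := Lz_one _
  have h0 : 0 < rho (e1 B) m ((pP m y.2 : Es (e0 B) m).1.1, fun k => (pP m y.2 : Es (e0 B) m).1.2 k + mo * L) := rho_pos he1 (ss mo m (pP m y.2))
  refine PS_cons (fun k => ?_) (PS_cons (fun k => sd_re ?_ ?_) (PS_shift (fun a b h => ?_) fun a b => ?_))
  · refine Fin.cases ?_ (fun k => sd_re ?_ ?_) k
    · have := sd_neg (sd_mul (u := (y.1 : ℂ) / 2) h0 one_pos (by simp))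
      simpa [e1] using this
    · simp only [Fin.cons_succ, mo_mul]; simp [pP, mk0]; positivity
    · simp; positivity
  · have h2 := rho_le_one (e1 B) m ((pP m y.2 : Es (e0 B) m).1.1, fun k => (pP m y.2).1.2 k + mo * L)
    have : (0 : ℝ) ≤ ((k : ℕ) : ℝ) := by positivity
    simp only [mo_mul] at h0 h2 ⊢
    simp [pP, mk0, e1] at h0 h2 ⊢
    nlinarith
  · have : (0 : ℝ) ≤ ((k : ℕ) : ℝ) := by positivity
    simp; linarith
  · simp only [add_left_inj] at h; exact nat_inj _ h
  · simp [pP, mk0]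

end
end OC

set_option linter.all false

namespace OC
open Cvx

section
variable {B Y V : Type} [TopologicalSpace B] [TopologicalSpace Y] [TopologicalSpace V] {r m : ℕ}

theorem circ_abs (θ : Circle) : ‖(θ : ℂ)‖ = 1 := Circle.norm_coe θ

noncomputable def q4 (m : ℕ) (ζ θ η : Circle) : Fin (m + 4) → ℂ :=
  Fin.cons (2 * (ζ : ℂ)) (Fin.cons (2 * ζ + (θ : ℂ) / 2) (Fin.cons (-2 * (ζ : ℂ)) (Fin.cons (-2 * ζ + (η : ℂ) / 2) (fun k : Fin m => -((k : ℕ) : ℂ) - 6))))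

theorem clump (ζ : Circle) {α β : ℂ} (hα : ‖α‖ ≤ 1 / 2) (hβ : ‖β‖ ≤ 1 / 2) : 2 * (ζ : ℂ) + α ≠ -2 * ζ + β := fun e => by
  have h1 : (4 : ℂ) * ζ = β - α := by linear_combination e
  have h2 := congrArg norm h1
  have h3 := norm_sub_le β α
  rw [norm_mul, circ_abs] at h2
  norm_num at h2; linarith

theorem far4 (ζ θ : Circle) (c : ℂ) (hc : c = 1 ∨ c = 0) (u : ℂ) (hu : u = 2 ∨ u = -2) (k : Fin m) : u * (ζ : ℂ) + c * (θ / 2) ≠ -((k : ℕ) : ℂ) - 6 := fun e => by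
  have h1 := circ_re ζ
  have h2 := circ_re θ
  have := congrArg Complex.re e
  have h : (0 : ℝ) ≤ ((k : ℕ) : ℝ) := Nat.cast_nonneg _
  rcases hc with rfl | rfl <;> rcases hu with rfl | rfl <;> simp at this <;> linarith

theorem q4_inj (ζ θ η : Circle) : Function.Injective (q4 m ζ θ η) := by
  have a (θ : Circle) : ‖(θ : ℂ) / 2‖ ≤ 1 / 2 := by rw [norm_div, circ_abs]; norm_num
  have b : ‖(0 : ℂ)‖ ≤ 1 / 2 := by simp
  refine cons_inj (fun k => ?_) (cons_inj (fun k => ?_) (cons_inj (fun k => ?_) (cons_inj (fun k => ?_) (nat_inj _))))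
  · refine Fin.cases ?_ (fun k => Fin.cases ?_ (fun k => Fin.cases ?_ (fun k => ?_) k) k) k <;> simp only [Fin.cons_zero, Fin.cons_succ]
    · simp
    · simpa using clump ζ b b
    · simpa using clump ζ b (a η)
    · simpa using far4 ζ θ 0 (.inr rfl) 2 (.inl rfl) k
  · refine Fin.cases ?_ (fun k => Fin.cases ?_ (fun k => ?_) k) k <;> simp only [Fin.cons_zero, Fin.cons_succ]
    · simpa using clump ζ (a θ) b
    · simpa using clump ζ (a θ) (a η)
    · simpa using far4 ζ θ 1 (.inl rfl) 2 (.inl rfl) k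
  · refine Fin.cases ?_ (fun k => ?_) k <;> simp only [Fin.cons_zero, Fin.cons_succ]
    · simp
    · simpa using far4 ζ θ 0 (.inr rfl) (-2) (.inr rfl) k
  · simpa using far4 ζ η 1 (.inl rfl) (-2) (.inr rfl) k

theorem q4_cont {f g h : Y → Circle} (hf : Continuous f) (hg : Continuous g) (hh : Continuous h) :
    Continuous fun y => q4 m (f y) (g y) (h y) :=
  cons_cont (by fun_prop) (cons_cont (by fun_prop) (cons_cont (by fun_prop) (cons_cont (by fun_prop) (by fun_prop))))

noncomputable def D4 (m : ℕ) : C(Circle × (Circle × B), Es (e0 B) (m + 4)) :=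
  mk0 ⟨fun p => p.2.2, by fun_prop⟩ (fun p => q4 m 1 p.1 p.2.1) (q4_cont (by fun_prop) (by fun_prop) (by fun_prop)) fun p => q4_inj _ _ _
noncomputable def D4' (m : ℕ) : C(Circle × (Circle × B), Es (e0 B) (m + 4)) :=
  mk0 ⟨fun p => p.2.2, by fun_prop⟩ (fun p => q4 m 1 p.2.1 p.1) (q4_cont (by fun_prop) (by fun_prop) (by fun_prop)) fun p => q4_inj _ _ _

noncomputable def pi4 (m : ℕ) : Equiv.Perm (Fin (m + 4)) :=
  Equiv.swap 0 (Fin.succ (Fin.succ 0)) * Equiv.swap (Fin.succ 0) (Fin.succ (Fin.succ (Fin.succ 0)))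

theorem pi4_apply : pi4 m 0 = Fin.succ (Fin.succ 0) ∧ pi4 m (Fin.succ 0) = Fin.succ (Fin.succ (Fin.succ 0)) ∧
    pi4 m (Fin.succ (Fin.succ 0)) = 0 ∧ pi4 m (Fin.succ (Fin.succ (Fin.succ 0))) = Fin.succ 0 ∧
    ∀ k : Fin m, pi4 m (Fin.succ (Fin.succ (Fin.succ (Fin.succ k)))) = Fin.succ (Fin.succ (Fin.succ (Fin.succ k))) := by
  simp only [pi4, Equiv.Perm.mul_apply]
  refine ⟨?_, ?_, ?_, ?_, fun k => ?_⟩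
  · rw [Equiv.swap_apply_of_ne_of_ne (a := Fin.succ 0) (x := 0), Equiv.swap_apply_left] <;>
    · rw [Ne, Fin.ext_iff]; simp only [Fin.val_succ, Fin.val_zero]; omega
  · rw [Equiv.swap_apply_left, Equiv.swap_apply_of_ne_of_ne] <;>
    · rw [Ne, Fin.ext_iff]; simp only [Fin.val_succ, Fin.val_zero]; omega
  · rw [Equiv.swap_apply_of_ne_of_ne (a := Fin.succ 0) (x := Fin.succ (Fin.succ 0)), Equiv.swap_apply_right] <;>
    · rw [Ne, Fin.ext_iff]; simp only [Fin.val_succ, Fin.val_zero]; omega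
  · rw [Equiv.swap_apply_right, Equiv.swap_apply_of_ne_of_ne] <;>
    · rw [Ne, Fin.ext_iff]; simp only [Fin.val_succ, Fin.val_zero]; omega
  · have : Equiv.swap (Fin.succ 0) (Fin.succ (Fin.succ (Fin.succ 0))) (Fin.succ (Fin.succ (Fin.succ (Fin.succ k)))) = (Fin.succ (Fin.succ (Fin.succ (Fin.succ k)))) := by
      rw [Equiv.swap_apply_of_ne_of_ne] <;>
      · rw [Ne, Fin.ext_iff]; simp only [Fin.val_succ, Fin.val_zero]; omega
    rw [this, Equiv.swap_apply_of_ne_of_ne] <;>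
    · rw [Ne, Fin.ext_iff]; simp only [Fin.val_succ, Fin.val_zero]; omega

theorem D4_zero {i : ℕ} (x : H i B) : cl _ _ _ (Tc (D4 m) x) = 0 := by
  have h1 : cl _ _ _ (Tc (D4 m) x) = cl _ _ _ (Tc (D4' m) x) := by
    refine cl_homot (pi4 m) ?_ _
    refine es_hom _ _ (fun p => q4 m (Circle.exp (Real.pi * (p.1 : ℝ))) p.2.1 p.2.2.1)
      (q4_cont (by fun_prop) (by fun_prop) (by fun_prop)) ?_ ?_ ?_ (fun t y => q4_inj _ _ _) (fun _ _ _ l => l.elim0)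
    · intro y; simp [D4, mk0]
    · intro y
      obtain ⟨h0, h1, h2, h3, h4⟩ := pi4_apply (m := m)
      funext k
      simp only [pm, D4', mk0, ContinuousMap.comp_apply, ContinuousMap.coe_mk]
      refine Fin.cases ?_ (fun k => Fin.cases ?_ (fun k => Fin.cases ?_ (fun k => Fin.cases ?_ (fun k => ?_) k) k) k) k
      · rw [h0]; simp only [q4, Fin.cons_succ, Fin.cons_zero]; simp
      · rw [h1]; simp only [q4, Fin.cons_succ, Fin.cons_zero]; simp
      · rw [h2]; simp only [q4, Fin.cons_succ, Fin.cons_zero]; simp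
      · rw [h3]; simp only [q4, Fin.cons_succ, Fin.cons_zero]; simp
      · rw [h4]; simp only [q4, Fin.cons_succ, Fin.cons_zero]
    · intro y; rfl
  have h2 : Tc (D4' m) x = - Tc (D4 m) x := Tc_swap (D4 (B := B) m) (D4' m) (fun α β y => rfl) x
  rw [h2, map_neg, eq_neg_iff_add_eq_zero, ← two_smul ℚ] at h1
  exact (smul_eq_zero.1 h1).resolve_left (by norm_num)

theorem term3b {i : ℕ} (w : H i B) :
    cl _ _ _ (Hm (jj (m + 3)) _ (Ta he1 (m + 2) _ (Hm (ss mo (m + 2)) _ (Hm (Dd m) _ (sig i B w))))) = 0 := by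
  refine Eq.trans ?_ (D4_zero (m := m) w)
  rw [Ta, LinearMap.comp_apply, Hm_comp, sig_nat, sig_nat, Hm_comp, Hm_comp]
  congr 1
  refine Hm_homot (line0 (B := B) (Y := Circle × (Circle × B)) (m := m + 4) _ _ ?_ fun y => ?_) _
  · intro y; rfl
  have hy := circ_re y.1
  have hy2 := circ_re y.2.1
  simp only [jj, ss, mk0, D4, q4, tau, ContinuousMap.comp_apply, ContinuousMap.coe_mk, cx, ContinuousMap.prodMap_apply, Prod.map, ContinuousMap.id_apply]
  set p : Es (e0 B) (m + 2) := Dd m y.2 with hp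
  set L := Lz p.1.2 with hL
  have hz : p.1.2 = Fin.cons 0 (Fin.cons ((y.2.1 : ℂ) / 2) (fun k : Fin m => -((k : ℕ) : ℂ) - 1)) := rfl
  have h1 : 3 / 2 ≤ L := by
    have := Lz_ge p.1.2 (Fin.succ 0)
    rw [← hL, hz, Fin.cons_succ, Fin.cons_zero, norm_div, circ_abs] at this
    norm_num at this; linarith
  have h0 : 0 < rho (e1 B) (m + 2) (p.1.1, fun k => p.1.2 k + mo * L) := rho_pos he1 (ss mo _ p)
  have h2 := rho_le_one (e1 B) (m + 2) (p.1.1, fun k => p.1.2 k + mo * L)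
  set ρ := rho (e1 B) (m + 2) (p.1.1, fun k => p.1.2 k + mo * L) with hρ
  clear_value ρ L
  simp only [e1, ContinuousMap.const_apply, zero_add]
  rw [hz, cons_add, cons_add]
  simp only [mo_mul]
  have hk (k : Fin m) : (0 : ℝ) ≤ ((k : ℕ) : ℝ) := by positivity
  have hq : -1 ≤ ρ * (y.1 : ℂ).re := by nlinarith
  have hq' : ρ * (y.1 : ℂ).re ≤ 1 := by nlinarith
  refine PS_cons (fun k => ?_) (PS_cons (fun k => ?_) (PS_cons (fun k => ?_) (PS_cons (fun k => ?_) (PS_shift (fun a b h => ?_) fun a b => ?_))))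
  · refine Fin.cases ?_ (fun k => Fin.cases ?_ (fun k => Fin.cases ?_ (fun k => ?_) k) k) k <;> simp only [Fin.cons_zero, Fin.cons_succ]
    · have := sd_neg (sd_mul (u := (y.1 : ℂ) / 2) h0 one_pos (by simp))
      simpa using this
    · apply sd_re <;> simp <;> linarith
    · apply sd_re <;> simp <;> linarith
    · have := hk k
      apply sd_re <;> simp <;> linarith
  · refine Fin.cases ?_ (fun k => Fin.cases ?_ (fun k => ?_) k) k <;> simp only [Fin.cons_zero, Fin.cons_succ]
    · apply sd_re <;> simp <;> linarith
    · apply sd_re <;> simp <;> linarith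
    · have := hk k
      apply sd_re <;> simp <;> linarith
  · refine Fin.cases ?_ (fun k => ?_) k <;> simp only [Fin.cons_zero, Fin.cons_succ]
    · have := sd_neg (sd_mul (u := (y.2.1 : ℂ) / 2) one_pos one_pos (by simp))
      simpa using this
    · have := hk k
      apply sd_re <;> simp <;> linarith
  · have := hk k
    apply sd_re <;> simp <;> linarith
  · simp only [add_left_inj] at h; exact nat_inj _ h
  · simp

theorem term3c {i : ℕ} (v : H i (Es (e1 B) m)) :
    cl _ _ _ (Hm (jj (m + 2)) _ (Ta he1 (m + 1) _ (Hm (tau he1 m) _ (sig i _ v)))) = 0 := by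
  let R : C(Circle × (Circle × Es (e1 B) m), ℝ) := ⟨fun p => rh (tau he1 m p.2), (rh_cont (B := B) (m := m + 1)).comp (by fun_prop)⟩
  let r0 : C(Circle × (Circle × Es (e1 B) m), ℝ) := ⟨fun p => rh p.2.2, (rh_cont (B := B) (m := m)).comp (by fun_prop)⟩
  have hr (p) : 0 < r0 p := rh_pos _
  have hR (p) : 0 < R p := rh_pos _
  have hRr (p) : R p ≤ r0 p / 2 := by
    have := rh_le (tau he1 m p.2) 0
    refine this.trans (le_of_eq ?_)
    simp only [tau, e1, ContinuousMap.coe_mk, Fin.cons_zero, ContinuousMap.const_apply, zero_add, norm_mul, norm_div, circ_abs, Complex.norm_real]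
    rw [Real.norm_of_nonneg (rh_pos p.2.2).le]; simp [r0]; rfl
  let c : C(Circle × (Circle × Es (e1 B) m), ℝ) := ⟨fun p => R p / (8 * r0 p), by
    refine Continuous.div (by fun_prop) (by fun_prop) fun p => by have := hr p; positivity⟩
  have hc (p) : 0 < c p ∧ c p < (ContinuousMap.const _ (1 / 8) : C(Circle × (Circle × Es (e1 B) m), ℝ)) p ∧ (ContinuousMap.const _ (1 / 8) : C(Circle × (Circle × Es (e1 B) m), ℝ)) p < 1 / 2 := by
    have h1 := hr p
    have h2 := hR p
    have h3 := hRr p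
    simp only [c, ContinuousMap.coe_mk, ContinuousMap.const_apply]
    refine ⟨by positivity, ?_, by norm_num⟩
    rw [div_lt_div_iff₀ (by positivity) (by norm_num)]; linarith
  refine Eq.trans ?_ (jacobi v c _ hc)
  · rw [Ta, LinearMap.comp_apply, Hm_comp, sig_nat, Hm_comp]
    congr 1
    refine Hm_homot (line0 (B := B) (Y := Circle × (Circle × Es (e1 B) m)) (m := m + 3) _ _ ?_ fun y => ?_) _
    · intro y; rfl
    have h1 := hr y
    have h2 := hR y
    have h3 := hRr y
    have e1' : (((jj (m + 2)).comp (tau he1 (m + 1))).comp (cx (tau he1 m)) y).1.2 =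
      Fin.cons 0 (Fin.cons (R y * ((y.1 : ℂ) / 2)) (Fin.cons (r0 y * ((y.2.1 : ℂ) / 2)) y.2.2.1.2)) := by
      simp [jj, mk0, tau, cx, e1, R, r0, rh]; rfl
    rw [e1']
    have e2 : (R y / (8 * r0 y) : ℝ) * (r0 y : ℂ) = (R y : ℂ) / 8 := by
      have : (r0 y : ℂ) ≠ 0 := by exact_mod_cast h1.ne'
      push_cast; field_simp
    have e3 : (KT (TT ⟨fun p => p.1, by fun_prop⟩ ⟨fun p => p.2.1, by fun_prop⟩ c _ hc) ⟨fun p : Circle × (Circle × Es (e1 B) m) => p.2.2, by fun_prop⟩ y).1.2 =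
      Fin.cons 0 (Fin.cons ((R y / 8 : ℝ) * (y.1 : ℂ)) (Fin.cons ((r0 y / 8 : ℝ) * (y.2.1 : ℂ)) y.2.2.1.2)) := by
      simp only [KT, mk0, c3, TT, ContinuousMap.coe_mk, ContinuousMap.const_apply, mul_zero]
      congr 1; congr 1
      · have : ((R y / 8 : ℝ) : ℂ) = (c y : ℝ) * (r0 y : ℂ) := by rw [show c y = R y / (8 * r0 y) from rfl, e2]; push_cast; ring
        rw [this]; simp [r0]; ring
      · congr 1; simp [r0]; ring
    rw [e3]
    have n1 : ‖(r0 y : ℂ) * ((y.2.1 : ℂ) / 2)‖ = r0 y / 2 := by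
      rw [norm_mul, norm_div, circ_abs, Complex.norm_real, Real.norm_of_nonneg h1.le]; norm_num; ring
    have n2 : ‖(R y : ℂ) * ((y.1 : ℂ) / 2)‖ = R y / 2 := by
      rw [norm_mul, norm_div, circ_abs, Complex.norm_real, Real.norm_of_nonneg h2.le]; norm_num; ring
    have n3 : ‖((R y / 8 : ℝ) : ℂ) * (y.1 : ℂ)‖ = R y / 8 := by
      rw [norm_mul, circ_abs, Complex.norm_real, Real.norm_of_nonneg (by positivity), mul_one]
    have n4 : ‖((r0 y / 8 : ℝ) : ℂ) * (y.2.1 : ℂ)‖ = r0 y / 8 := by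
      rw [norm_mul, circ_abs, Complex.norm_real, Real.norm_of_nonneg (by positivity), mul_one]
    have m1 : (R y : ℂ) * ((y.1 : ℂ) / 2) = (1 : ℝ) * (R y * ((y.1 : ℂ) / 2)) := by simp
    have m3 : ((R y / 8 : ℝ) : ℂ) * (y.1 : ℂ) = (1 / 4 : ℝ) * (R y * ((y.1 : ℂ) / 2)) := by push_cast; ring
    have m2 : (r0 y : ℂ) * ((y.2.1 : ℂ) / 2) = (1 : ℝ) * (r0 y * ((y.2.1 : ℂ) / 2)) := by simp
    have m4 : ((r0 y / 8 : ℝ) : ℂ) * (y.2.1 : ℂ) = (1 / 4 : ℝ) * (r0 y * ((y.2.1 : ℂ) / 2)) := by push_cast; ring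
    have c1 : (R y : ℂ) ≠ 0 := by exact_mod_cast h2.ne'
    have c2 : (r0 y : ℂ) ≠ 0 := by exact_mod_cast h1.ne'
    refine PS_cons (fun k => ?_) (PS_cons (fun k => ?_) (PS_cons (fun k => ?_) (PS_self y.2.2.2.1)))
    · refine Fin.cases ?_ (fun k => Fin.cases ?_ (fun k => ?_) k) k <;> simp only [Fin.cons_zero, Fin.cons_succ, zero_sub]
      · rw [m1, m3]; exact sd_neg (sd_mul one_pos (by norm_num) (by simp [c1]))
      · rw [m2, m4]; exact sd_neg (sd_mul one_pos (by norm_num) (by simp [c2]))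
      · refine sd_neg (sd_self fun e => ?_)
        have := rh_le y.2.2 k
        rw [e, norm_zero] at this
        exact absurd (rh_pos y.2.2) (not_lt.2 this)
    · refine Fin.cases ?_ (fun k => ?_) k <;> simp only [Fin.cons_zero, Fin.cons_succ]
      · rw [m1, m2, m3, m4, ← mul_sub, ← mul_sub]
        refine sd_mul one_pos (by norm_num) (sub_ne_zero.2 fun e => ?_)
        have := congrArg norm e
        rw [n1, n2] at this; linarith
      · exact sd_near (r := r0 y) (by rw [n2]; linarith) (by rw [n3]; linarith) (rh_le y.2.2 k)
    · exact sd_near (r := r0 y) (by rw [n1]; linarith) (by rw [n4]; linarith) (rh_le y.2.2 k)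

end
end OC

set_option linter.all false

namespace OC
open Cvx

section
variable {B Y V : Type} [TopologicalSpace B] [TopologicalSpace Y] [TopologicalSpace V] {r m : ℕ}

def Nf (m i : ℕ) (x : H i (Es (e0 B) m)) : Prop :=
  ∃ b : H i B, ∃ w ∈ DS m i, cl _ _ _ x = cl _ _ _ (Hm (pP m) i b) + cl _ _ _ w

theorem hA {i : ℕ} {y : H i (Es (e0 B) m)} (h : Nf m i y) : Nf (m + 1) i (Hm (jj m) i (Hm (ss mo m) i y)) := by
  obtain ⟨b, w, hw, h⟩ := h
  rw [← map_add] at h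
  have h2 := cl_Hm (jj m) jj_eqv (cl_Hm (ss mo m) (ss_eqv mo) h)
  rw [map_add, map_add, term1, map_add] at h2
  rcases m with _ | _ | m
  · obtain rfl : w = 0 := hw
    exact ⟨b, 0, zero_mem _, by rw [h2]; simp⟩
  · obtain rfl : w = 0 := hw
    exact ⟨b, 0, zero_mem _, by rw [h2]; simp⟩
  · obtain ⟨u, hu, rfl⟩ := hw
    exact ⟨b, Hm (Dd (m + 1)) i u, ⟨u, hu, rfl⟩, by rw [h2, term2]⟩

theorem hB {i : ℕ} {y : H i (Es (e0 B) m)} (h : Nf m i y) :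
    ∃ w ∈ DS (m + 2) (i + 1), cl _ _ _ (Hm (jj (m + 1)) _ (Ta he1 m i (Hm (ss mo m) i y))) = cl _ _ _ w := by
  obtain ⟨b, w, hw, h⟩ := h
  rw [← map_add] at h
  have h2 := cl_Hm (jj (m + 1)) jj_eqv (Ta_cl he1 (cl_Hm (ss mo m) (ss_eqv mo) h))
  rw [map_add, map_add, map_add, term3a, map_add] at h2
  refine ⟨Hm (Dd m) _ (sig i B b), ⟨_, ⟨b, rfl⟩, rfl⟩, h2.trans ?_⟩
  rw [add_eq_left]
  rcases m with _ | _ | m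
  · obtain rfl : w = 0 := hw
    simp
  · obtain rfl : w = 0 := hw
    simp
  · obtain ⟨u, hu, rfl⟩ := hw
    rcases i with _ | i
    · obtain rfl : u = 0 := hu
      simp
    · obtain ⟨u, rfl⟩ := hu
      exact term3b u

theorem nf0 (i : ℕ) (x : H i (Es (e0 B) 0)) : Nf 0 i x := by
  refine ⟨Hm ⟨fun p => p.1.1, by fun_prop⟩ i x, 0, zero_mem _, ?_⟩
  rw [Hm_comp, map_zero, add_zero]
  congr 1
  refine (Hm_id x).symm.trans ?_
  congr 2
  ext p : 1
  exact Subtype.ext (Prod.ext rfl (Subsingleton.elim _ _))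

theorem nf (m : ℕ) : ∀ (i : ℕ) (x : H i (Es (e0 B) m)), Nf m i x := by
  induction m using Nat.twoStepInduction with
  | zero => exact nf0
  | one =>
    intro i x
    have := hA (nf0 i (Hm (incl (e1 B) _) i (Hm (tt 0) i x)))
    rw [← dec0, jt] at this
    exact this
  | more m ih0 ih1 =>
    intro i x
    obtain ⟨w, hw, h⟩ := dec1 mo (Hm (tt _) i x)
    rw [← map_add] at h
    have h2 := cl_Hm (jj _) jj_eqv h
    rw [jt, map_add, map_add] at h2
    obtain ⟨b, w1, hw1, h3⟩ := hA (ih1 i (Hm (incl (e1 B) _) i (Hm (tt _) i x)))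
    rw [h3] at h2
    suffices h4 : ∃ w2 ∈ DS (m + 2) i, cl _ _ _ (Hm (jj (m + 1)) i (Hm (tau he1 m) i w)) = cl _ _ _ w2 by
      obtain ⟨w2, hw2, h4⟩ := h4
      exact ⟨b, w1 + w2, add_mem hw1 hw2, by rw [h2, h4, map_add, add_assoc]⟩
    rcases i with _ | i
    · obtain rfl : w = 0 := hw
      exact ⟨0, zero_mem _, by simp⟩
    obtain ⟨y, rfl⟩ := hw
    change ∃ w2 ∈ DS (m + 2) (i + 1), cl _ _ _ (Hm (jj (m + 1)) (i + 1) (Ta he1 m i y)) = cl _ _ _ w2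
    obtain ⟨w5, hw5, h5⟩ := hB (ih0 i (Hm (incl (e1 B) _) i y))
    rcases m with _ | m
    · rw [← dec0] at h5; exact ⟨w5, hw5, h5⟩
    · refine ⟨w5, hw5, ?_⟩
      obtain ⟨v, hv, h⟩ := dec1 mo y
      rw [← map_add] at h
      have h6 := cl_Hm (jj _) jj_eqv (Ta_cl he1 h)
      rw [h6, map_add, map_add, map_add, h5, add_eq_left]
      rcases i with _ | i
      · obtain rfl : v = 0 := hv
        simp
      · obtain ⟨v, rfl⟩ := hv
        exact term3c v

/-! ranks -/

theorem rk {U V W : Type} [AddCommGroup U] [AddCommGroup V] [AddCommGroup W] [Module ℚ U] [Module ℚ V] [Module ℚ W]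
    (f : V →ₗ[ℚ] W) (g : U →ₗ[ℚ] V) (h : LinearMap.ker f ≤ LinearMap.range g) {a b : ℕ}
    (hW : Module.rank ℚ W ≤ a) (hU : Module.rank ℚ U ≤ b) : Module.rank ℚ V ≤ (a + b : ℕ) := by
  rw [← LinearMap.rank_range_add_rank_ker f, Nat.cast_add]
  exact add_le_add ((Submodule.rank_le _).trans hW) ((Submodule.rank_mono h).trans ((rank_range_le g).trans hU))

theorem rk0 {V : Type} [AddCommGroup V] [Module ℚ V] (h : ∀ x : V, x = 0) : Module.rank ℚ V ≤ (0 : ℕ) := by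
  have : Subsingleton V := ⟨fun x y => by rw [h x, h y]⟩
  simp

theorem SG_rk {b : ℕ → ℕ} (hb : ∀ i, Module.rank ℚ (H i B) ≤ b i) : ∀ i, Module.rank ℚ (SG i B) ≤ (if i = 0 then 0 else b (i - 1) : ℕ)
  | 0 => rk0 fun x => Subtype.ext x.2
  | i + 1 => (rank_range_le (sig i B)).trans (hb i)

theorem DS_rk {b : ℕ → ℕ} (hb : ∀ i, Module.rank ℚ (H i B) ≤ b i) (i : ℕ) : ∀ m, Module.rank ℚ (DS (B := B) m i) ≤ (if i = 0 then 0 else b (i - 1) : ℕ)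
  | 0 => (rk0 fun x => Subtype.ext x.2).trans (by simp)
  | 1 => (rk0 fun x => Subtype.ext x.2).trans (by simp)
  | m + 2 => (rank_map_le _ _).trans (SG_rk hb i)

theorem HQ0_rk {b : ℕ → ℕ} (hb : ∀ i, Module.rank ℚ (H i B) ≤ b i) (m i : ℕ) :
    Module.rank ℚ (HQ (e0 B) m i) ≤ (b i + if i = 0 then 0 else b (i - 1) : ℕ) := by
  have : (LinearMap.range (cl (e0 B) m i ∘ₗ Hm (pP m) i)) ⊔ (DS m i).map (cl _ _ _) = ⊤ := by
    refine Submodule.eq_top_iff'.2 fun x => ?_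
    obtain ⟨x, rfl⟩ := Submodule.mkQ_surjective _ x
    obtain ⟨b, w, hw, h⟩ := nf m i x
    exact Submodule.mem_sup.2 ⟨_, ⟨b, rfl⟩, _, ⟨w, hw, rfl⟩, h.symm⟩
  rw [← rank_top, ← this]
  refine (Submodule.rank_add_le_rank_add_rank _ _).trans ?_
  rw [Nat.cast_add]
  exact add_le_add ((rank_range_le _).trans (hb i)) ((rank_map_le _ _).trans (DS_rk hb i m))

noncomputable def qi (s : Fin (r + 1) → C(B, ℂ)) (m i : ℕ) : HQ s m i →ₗ[ℚ] HQ (tl s) m i :=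
  Submodule.mapQ _ _ (Hm (incl s m) i) fun x hx => by
    have : cl s m i x = cl s m i 0 := by rw [map_zero]; exact (Submodule.Quotient.mk_eq_zero _).2 hx
    have := cl_Hm (incl s m) (fun γ => ⟨γ, fun p => rfl⟩) this
    rw [map_zero, map_zero] at this
    exact Submodule.mem_comap.2 ((Submodule.Quotient.mk_eq_zero _).1 this)

noncomputable def qT {s : Fin (r + 1) → C(B, ℂ)} (hs : ∀ b, Function.Injective fun l => s l b) (m i : ℕ) : HQ s m i →ₗ[ℚ] HQ s (m + 1) (i + 1) :=
  Submodule.mapQ _ _ (Ta hs m i) fun x hx => by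
    have : cl s m i x = cl s m i 0 := by rw [map_zero]; exact (Submodule.Quotient.mk_eq_zero _).2 hx
    have := Ta_cl hs this
    rw [map_zero, map_zero] at this
    exact Submodule.mem_comap.2 ((Submodule.Quotient.mk_eq_zero _).1 this)

def bk (b : ℕ → ℕ) : ℕ → ℕ → ℕ
  | 0, i => b i
  | k + 1, i => ∑ j ∈ Finset.range (i + 1), bk b k j

theorem HQ_rk {b : ℕ → ℕ} (h0 : ∀ m i, Module.rank ℚ (HQ (e0 B) m i) ≤ b i) : ∀ (r : ℕ) (s : Fin r → C(B, ℂ))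
    (hs : ∀ b, Function.Injective fun l => s l b) (m i : ℕ), Module.rank ℚ (HQ s m i) ≤ bk b r i := by
  intro r
  induction r with
  | zero =>
    intro s hs m i
    obtain rfl : s = e0 B := Subsingleton.elim _ _
    exact h0 m i
  | succ r ih =>
    intro s hs m
    have ht := ih (tl s) (fun b x y h => Fin.succ_injective _ (hs b h))
    induction m with
    | zero =>
      intro i
      have := rk (qi s 0 i) (0 : PUnit →ₗ[ℚ] _) (fun x hx => by
        obtain ⟨x, rfl⟩ := Submodule.mkQ_surjective _ x
        rw [L1z x hx]; simp) (b := 0) (ht 0 i) (by simp)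
      refine this.trans ?_
      rw [Nat.cast_le, bk, Finset.sum_range_succ]; omega
    | succ m ihm =>
      intro i
      rcases i with _ | i
      · have := rk (qi s (m + 1) 0) (0 : PUnit →ₗ[ℚ] _) (fun x hx => by
          obtain ⟨x, rfl⟩ := Submodule.mkQ_surjective _ x
          obtain ⟨w, hw, h⟩ := L1 hs x hx
          obtain rfl : w = 0 := hw
          rw [map_zero, map_zero] at h
          rw [h]; simp) (b := 0) (ht _ _) (by simp)
        refine this.trans ?_
        rw [Nat.cast_le, bk, Finset.sum_range_succ]; omega
      · have := rk (qi s (m + 1) (i + 1)) (qT hs m i) (fun x hx => by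
          obtain ⟨x, rfl⟩ := Submodule.mkQ_surjective _ x
          obtain ⟨w, ⟨w, rfl⟩, h⟩ := L1 hs x hx
          exact ⟨cl s m i w, h.symm⟩) (ht _ _) (ihm i)
        refine this.trans ?_
        rw [Nat.cast_le, bk, bk, Finset.sum_range_succ _ (i + 1)]; omega

theorem bk_le {b : ℕ → ℕ} {D M : ℕ} (h : ∀ i, b i ≤ D) (hM : ∀ i, M ≤ i → b i = 0) (k i : ℕ) : bk b (k + 1) i ≤ D * M * (i + 1) ^ k := by
  induction k generalizing i with
  | zero =>
    simp only [bk, pow_zero, mul_one]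
    calc ∑ j ∈ Finset.range (i + 1), b j ≤ ∑ j ∈ Finset.range (i + 1), (if j < M then D else 0) := Finset.sum_le_sum fun j _ => by
          split_ifs with hj
          · exact h j
          · rw [hM j (not_lt.1 hj)]
      _ = ∑ j ∈ (Finset.range (i + 1)).filter (· < M), D := by rw [Finset.sum_filter]
      _ ≤ ∑ j ∈ Finset.range M, D := Finset.sum_le_sum_of_subset fun j hj => by simp at hj ⊢; exact hj.2
      _ = D * M := by simp [mul_comm]
  | succ k ih =>
    rw [bk]
    calc _ ≤ ∑ j ∈ Finset.range (i + 1), D * M * (i + 1) ^ k := Finset.sum_le_sum fun j hj => (ih j).trans (by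
          have : j + 1 ≤ i + 1 := Finset.mem_range.1 hj
          gcongr)
      _ = _ := by simp; ring

/-- the main estimate -/
theorem HQ_bound {C N : ℕ} (h : ∀ i, Module.rank ℚ (H i B) ≤ C) (hN : ∀ i, N ≤ i → ∀ x : H i B, x = 0) (r : ℕ) : ∃ K : ℕ,
    ∀ (s : Fin r → C(B, ℂ)) (hs : ∀ b, Function.Injective fun l => s l b) (m i : ℕ),
      Module.rank ℚ (HQ s m i) ≤ (K * (i + 1) ^ (r - 1) : ℕ) := by
  let b (i : ℕ) : ℕ := if i < N then C else 0
  have hb (i) : Module.rank ℚ (H i B) ≤ b i := by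
    by_cases hi : i < N
    · simp only [b, hi, if_true]; exact h i
    · simp only [b, hi, if_false]; exact rk0 (hN i (not_lt.1 hi))
  let b' (i : ℕ) : ℕ := b i + if i = 0 then 0 else b (i - 1)
  have hb' (i) : b' i ≤ 2 * C := by simp only [b', b]; split_ifs <;> omega
  have hM (i) (hi : N + 1 ≤ i) : b' i = 0 := by simp only [b', b]; split_ifs <;> omega
  refine ⟨2 * C * (N + 1), fun s hs m i => (HQ_rk (b := b') (HQ0_rk hb) r s hs m i).trans ?_⟩
  rw [Nat.cast_le]
  rcases r with _ | r
  · simp only [bk]; rw [Nat.zero_sub, pow_zero, mul_one]; nlinarith [hb' i]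
  · exact bk_le hb' hM r i

end
end OC

set_option linter.all false

namespace OC
open Cvx

section
variable {Y : Type} [TopologicalSpace Y]

/-- the homology of `A` in degree `i` is generated by `C` classes -/
def FB (A : Set Y) (i C : ℕ) : Prop := ∃ S : Submodule ℚ (Ch (i + 1) Y), Module.rank ℚ S ≤ C ∧
  ∀ z ∈ Zc i Y, z ∈ sup A (i + 1) → ∃ s ∈ S, ∃ e ∈ sup A (i + 2), z = s + d (i + 1) e

theorem small' {A B : Set Y} (hA : IsOpen A) (hB : IsOpen B) {n : ℕ} {c : Ch (n + 1) Y} (hs : c ∈ sup (A ∪ B) (n + 1))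
    (hc : c ∈ Zc n Y) : ∃ a ∈ sup A (n + 1), ∃ b ∈ sup B (n + 1), ∃ e ∈ sup (A ∪ B) (n + 2), c = a + b + d (n + 1) e := by
  obtain ⟨c, rfl⟩ := sup_lift hs
  let I := inc (A ∪ B)
  have hZ := Zc_inc I Subtype.val_injective hc
  obtain ⟨a, ha, b, hb, e, h⟩ := small_chains (hA.preimage I.continuous) (hB.preimage I.continuous) (fun y => y.2) c (by
    rcases hZ with rfl | h
    · exact Submodule.mem_sup_left (mem_univ (fun s t => absurd t.2.2 (by simp)) _)
    · rw [h]; exact zero_mem _)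
  refine ⟨cm I _ a, cm_sup I (fun y hy => hy) ha, cm I _ b, cm_sup I (fun y hy => hy) hb, cm I _ e, cm_range I (fun y => y.2) e, ?_⟩
  rw [d_cm, ← map_add, ← map_add, ← h]

theorem rk_sup {V : Type} [AddCommGroup V] [Module ℚ V] {S T : Submodule ℚ V} {a b : ℕ} (hS : Module.rank ℚ S ≤ a) (hT : Module.rank ℚ T ≤ b) :
    Module.rank ℚ ↥(S ⊔ T) ≤ (a + b : ℕ) := by
  rw [Nat.cast_add]
  exact (Submodule.rank_add_le_rank_add_rank _ _).trans (add_le_add hS hT)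

theorem rsec {V W : Type} [AddCommGroup V] [Module ℚ V] [AddCommGroup W] [Module ℚ W] (D : V →ₗ[ℚ] W) :
    ∃ g : LinearMap.range D →ₗ[ℚ] V, D.rangeRestrict ∘ₗ g = LinearMap.id :=
  D.rangeRestrict.exists_rightInverse_of_surjective D.range_rangeRestrict

theorem FB_union {A B : Set Y} (hA : IsOpen A) (hB : IsOpen B) {a b c : ℕ → ℕ} (h1 : ∀ i, FB A i (a i)) (h2 : ∀ i, FB B i (b i))
    (h3 : ∀ i, FB (A ∩ B) i (c i)) (i : ℕ) : FB (A ∪ B) i (a i + b i + if i = 0 then 0 else c (i - 1)) := by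
  obtain ⟨S1, r1, h1⟩ := h1 i
  obtain ⟨S2, r2, h2⟩ := h2 i
  rcases i with _ | i
  · refine ⟨S1 ⊔ S2, by simpa using rk_sup r1 r2, fun z hz hs => ?_⟩
    obtain ⟨a, ha, b, hb, e, he, rfl⟩ := small' hA hB hs hz
    obtain ⟨s1, hs1, e1, he1, rfl⟩ := h1 a (Or.inl rfl) ha
    obtain ⟨s2, hs2, e2, he2, rfl⟩ := h2 b (Or.inl rfl) hb
    refine ⟨s1 + s2, Submodule.add_mem_sup hs1 hs2, e1 + e2 + e, add_mem (add_mem (sup_mono Set.subset_union_left he1) (sup_mono Set.subset_union_right he2)) he, ?_⟩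
    simp only [map_add]; abel
  · obtain ⟨S3, r3, h3⟩ := h3 i
    let P : Submodule ℚ (Ch (i + 2) Y × Ch (i + 2) Y) :=
      ((sup A (i + 2)).prod (sup B (i + 2))) ⊓ LinearMap.ker (d (i + 1) ∘ₗ (LinearMap.fst ℚ _ _ + LinearMap.snd ℚ _ _)) ⊓
        S3.comap (d (i + 1) ∘ₗ LinearMap.fst ℚ _ _)
    let D : P →ₗ[ℚ] S3 := LinearMap.codRestrict S3 ((d (i + 1) ∘ₗ LinearMap.fst ℚ _ _) ∘ₗ P.subtype) fun p => p.2.2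
    obtain ⟨g, hg⟩ := rsec D
    let g' : LinearMap.range D →ₗ[ℚ] Ch (i + 2) Y := (LinearMap.fst ℚ _ _ + LinearMap.snd ℚ _ _) ∘ₗ P.subtype ∘ₗ g
    refine ⟨S1 ⊔ S2 ⊔ LinearMap.range g', rk_sup (rk_sup r1 r2) ((rank_range_le _).trans ((Submodule.rank_le _).trans r3)), fun z hz hs => ?_⟩
    obtain ⟨a, ha, b, hb, e, he, rfl⟩ := small' hA hB hs hz
    have hz' : d (i + 1) a + d (i + 1) b = 0 := by
      have := hz.resolve_left (by simp)
      rw [map_add, map_add, d_d, add_zero] at this; exact this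
    obtain ⟨s3, hs3, e3, he3, h⟩ := h3 (d (i + 1) a) (d_mem_Zc _) (sup_inter (d_sup ha) (by rw [eq_neg_of_add_eq_zero_left hz']; exact neg_mem (d_sup hb)))
    have e3A := sup_mono (Set.inter_subset_left) he3
    have e3B := sup_mono (Set.inter_subset_right) he3
    have hd : d (i + 1) (a - e3) = s3 := by rw [map_sub, h]; abel
    let p : P := ⟨(a - e3, b + e3), ⟨⟨sub_mem ha e3A, add_mem hb e3B⟩, by
      rw [SetLike.mem_coe, LinearMap.mem_ker]; simp only [LinearMap.comp_apply, LinearMap.add_apply, LinearMap.fst_apply, LinearMap.snd_apply]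
      rw [show a - e3 + (b + e3) = a + b by abel, map_add, hz']⟩, by
      rw [SetLike.mem_coe, Submodule.mem_comap]; simp only [LinearMap.comp_apply, LinearMap.fst_apply]; rw [hd]; exact hs3⟩
    let q : P := g (D.rangeRestrict p)
    have hq : d (i + 1) q.1.1 = s3 := by
      have := congrArg (fun x => (x.1.1 : Ch (i + 1) Y)) (LinearMap.congr_fun hg (D.rangeRestrict p))
      exact this.trans hd
    have hq2 : d (i + 1) q.1.1 + d (i + 1) q.1.2 = 0 := by
      have := q.2.1.2
      rw [SetLike.mem_coe, LinearMap.mem_ker] at this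
      simpa using this
    have hd2 : d (i + 1) (b + e3) = - s3 := by rw [← hd, map_add, map_sub, eq_neg_of_add_eq_zero_right hz']; abel
    obtain ⟨s1, hs1, e1, he1, h4⟩ := h1 (a - e3 - q.1.1) (Zc_of (by rw [map_sub, hd, hq, sub_self])) (sub_mem (sub_mem ha e3A) q.2.1.1.1)
    obtain ⟨s2, hs2, e2, he2, h5⟩ := h2 (b + e3 - q.1.2) (Zc_of (by rw [map_sub, hd2, eq_neg_of_add_eq_zero_right hq2, hq, sub_self]))
      (sub_mem (add_mem hb e3B) q.2.1.1.2)
    refine ⟨s1 + s2 + g' (D.rangeRestrict p), Submodule.add_mem_sup (Submodule.add_mem_sup hs1 hs2) ⟨_, rfl⟩, e1 + e2 + e,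
      add_mem (add_mem (sup_mono Set.subset_union_left he1) (sup_mono Set.subset_union_right he2)) he, ?_⟩
    have : g' (D.rangeRestrict p) = q.1.1 + q.1.2 := rfl
    rw [this, map_add, map_add, show s1 + s2 + (q.1.1 + q.1.2) + (d (i + 1 + 1) e1 + d (i + 1 + 1) e2 + d (i + 1 + 1) e) =
      (s1 + d (i + 1 + 1) e1) + (s2 + d (i + 1 + 1) e2) + (q.1.1 + q.1.2) + d (i + 1 + 1) e by abel, ← h4, ← h5]
    abel

theorem FB_empty (i : ℕ) : FB (∅ : Set Y) i 0 :=
  ⟨⊥, rk0 fun x => Subtype.ext x.2, fun z _ hs => ⟨0, zero_mem _, 0, zero_mem _, by rw [sup_bot hs]; simp⟩⟩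

instance dl1 : Subsingleton (Dl 1) := ⟨fun x y => by
  have hx := x.2.2
  have hy := y.2.2
  simp at hx hy
  apply Subtype.ext; funext k
  rw [Subsingleton.elim k 0]; exact hx.trans hy.symm⟩

theorem pt_cyc {i : ℕ} (z : Ch (i + 2) (Dl 1)) (hz : d (i + 1) z = 0) : ∃ e, d (i + 2) e = z := by
  have hs : ∀ {n : ℕ} (z : Ch n (Dl 1)), ∃ z', rl n z' = z := fun {n} z => by
    refine ⟨pf (fun s => fun _ => default) z, ?_⟩
    rw [rl, pf_pf]
    refine Eq.trans ?_ (pf_id z)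
    congr 2; funext s; ext t : 1; exact Subsingleton.elim _ _
  obtain ⟨z', rfl⟩ := hs z
  rw [d_rl] at hz
  have h0 : lb (i + 1) z' = 0 := by
    refine Finsupp.mapDomain_injective (f := (aff : (Fin (i + 1) → Dl 1) → C(Dl (i + 1), Dl 1))) (fun v w _ => Subsingleton.elim _ _) ?_
    rw [Finsupp.mapDomain_zero]; exact hz
  refine ⟨rl _ (cone default z'), ?_⟩
  rw [d_rl, lb_cone, h0]; simp

theorem FB_contr {A : Set Y} (h : (ContinuousMap.id A).Nullhomotopic) (i : ℕ) : FB A i (if i = 0 then 1 else 0) := by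
  obtain ⟨y, h⟩ := h
  let f : C(A, Dl 1) := ContinuousMap.const _ default
  let g : C(Dl 1, A) := ContinuousMap.const _ y
  have key : ∀ z ∈ Zc i Y, z ∈ sup A (i + 1) → ∃ z' ∈ Zc i A, ∃ e ∈ sup A (i + 2), z = cm (inc A) _ (cm g _ (cm f _ z')) + d (i + 1) e := by
    intro z hz hs
    obtain ⟨z', rfl⟩ := sup_lift hs
    have hz' := Zc_inc _ Subtype.val_injective hz
    have := Hm_homot h (hk i A ⟨z', hz'⟩)
    rw [Hm_hk, Hm_hk, hk_eq] at this
    obtain ⟨e, he⟩ := this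
    refine ⟨z', hz', cm (inc A) _ e, cm_range _ (fun y => y.2) _, ?_⟩
    rw [d_cm, he, ← map_add, cm_cm]
    congr 1
    simp only [cm_id]
    rw [show g.comp f = ContinuousMap.const _ y from rfl]; abel
  rcases i with _ | i
  · refine ⟨LinearMap.range (cm ((inc A).comp g) 1), (rank_range_le _).trans ?_, fun z hz hs => ?_⟩
    · have : Subsingleton C(Dl 1, Dl 1) := ⟨fun a b => by ext t : 1; exact Subsingleton.elim _ _⟩
      rw [rank_finsupp_self]; simp [Cardinal.le_one_iff_subsingleton, this]
    · obtain ⟨z', hz', e, he, h⟩ := key z hz hs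
      exact ⟨_, ⟨cm f _ z', rfl⟩, e, he, by rw [h, cm_cm (inc A)]⟩
  · refine ⟨⊥, rk0 fun x => Subtype.ext x.2, fun z hz hs => ?_⟩
    obtain ⟨z', hz', e, he, h⟩ := key z hz hs
    obtain ⟨w, hw⟩ := pt_cyc (cm f _ z') (by rw [d_cm, hz'.resolve_left (by simp), map_zero])
    refine ⟨0, zero_mem _, cm (inc A) _ (cm g _ w) + e, add_mem (cm_range _ (fun y => y.2) _) he, ?_⟩
    rw [h, ← hw, map_add, d_cm, d_cm, zero_add]

def gb : ℕ → ℕ → ℕ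
  | 0, _ => 0
  | k + 1, i => (if i = 0 then 1 else 0) + gb k i + if i = 0 then 0 else gb k (i - 1)

theorem gb_le (k i : ℕ) : gb k i ≤ 2 ^ k - 1 := by
  induction k generalizing i with
  | zero => simp [gb]
  | succ k ih =>
    have h1 := ih i
    have h2 := ih (i - 1)
    have h3 : 1 ≤ 2 ^ k := Nat.one_le_two_pow
    rw [gb, pow_succ]; split_ifs <;> omega

theorem gb_zero (k i : ℕ) (h : k ≤ i) : gb k i = 0 := by
  induction k generalizing i with
  | zero => simp [gb]
  | succ k ih => rw [gb, ih i (by omega), ih (i - 1) (by omega)]; split_ifs <;> omega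

theorem FB_cover (𝒢 : Set (Set Y)) (ho : ∀ A ∈ 𝒢, IsOpen A) (hc : ∀ A ∈ 𝒢, A = ∅ ∨ (ContinuousMap.id A).Nullhomotopic)
    (hi : ∀ A ∈ 𝒢, ∀ A' ∈ 𝒢, A ∩ A' ∈ 𝒢) (k : ℕ) : ∀ (U : Fin k → Set Y), (∀ j, U j ∈ 𝒢) → ∀ i, FB (⋃ j, U j) i (gb k i) := by
  induction k with
  | zero => intro U _ i; rw [Set.iUnion_of_empty]; exact FB_empty i
  | succ k ih =>
    intro U hU
    have e : (⋃ j, U j) = U 0 ∪ ⋃ j : Fin k, U j.succ := by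
      ext x; simp [Fin.exists_fin_succ]
    rw [e]
    have h0 : ∀ i, FB (U 0) i (if i = 0 then 1 else 0) := by
      intro i
      rcases hc _ (hU 0) with h | h
      · rw [h]
        obtain ⟨S, hS, h⟩ := FB_empty (Y := Y) i
        exact ⟨S, hS.trans (by simp), h⟩
      · exact FB_contr h i
    refine FB_union (ho _ (hU 0)) (isOpen_iUnion fun j => ho _ (hU _)) h0 (ih _ fun j => hU _) (c := gb k) ?_
    rw [Set.inter_iUnion]
    exact ih _ fun j => hi _ (hU _) _ (hU _)

theorem H_fin (𝒢 : Set (Set Y)) (ho : ∀ A ∈ 𝒢, IsOpen A) (hc : ∀ A ∈ 𝒢, A = ∅ ∨ (ContinuousMap.id A).Nullhomotopic)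
    (hi : ∀ A ∈ 𝒢, ∀ A' ∈ 𝒢, A ∩ A' ∈ 𝒢) {ι : Type} [Finite ι] (U : ι → Set Y) (hU : ∀ j, U j ∈ 𝒢) (hY : ∀ y, ∃ j, y ∈ U j) :
    ∃ C N : ℕ, (∀ i, Module.rank ℚ (H i Y) ≤ C) ∧ ∀ i, N ≤ i → ∀ x : H i Y, x = 0 := by
  obtain ⟨k, ⟨e⟩⟩ := Finite.exists_equiv_fin ι
  have h := FB_cover 𝒢 ho hc hi k (U ∘ e.symm) (fun j => hU _)
  have hu : (⋃ j, (U ∘ e.symm) j) = Set.univ := by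
    refine Set.eq_univ_of_forall fun y => ?_
    obtain ⟨j, hj⟩ := hY y
    exact Set.mem_iUnion.2 ⟨e j, by simpa using hj⟩
  rw [hu] at h
  have hr : ∀ i, Module.rank ℚ (H i Y) ≤ gb k i := fun i => by
    obtain ⟨S, hS, h⟩ := h i
    let f : (S.submoduleOf (Zc i Y)) →ₗ[ℚ] H i Y := hk i Y ∘ₗ Submodule.subtype _
    have hf : Function.Surjective f := fun x => by
      obtain ⟨⟨z, hz⟩, rfl⟩ := hk_surj i x
      obtain ⟨s, hs, e, he, rfl⟩ := h z hz (mem_univ (fun _ _ => trivial) _)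
      have hs' : s ∈ Zc i Y := by
        have := sub_mem hz (d_mem_Zc e); rwa [add_sub_cancel_right] at this
      refine ⟨⟨⟨s, hs'⟩, hs⟩, ?_⟩
      refine (hk_eq _ _).2 ⟨-e, ?_⟩
      simp
    refine (LinearMap.rank_le_of_surjective f hf).trans (le_trans ?_ hS)
    exact LinearMap.rank_le_of_injective (LinearMap.restrict (Zc i Y).subtype (p := S.submoduleOf (Zc i Y)) (q := S) fun x hx => hx)
      fun x y h => Subtype.ext (Subtype.ext (congrArg (fun s : S => s.1) h))
  refine ⟨2 ^ k - 1, k, fun i => (hr i).trans (by exact_mod_cast gb_le k i), fun i hi x => ?_⟩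
  have := hr i
  rw [gb_zero k i hi, Nat.cast_zero, nonpos_iff_eq_zero, rank_zero_iff] at this
  exact Subsingleton.elim _ _

end
end OC

set_option linter.all false
namespace OC
open Cvx
section

theorem lift_ex {A E X : Type} [TopologicalSpace A] [TopologicalSpace E] [TopologicalSpace X] [ContractibleSpace A] {p : E → X}
    (hp : IsCoveringMap p) (hs : Function.Surjective p) (f : C(A, X)) : ∃ g : C(A, E), ∀ x, p (g x) = f x := by
  obtain ⟨a, ⟨K⟩⟩ := id_nullhomotopic A
  obtain ⟨e, he⟩ := hs (f a)
  let K' := K.symm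
  let T : C(unitInterval × A, X) := f.comp K'.toContinuousMap
  have h0 : ∀ x, T (0, x) = p (ContinuousMap.const A e x) := fun x => by
    change f (K' (0, x)) = p e; rw [K'.apply_zero, he]; rfl
  refine ⟨(hp.liftHomotopy T (ContinuousMap.const A e) h0).comp ⟨fun x => (1, x), by fun_prop⟩, fun x => ?_⟩
  refine (congrFun (hp.liftHomotopy_lifts T _ h0) (1, x)).trans ?_
  change f (K' (1, x)) = f x; rw [K'.apply_one]; rfl

variable {G X : Type} [Group G] [MulAction G X] [TopologicalSpace X] {F : Finset ℂ} {π : X → {z : ℂ // z ∉ (F : Set ℂ)}}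

instance {n : ℕ} [T2Space X] : T2Space (orbitConfigSp G X n) := inferInstanceAs (T2Space {x : Fin n → X | _})

theorem oc_val (n : ℕ) : Continuous (fun x : orbitConfigSp G X n => x.1) := continuous_subtype_val

def qm (G : Type) [Group G] [MulAction G X] (hπ : IsCoveringMap π) (a : ℕ) : C(orbitConfigSp G X a, Fin a → ℂ) :=
  ⟨fun x j => (π (x.1 j)).1, continuous_pi fun j => continuous_subtype_val.comp (hπ.continuous.comp ((continuous_apply j).comp (oc_val a)))⟩

theorem qm_inj (hπ : IsCoveringMap π) (a : ℕ) : IsLocallyInjective (qm G hπ a) := fun x => by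
  choose U hU hx hi using fun j => hπ.isLocalHomeomorph.isLocallyInjective (x.1 j)
  refine ⟨{y | ∀ j, y.1 j ∈ U j}, ?_, hx, fun y hy z hz h => ?_⟩
  · simp only [Set.setOf_forall]
    exact isOpen_iInter_of_finite fun j => (hU j).preimage ((continuous_apply j).comp (oc_val a))
  · exact Subtype.ext (funext fun j => hi j (hy j) (hz j) (Subtype.ext (congrFun h j)))

theorem quad (w : ℂ) (hw : w ≠ 0) : ∃ k : Fin 4, 0 < (Complex.I ^ (k : ℕ) * w).re := by
  by_contra! h
  have h0 := h 0; have h1 := h 1; have h2 := h 2; have h3 := h 3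
  simp [pow_succ] at h0 h1 h2 h3
  exact hw (Complex.ext (by simp; linarith) (by simp; linarith))

def Uq (F : Finset ℂ) (a : ℕ) (t : (Fin a → Fin a → Fin 4) × (Fin a → F → Fin 4)) : Set (Fin a → ℂ) :=
  (⋂ (i) (j) (_ : i ≠ j), {w | 0 < (Complex.I ^ (t.1 i j : ℕ) * (w i - w j)).re}) ∩
    ⋂ (i) (f : F), {w | (Complex.I ^ (t.2 i f : ℕ) * f.1).re < (Complex.I ^ (t.2 i f : ℕ) * w i).re}

theorem Uq_open (a t) : IsOpen (Uq F a t) :=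
  (isOpen_iInter_of_finite fun i => isOpen_iInter_of_finite fun j => isOpen_iInter_of_finite fun _ => isOpen_lt (by fun_prop) (by fun_prop)).inter
    (isOpen_iInter_of_finite fun i => isOpen_iInter_of_finite fun j => isOpen_lt (by fun_prop) (by fun_prop))

theorem Uq_convex (a t) : Convex ℝ (Uq F a t) :=
  (convex_iInter fun i => convex_iInter fun j => convex_iInter fun _ => convex_halfSpace_gt
      ⟨fun x y => by simp; ring, fun c x => by simp; ring⟩ _).inter
    (convex_iInter fun i => convex_iInter fun j => convex_halfSpace_gt ⟨fun x y => by simp; ring, fun c x => by simp; ring⟩ _)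

theorem Uq_ne {a t} {w} (hw : w ∈ Uq F a t) {i j} (h : i ≠ j) : w i ≠ w j := fun e => by
  have := Set.mem_iInter.1 (Set.mem_iInter.1 (Set.mem_iInter.1 hw.1 i) j) h
  simp [e] at this

theorem Uq_nF {a t} {w} (hw : w ∈ Uq F a t) (i) : w i ∉ (F : Set ℂ) := fun e => by
  have := Set.mem_iInter.1 (Set.mem_iInter.1 hw.2 i) ⟨w i, e⟩
  exact lt_irrefl _ (Set.mem_setOf_eq ▸ this)

theorem Uq_cov {a} {w : Fin a → ℂ} (h1 : Function.Injective w) (h2 : ∀ i, w i ∉ F) : ∃ t, w ∈ Uq F a t := by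
  choose t ht using fun i j => fun h : w i - w j ≠ 0 => quad _ h
  choose t' ht' using fun i (f : F) => quad (w i - f.1) (sub_ne_zero.2 fun e => h2 i (e ▸ f.2))
  classical
  refine ⟨(fun i j => if h : w i - w j ≠ 0 then t i j h else 0, t'), ?_, ?_⟩
  · simp only [Set.mem_iInter]
    intro i j hij
    have h : w i - w j ≠ 0 := sub_ne_zero.2 (h1.ne hij)
    change 0 < (Complex.I ^ ((if h : w i - w j ≠ 0 then t i j h else 0 : Fin 4) : ℕ) * (w i - w j)).re
    rw [dif_pos h]; exact ht i j h
  · simp only [Set.mem_iInter]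
    intro i f
    have := ht' i f
    rw [mul_sub, Complex.sub_re, sub_pos] at this
    exact this

theorem B_fin [Finite G] [T2Space X] [ContinuousConstSMul G X] (hπ : IsCoveringMap π) (hs : Function.Surjective π)
    (hG : ∀ x y, π x = π y ↔ ∃ g : G, g • x = y) (a : ℕ) :
    ∃ C N : ℕ, (∀ i, Module.rank ℚ (H i (orbitConfigSp G X a)) ≤ C) ∧ ∀ i, N ≤ i → ∀ x : H i (orbitConfigSp G X a), x = 0 := by
  let q := qm G hπ a
  let 𝒢 : Set (Set (orbitConfigSp G X a)) := {A | ∃ U : Set (Fin a → ℂ), IsOpen U ∧ Convex ℝ U ∧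
    ∃ σ : C(U, orbitConfigSp G X a), (∀ z, q (σ z) = z.1) ∧ A = Set.range σ}
  have lif : ∀ t, ∃ s : Fin a → C(Uq F a t, X), ∀ j z, (π (s j z)).1 = z.1 j := fun t => by
    rcases (Uq F a t).eq_empty_or_nonempty with h | h
    · haveI : IsEmpty (Uq F a t) := Set.isEmpty_coe_sort.2 h
      exact ⟨fun j => ⟨fun z => isEmptyElim z, continuous_of_discreteTopology⟩, fun j z => isEmptyElim z⟩
    · haveI := (Uq_convex a t).contractibleSpace h
      choose s hs using fun j => lift_ex hπ hs (⟨fun z => ⟨z.1 j, Uq_nF z.2 j⟩, Continuous.subtype_mk ((continuous_apply j).comp continuous_subtype_val) _⟩ : C(Uq F a t, {z : ℂ // z ∉ (F : Set ℂ)}))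
      exact ⟨s, fun j z => congrArg Subtype.val (hs j z)⟩
  choose s hs' using lif
  have hGi : ∀ (g : G) x, π (g • x) = π x := fun g x => ((hG _ _).2 ⟨g, rfl⟩).symm
  let σ : ∀ (k : ((Fin a → Fin a → Fin 4) × (Fin a → F → Fin 4)) × (Fin a → G)), C(Uq F a k.1, orbitConfigSp G X a) := fun k =>
    ⟨fun z => ⟨fun j => k.2 j • s k.1 j z, fun i j hij g h => Uq_ne z.2 hij (by
      have := congrArg (fun x => (π x).1) h
      simp only [hGi] at this
      rwa [hs', hs'] at this)⟩, Continuous.subtype_mk (continuous_pi fun j => ((s k.1 j).continuous).const_smul _) _⟩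
  have hσ : ∀ k z, q (σ k z) = z.1 := fun k z => funext fun j => (congrArg Subtype.val (hGi _ _)).trans (hs' k.1 j z)
  refine H_fin 𝒢 ?_ ?_ ?_ (fun k => Set.range (σ k)) (fun k => ⟨_, Uq_open _ _, Uq_convex _ _, σ k, hσ k, rfl⟩) fun x => ?_
  · rintro _ ⟨U, hU, -, σ, hσ, rfl⟩
    have h := (qm_inj (G := G) hπ a).isOpen_eqLocus (g₁ := fun x : q ⁻¹' U => x.1) (g₂ := fun x => σ ⟨q x.1, x.2⟩) continuous_subtype_val (by fun_prop)
      (funext fun x => (hσ ⟨q x.1, x.2⟩).symm)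
    have h2 := (hU.preimage q.continuous).isOpenMap_subtype_val _ h
    convert h2
    ext x
    constructor
    · rintro ⟨z, rfl⟩
      refine ⟨⟨σ z, by change q _ ∈ U; rw [hσ]; exact z.2⟩, ?_, rfl⟩
      change σ z = σ ⟨q (σ z), _⟩
      congr 1; exact Subtype.ext (hσ z).symm
    · rintro ⟨x, hx, rfl⟩
      exact ⟨_, hx.symm⟩
  · rintro _ ⟨U, -, hU, σ, hσ, rfl⟩
    rcases U.eq_empty_or_nonempty with h | h
    · haveI : IsEmpty U := Set.isEmpty_coe_sort.2 h
      exact Or.inl (Set.range_eq_empty _)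
    · right
      haveI := hU.contractibleSpace h
      have hm : ∀ x : Set.range σ, q x.1 ∈ U := by rintro ⟨_, z, rfl⟩; rw [hσ]; exact z.2
      let e : Set.range σ ≃ₜ U :=
        { toFun := fun x => ⟨q x.1, hm x⟩
          invFun := fun z => ⟨σ z, z, rfl⟩
          left_inv := by
            rintro ⟨_, z, rfl⟩
            refine Subtype.ext ?_
            change σ _ = σ z
            congr 1; exact Subtype.ext (hσ z)
          right_inv := fun z => Subtype.ext (hσ z)
          continuous_toFun := by fun_prop
          continuous_invFun := by fun_prop }
      haveI := e.contractibleSpace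
      exact id_nullhomotopic _
  · rintro _ ⟨U, hU, hUc, σ, hσ, rfl⟩ _ ⟨U', hU', hUc', σ', hσ', rfl⟩
    let V := U ∩ U'
    have hV : Convex ℝ V := hUc.inter hUc'
    haveI : PreconnectedSpace V := Subtype.preconnectedSpace hV.isPreconnected
    by_cases h : ∃ z : V, σ ⟨z.1, z.2.1⟩ = σ' ⟨z.1, z.2.2⟩
    · obtain ⟨z, hz⟩ := h
      have key := (T2Space.isSeparatedMap q).eq_of_comp_eq (qm_inj (G := G) hπ a) (g₁ := fun z : V => σ ⟨z.1, z.2.1⟩) (g₂ := fun z : V => σ' ⟨z.1, z.2.2⟩)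
        (by fun_prop) (by fun_prop) (funext fun z => (hσ ⟨z.1, z.2.1⟩).trans (hσ' ⟨z.1, z.2.2⟩).symm) z hz
      refine ⟨V, hU.inter hU', hV, ⟨fun z : V => σ ⟨z.1, z.2.1⟩, by fun_prop⟩, fun z => hσ _, ?_⟩
      ext x
      constructor
      · rintro ⟨⟨z, rfl⟩, z', h⟩
        have : z'.1 = z.1 := by rw [← hσ, ← hσ', h]
        exact ⟨⟨z.1, z.2, this ▸ z'.2⟩, rfl⟩
      · rintro ⟨z, rfl⟩
        exact ⟨⟨_, rfl⟩, ⟨_, (congrFun key z).symm⟩⟩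
    · refine ⟨∅, isOpen_empty, convex_empty, ⟨fun z => (z.2 : False).elim, continuous_of_discreteTopology⟩, fun z => (z.2 : False).elim, ?_⟩
      refine Eq.trans ?_ (Set.range_eq_empty _).symm
      rw [Set.eq_empty_iff_forall_notMem]
      rintro _ ⟨⟨z, rfl⟩, z', h'⟩
      have : z'.1 = z.1 := by rw [← hσ, ← hσ', h']
      refine h ⟨⟨z.1, z.2, this ▸ z'.2⟩, h'.symm.trans ?_⟩
      congr 1; exact Subtype.ext this
  · obtain ⟨t, ht⟩ := Uq_cov (F := F) (w := q x) (fun i j h => by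
      by_contra hij
      obtain ⟨g, hg⟩ := (hG _ _).1 (Subtype.ext h)
      exact x.2 j i (Ne.symm hij) g hg.symm) fun i => (π (x.1 i)).2
    choose g hg using fun j => (hG _ _).1 (Subtype.ext (hs' t j ⟨q x, ht⟩))
    exact ⟨(t, g), ⟨q x, ht⟩, Subtype.ext (funext hg)⟩

end
end OC

set_option linter.all false
namespace OC
open Cvx
section

theorem transfer {Y Z Γ : Type} [TopologicalSpace Y] [TopologicalSpace Z] [Group Γ] [Finite Γ] (A : Γ → C(Y, Y)) (hA : ∀ g h, A (g * h) = (A g).comp (A h))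
    (q : C(Y, Z)) (h1 : ∀ n (s : C(Dl (n + 1), Z)), ∃ s' : C(Dl (n + 1), Y), q.comp s' = s)
    (h2 : ∀ n (s s' : C(Dl (n + 1), Y)), q.comp s = q.comp s' → ∃ g, s' = (A g).comp s) {i : ℕ} {x : H i Y} (hx : ∀ g, Hm (A g) i x = x)
    (hq : Hm q i x = 0) : x = 0 := by
  haveI := Fintype.ofFinite Γ
  choose L hL using h1
  obtain ⟨z, rfl⟩ := hk_surj i x
  rw [Hm_hk, hk_eq_zero] at hq
  obtain ⟨e, he⟩ := hq
  let e' : Ch (i + 2) Y := pf (L (i + 1)) e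
  have he' : cm q (i + 2) e' = e := by
    change pf _ (pf _ e) = e
    rw [pf_pf]
    convert pf_id e using 2
    exact congrArg _ (funext fun s => hL _ s)
  let N : ∀ n, Ch n Y →ₗ[ℚ] Ch n Y := fun n => ∑ g, cm (A g) n
  let tr : Ch (i + 1) Z →ₗ[ℚ] Ch (i + 1) Y := N (i + 1) ∘ₗ pf (L i)
  have htr : ∀ c, tr (cm q (i + 1) c) = N (i + 1) c := fun c => by
    have : tr ∘ₗ cm q (i + 1) = N (i + 1) := lext fun s => by
      obtain ⟨g, hg⟩ := h2 i s (L i (q.comp s)) (hL _ _).symm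
      simp only [LinearMap.comp_apply, tr, cm_sg, pf_sg, hg, N, LinearMap.sum_apply]
      refine Fintype.sum_equiv (Equiv.mulRight g) _ _ fun k => ?_
      rw [Equiv.coe_mulRight, hA]; rfl
    exact LinearMap.congr_fun this c
  have hz : N (i + 1) (z.1 - d (i + 1) e') = 0 := by
    rw [← htr, map_sub, ← d_cm, he', he]
    change tr (cm q (i + 1) z.1 - cm q (i + 1) z.1) = 0
    rw [sub_self, map_zero]
  have hN : (Fintype.card Γ : ℚ) • hk i Y z = 0 := by
    have : ∑ g, Hm (A g) i (hk i Y z) = (Fintype.card Γ : ℚ) • hk i Y z := by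
      simp only [hx]; rw [Finset.sum_const, Finset.card_univ, Nat.cast_smul_eq_nsmul]
    rw [← this]
    simp only [Hm_hk]
    rw [← map_sum, hk_eq_zero]
    refine ⟨N (i + 2) e', ?_⟩
    rw [map_sub, sub_eq_zero] at hz
    simp only [N, LinearMap.sum_apply, map_sum, d_cm] at hz ⊢
    rw [← hz, AddSubmonoidClass.coe_finset_sum]
  exact (smul_eq_zero.1 hN).resolve_left (by exact_mod_cast Fintype.card_ne_zero)

instance (n : ℕ) : ContractibleSpace (Dl (n + 1)) := (convex_stdSimplex ℝ (Fin (n + 1))).contractibleSpace ⟨_, (io (n + 1) 0).2⟩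

variable {G X : Type} [Group G] [MulAction G X] [TopologicalSpace X]

theorem wAct_oc {n a : ℕ} (p : (Fin (n - a) → G) × Equiv.Perm (Fin (n - a))) {x : Fin n → X} (hx : ∀ i j, i ≠ j → ∀ g : G, x i ≠ g • x j) :
    ∀ i j, i ≠ j → ∀ g : G, wAct p x i ≠ g • wAct p x j := by
  have key : ∃ (u : Fin n → G) (τ : Fin n → Fin n), Function.Injective τ ∧ ∀ k, wAct p x k = u k • x (τ k) := by
    refine ⟨fun k => if h : (k : ℕ) < n - a then p.1 ⟨k, h⟩ else 1,
      fun k => if h : (k : ℕ) < n - a then Fin.castLE (Nat.sub_le n a) (p.2⁻¹ ⟨(k : ℕ), h⟩) else k, fun i j h => ?_, fun k => ?_⟩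
    · dsimp only at h
      split_ifs at h with h1 h2 h2
      · have := p.2⁻¹.injective (Fin.castLE_injective _ h)
        exact Fin.ext (by simpa using this)
      · exact absurd (h ▸ (p.2⁻¹ ⟨i, h1⟩).2 : (j : ℕ) < n - a) h2
      · exact absurd (h ▸ (p.2⁻¹ ⟨j, h2⟩).2 : (i : ℕ) < n - a) h1
      · exact h
    · unfold wAct
      dsimp only
      split_ifs
      · rfl
      · rw [one_smul]
  obtain ⟨u, τ, hτ, h⟩ := key
  intro i j hij g e
  rw [h, h, smul_smul, ← eq_inv_smul_iff, smul_smul] at e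
  exact hx _ _ (hτ.ne hij) _ e

def wm [ContinuousConstSMul G X] {n a : ℕ} (p : (Fin (n - a) → G) × Equiv.Perm (Fin (n - a))) : C(orbitConfigSp G X n, orbitConfigSp G X n) :=
  ⟨fun x => ⟨wAct p x.1, wAct_oc p x.2⟩, Continuous.subtype_mk (continuous_pi fun k => by
    unfold wAct
    split_ifs
    · exact ((continuous_apply _).comp (oc_val n)).const_smul _
    · exact (continuous_apply _).comp (oc_val n)) _⟩

variable {F : Finset ℂ} {π : X → {z : ℂ // z ∉ (F : Set ℂ)}}

theorem oc_iff (hG : ∀ x y, π x = π y ↔ ∃ g : G, g • x = y) {n : ℕ} (x : Fin n → X) :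
    (∀ i j, i ≠ j → ∀ g : G, x i ≠ g • x j) ↔ Function.Injective fun i => π (x i) := by
  constructor
  · intro h i j e
    by_contra hij
    obtain ⟨g, hg⟩ := (hG _ _).1 e
    exact h j i (Ne.symm hij) g hg.symm
  · intro h i j hij g e
    exact hij (h ((hG _ _).2 ⟨g, e.symm⟩).symm)

noncomputable def sc (G : Type) [Group G] [MulAction G X] (hπ : IsCoveringMap π) (a : ℕ) : Fin (F.card + a) → C(orbitConfigSp G X a, ℂ) :=
  Fin.addCases (fun l => ContinuousMap.const _ (F.equivFin.symm l).1) fun j => ⟨fun x => qm G hπ a x j, by fun_prop⟩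

theorem sc_l (hπ : IsCoveringMap π) (a : ℕ) (l b) : sc G hπ a (Fin.castAdd a l) b = (F.equivFin.symm l).1 := by simp [sc]
theorem sc_r (hπ : IsCoveringMap π) (a : ℕ) (j b) : sc G hπ a (Fin.natAdd F.card j) b = (π (b.1 j)).1 := by simp [sc]; rfl

variable (hG : ∀ x y, π x = π y ↔ ∃ g : G, g • x = y) (hπ : IsCoveringMap π)

theorem sc_inj (hG : ∀ x y, π x = π y ↔ ∃ g : G, g • x = y) (hπ : IsCoveringMap π) (a : ℕ) (b) : Function.Injective fun l => sc G hπ a l b := by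
  intro l l' h
  dsimp only at h
  induction l using Fin.addCases with
  | left l =>
    induction l' using Fin.addCases with
    | left l' => rw [sc_l, sc_l] at h; exact congrArg _ (F.equivFin.symm.injective (Subtype.ext h))
    | right j => rw [sc_l, sc_r] at h; exact absurd (h ▸ (F.equivFin.symm l).2) (π (b.1 j)).2
  | right j =>
    induction l' using Fin.addCases with
    | left l => rw [sc_l, sc_r] at h; exact absurd (h ▸ (F.equivFin.symm l).2) (π (b.1 j)).2
    | right j' => rw [sc_r, sc_r] at h; exact congrArg _ ((oc_iff hG _).1 b.2 (Subtype.ext h))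

theorem Es_iff {a m : ℕ} (b : orbitConfigSp G X a) (z : Fin m → ℂ) : (b, z) ∈ Es (sc G hπ a) m ↔
    Function.Injective z ∧ (∀ k, z k ∉ F) ∧ ∀ k j, z k ≠ (π (b.1 j)).1 := by
  refine and_congr_right fun _ => ⟨fun h => ⟨fun k hk => ?_, fun k j => ?_⟩, fun h k l => ?_⟩
  · refine h k (Fin.castAdd a (F.equivFin ⟨_, hk⟩)) ?_
    rw [sc_l]; simp
  · have := h k (Fin.natAdd _ j)
    rwa [sc_r] at this
  · induction l using Fin.addCases with
    | left l => rw [sc_l]; intro e; refine h.1 k ?_; rw [show z k = _ from e]; exact (F.equivFin.symm l).2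
    | right j => rw [sc_r]; exact h.2 k j

abbrev i1 {n : ℕ} (a : ℕ) (k : Fin (n - a)) : Fin n := Fin.castLE (Nat.sub_le n a) k
abbrev i2 {n a : ℕ} (h : a ≤ n) (j : Fin a) : Fin n := ⟨n - a + j, by omega⟩

theorem i_cases {n a : ℕ} (h : a ≤ n) (k : Fin n) : (∃ j, k = i1 a j) ∨ ∃ j, k = i2 h j := by
  by_cases hk : (k : ℕ) < n - a
  · exact Or.inl ⟨⟨k, hk⟩, rfl⟩
  · exact Or.inr ⟨⟨k - (n - a), by omega⟩, Fin.ext (by simp; omega)⟩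

theorem wAct1 {n a : ℕ} (p : (Fin (n - a) → G) × Equiv.Perm (Fin (n - a))) (x : Fin n → X) (k : Fin (n - a)) :
    wAct p x (i1 a k) = p.1 k • x (i1 a (p.2⁻¹ k)) := dif_pos k.2

theorem wAct2 {n a : ℕ} (h : a ≤ n) (p : (Fin (n - a) → G) × Equiv.Perm (Fin (n - a))) (x : Fin n → X) (j : Fin a) :
    wAct p x (i2 h j) = x (i2 h j) := dif_neg (by simp)

theorem hGi (hG : ∀ x y, π x = π y ↔ ∃ g : G, g • x = y) (g : G) (x : X) : π (g • x) = π x := ((hG _ _).2 ⟨g, rfl⟩).symm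

def qh (hG : ∀ x y, π x = π y ↔ ∃ g : G, g • x = y) (hπ : IsCoveringMap π) {n a : ℕ} (h : a ≤ n) :
    C(orbitConfigSp G X n, Es (sc G hπ a) (n - a)) :=
  ⟨fun x => ⟨(⟨fun j => x.1 (i2 h j), fun i j hij => x.2 _ _ fun e => hij (Fin.ext (by simpa using e))⟩, fun k => (π (x.1 (i1 a k))).1),
    (Es_iff hπ _ _).2 (by
      have hi := (oc_iff hG _).1 x.2
      refine ⟨fun k k' e => Fin.castLE_injective _ (hi (Subtype.ext e)), fun k => (π _).2, fun k j e => ?_⟩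
      have := congrArg Fin.val (hi (Subtype.ext e))
      have h2 := k.2
      simp at this
      omega)⟩, by
    refine Continuous.subtype_mk (Continuous.prodMk (Continuous.subtype_mk (continuous_pi fun j => (continuous_apply _).comp (oc_val n)) _)
      (continuous_pi fun k => continuous_subtype_val.comp (hπ.continuous.comp ((continuous_apply _).comp (oc_val n))))) _⟩

theorem inv_zero [Finite G] [T2Space X] [ContinuousConstSMul G X] (hG : ∀ x y, π x = π y ↔ ∃ g : G, g • x = y) (hπ : IsCoveringMap π)
    (hs : Function.Surjective π) {n a : ℕ} (h : a ≤ n) {i : ℕ} {x : H i (orbitConfigSp G X n)}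
    (hx : ∀ p : (Fin (n - a) → G) × Equiv.Perm (Fin (n - a)), Hm (wm p) i x = x) (hc : cl (sc G hπ a) (n - a) i (Hm (qh hG hπ h) i x) = 0) : x = 0 := by
  have h0 : Hm (qh hG hπ h) i x = 0 := by
    have e := Nm_Iq hc
    have hp : ∀ γ, Hm (pm (sc G hπ a) γ) i (Hm (qh hG hπ h) i x) = Hm (qh hG hπ h) i x := fun γ => by
      conv_rhs => rw [← hx (1, γ⁻¹)]
      rw [Hm_comp, Hm_comp]
      congr 2
      ext y : 1
      refine Subtype.ext (Prod.ext (Subtype.ext (funext fun j => (wAct2 h _ _ j).symm)) (funext fun k => ?_))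
      change (π (y.1 (i1 a (γ k)))).1 = (π (wAct (1, γ⁻¹) y.1 (i1 a k))).1
      rw [wAct1]; simp
    rw [Nm, LinearMap.sum_apply, Finset.sum_congr rfl fun γ _ => hp γ, Finset.sum_const, Finset.card_univ, ← Nat.cast_smul_eq_nsmul ℚ] at e
    exact (smul_eq_zero.1 e).resolve_left (by exact_mod_cast Fintype.card_ne_zero)
  refine transfer (Γ := Fin (n - a) → G) (fun g => wm (g, 1)) (fun g g' => ?_) (qh hG hπ h) (fun l s => ?_) (fun l s s' e => ?_) (fun g => hx (g, 1)) h0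
  · ext y : 1
    refine Subtype.ext (funext fun k => ?_)
    change wAct _ y.1 k = wAct (g, 1) (wAct (g', 1) y.1) k
    obtain ⟨j, rfl⟩ | ⟨j, rfl⟩ := i_cases h k
    · simp only [wAct1, inv_one, Equiv.Perm.one_apply, smul_smul]; rfl
    · simp only [wAct2 h]
  · have hE := fun t => (Es_iff hπ (s t).1.1 (s t).1.2).1 (s t).2
    choose u hu using fun k => lift_ex hπ hs (⟨fun t => ⟨(s t).1.2 k, (hE t).2.1 k⟩, Continuous.subtype_mk (by fun_prop) _⟩ :
      C(Dl (l + 1), {z : ℂ // z ∉ (F : Set ℂ)}))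
    have hu' : ∀ k t, (π (u k t)).1 = (s t).1.2 k := fun k t => congrArg Subtype.val (hu k t)
    let v : Fin n → C(Dl (l + 1), X) := fun k => if hk : (k : ℕ) < n - a then u ⟨k, hk⟩ else
      ⟨fun t => (s t).1.1.1 ⟨k - (n - a), by omega⟩, (continuous_apply (⟨k - (n - a), by omega⟩ : Fin a)).comp ((oc_val a).comp (continuous_fst.comp (continuous_subtype_val.comp s.continuous)))⟩
    have v1 : ∀ k, v (i1 a k) = u k := fun k => dif_pos k.2
    have v2 : ∀ j t, v (i2 h j) t = (s t).1.1.1 j := fun j t => by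
      have : v (i2 h j) = _ := dif_neg (by simp)
      rw [this]
      change (s t).1.1.1 _ = _
      exact congrArg _ (Fin.ext (Nat.add_sub_cancel_left _ _))
    refine ⟨⟨fun t => ⟨fun k => v k t, (oc_iff hG _).2 fun k k' e => ?_⟩, Continuous.subtype_mk (continuous_pi fun k => (v k).continuous) _⟩, ?_⟩
    · have e := congrArg Subtype.val e
      dsimp only at e
      obtain ⟨j, rfl⟩ | ⟨j, rfl⟩ := i_cases h k <;> obtain ⟨j', rfl⟩ | ⟨j', rfl⟩ := i_cases h k'
      · rw [v1, v1, hu', hu'] at e; rw [(hE t).1 e]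
      · rw [v1, v2, hu'] at e; exact absurd e ((hE t).2.2 _ _)
      · rw [v1, v2, hu'] at e; exact absurd e.symm ((hE t).2.2 _ _)
      · rw [v2, v2] at e; rw [(oc_iff hG _).1 (s t).1.1.2 (Subtype.ext e)]
    · ext t : 1
      refine Subtype.ext (Prod.ext (Subtype.ext (funext fun j => v2 j t)) (funext fun k => ?_))
      refine Eq.trans ?_ (hu' k t)
      change (π (v (i1 a k) t)).1 = _
      rw [v1]
  · have e' := fun t => congrArg Subtype.val (ContinuousMap.congr_fun e t)
    have e1 : ∀ t j, (s t).1 (i2 h j) = (s' t).1 (i2 h j) := fun t j => congrFun (congrArg (fun p => p.1.1) (e' t)) j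
    have e2 : ∀ t k, π ((s t).1 (i1 a k)) = π ((s' t).1 (i1 a k)) := fun t k => Subtype.ext (congrFun (congrArg (fun p => p.2) (e' t)) k)
    let t0 := io (l + 1) 0
    choose g hg using fun k => (hG _ _).1 (e2 t0 k)
    refine ⟨g, ?_⟩
    ext t : 1
    refine Subtype.ext (funext fun k => ?_)
    change (s' t).1 k = wAct (g, 1) (s t).1 k
    obtain ⟨j, rfl⟩ | ⟨j, rfl⟩ := i_cases h k
    · rw [wAct1]
      refine congrFun (hπ.eq_of_comp_eq (g₁ := fun t => (s' t).1 (i1 a j)) (g₂ := fun t => g j • (s t).1 (i1 a j))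
        ((continuous_apply _).comp ((oc_val n).comp s'.continuous)) (((continuous_apply _).comp ((oc_val n).comp s.continuous)).const_smul _)
        (funext fun t => ?_) t0 (hg j).symm) t
      simp only [Function.comp_apply, hGi hG, e2]
    · rw [wAct2 h, e1]

theorem inv_bound [Finite G] [T2Space X] [ContinuousConstSMul G X] (hG : ∀ x y, π x = π y ↔ ∃ g : G, g • x = y) (hπ : IsCoveringMap π)
    (hs : Function.Surjective π) (a : ℕ) : ∃ K : ℕ, ∀ n, a ≤ n → ∀ i (V : Submodule ℚ (H i (orbitConfigSp G X n))),
      (∀ x ∈ V, ∀ p : (Fin (n - a) → G) × Equiv.Perm (Fin (n - a)), Hm (wm p) i x = x) →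
      Module.rank ℚ V ≤ (K * (i + 1) ^ (F.card + a - 1) : ℕ) := by
  obtain ⟨C, N, hC, hN⟩ := B_fin (G := G) hπ hs hG a
  obtain ⟨K, hK⟩ := HQ_bound hC hN (F.card + a)
  refine ⟨K, fun n h i V hV => le_trans ?_ (hK (sc G hπ a) (sc_inj hG hπ a) (n - a) i)⟩
  refine LinearMap.rank_le_of_injective (cl (sc G hπ a) (n - a) i ∘ₗ Hm (qh hG hπ h) i ∘ₗ V.subtype)
    ((injective_iff_map_eq_zero _).2 fun x hx => Subtype.ext ?_)
  exact inv_zero hG hπ hs h (hV x.1 x.2) hx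

end
end OC

set_option linter.all false
open CategoryTheory AlgebraicTopology
namespace OC
open Cvx
section

noncomputable abbrev MF : TopCat.{0} ⥤ ChainComplex (ModuleCat.{0} ℚ) ℕ :=
  TopCat.toSSet ⋙ ((SimplicialObject.whiskering _ _).obj (ModuleCat.free ℚ)) ⋙ alternatingFaceMapComplex _

noncomputable def sx (Y : TopCat.{0}) (n : ℕ) : (TopCat.toSSet.obj Y).obj (Opposite.op (SimplexCategory.mk n)) ≃ C(Dl (n + 1), Y) :=
  TopCat.toSSetObjEquiv Y (Opposite.op (SimplexCategory.mk n))

noncomputable def ex (Y : TopCat.{0}) (n : ℕ) : (MF.obj Y).X n ⟶ ModuleCat.of ℚ (Ch (n + 1) Y) :=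
  ModuleCat.ofHom (pf (sx Y n))

theorem ex_bij (Y : TopCat.{0}) (n : ℕ) : Function.Bijective (ex Y n) :=
  ⟨Finsupp.mapDomain_injective (sx Y n).injective, fun c => ⟨pf (sx Y n).symm c, by
    change pf _ (pf _ c) = c
    rw [pf_pf, Equiv.self_comp_symm, pf_id]⟩⟩

theorem ex_sg (Y : TopCat.{0}) (n : ℕ) (x) : ex Y n (ModuleCat.freeMk x) = sg (sx Y n x) := pf_sg _ _

theorem aff_map {m n : ℕ} (f : Fin m → Fin n) (t : Dl m) : aff (fun i => io n (f i)) t = stdSimplex.map f t := by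
  refine Subtype.ext (funext fun k => ?_)
  refine (affD_apply _ t k).trans ?_
  change _ = (stdSimplex.map f t) k
  rw [stdSimplex.map_coe]
  simp [FunOnFinite.linearMap_apply_apply, io, Finset.sum_filter, Pi.single_apply, eq_comm]

theorem d_sg {Y : Type} [TopologicalSpace Y] (n : ℕ) (s : C(Dl (n + 1), Y)) :
    d n (sg s) = ∑ j : Fin (n + 1), ((-1 : ℚ) ^ (j : ℕ)) • sg (s.comp (aff (fun i => io (n + 1) (j.succAbove i)))) := by
  rw [d, sing_sg, lb_sg]
  simp only [map_sum, map_smul, rl_sg, cm_sg]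
  rfl

theorem ex_map {Y Z : TopCat.{0}} (f : Y ⟶ Z) (n : ℕ) (c) : ex Z n ((MF.map f).f n c) = cm f.hom (n + 1) (ex Y n c) := by
  have : (MF.map f).f n ≫ ex Z n = ex Y n ≫ ModuleCat.ofHom (cm f.hom (n + 1)) := ModuleCat.free_hom_ext fun x => by
    change ex Z n ((MF.map f).f n (ModuleCat.freeMk x)) = cm f.hom (n + 1) (ex Y n (ModuleCat.freeMk x))
    rw [ex_sg, cm_sg]
    have : (MF.map f).f n (ModuleCat.freeMk x) = ModuleCat.freeMk ((TopCat.toSSet.map f).app _ x) := ModuleCat.free_map_apply _ _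
    rw [this, ex_sg]
    rfl
  exact ConcreteCategory.congr_hom this c

theorem hsum {A B : ModuleCat.{0} ℚ} {m : ℕ} (e : Fin m → ℤ) (f : Fin m → (A ⟶ B)) (v : A) :
    (∑ j, e j • f j) v = ∑ j, e j • f j v := by
  change (∑ j, e j • f j).hom v = _
  rw [ModuleCat.hom_sum, LinearMap.sum_apply]
  rfl

theorem ex_d (Y : TopCat.{0}) (n : ℕ) (c) : ex Y n ((MF.obj Y).d (n + 1) n c) = d (n + 1) (ex Y (n + 1) c) := by
  have : (MF.obj Y).d (n + 1) n ≫ ex Y n = ex Y (n + 1) ≫ ModuleCat.ofHom (d (n + 1)) := ModuleCat.free_hom_ext fun x => by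
    change ex Y n ((MF.obj Y).d (n + 1) n (ModuleCat.freeMk x)) = d (n + 1) (ex Y (n + 1) (ModuleCat.freeMk x))
    rw [ex_sg, d_sg]
    have : (MF.obj Y).d (n + 1) n (ModuleCat.freeMk x) = ∑ j : Fin (n + 2), (-1 : ℤ) ^ (j : ℕ) •
        (ModuleCat.freeMk ((TopCat.toSSet.obj Y).δ j x) : (MF.obj Y).X n) := by
      refine (ConcreteCategory.congr_hom (AlternatingFaceMapComplex.obj_d_eq _ n) _).trans ?_
      refine (hsum _ _ _).trans (Finset.sum_congr rfl fun j _ => ?_)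
      exact congrArg _ (ModuleCat.free_map_apply _ _)
    rw [this]
    refine (map_sum (ex Y n).hom _ _).trans (Finset.sum_congr rfl fun j _ => ?_)
    refine (map_zsmul (ex Y n).hom _ _).trans ?_
    rw [← Int.cast_smul_eq_zsmul ℚ]
    push_cast
    congr 1
    refine (ex_sg _ _ _).trans (congrArg sg ?_)
    ext t
    rw [ContinuousMap.comp_apply, aff_map]
    rfl
  exact ConcreteCategory.congr_hom this c

noncomputable def kz (Y : TopCat.{0}) (i : ℕ) : (MF.obj Y).cycles i ⟶ ModuleCat.of ℚ (H i Y) :=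
  ModuleCat.ofHom (hk i Y ∘ₗ LinearMap.codRestrict (Zc i Y) ((MF.obj Y).iCycles i ≫ ex Y i).hom fun z => by
    rcases i with _ | i
    · exact Or.inl rfl
    · refine Zc_of ?_
      change d (i + 1) (ex Y (i + 1) ((MF.obj Y).iCycles (i + 1) z)) = 0
      rw [← ex_d]
      have := ConcreteCategory.congr_hom ((MF.obj Y).iCycles_d (i + 1) i) z
      erw [this]
      exact map_zero (ex Y i).hom)

theorem kz_zero (Y : TopCat.{0}) (i : ℕ) (z) : kz Y i z = 0 ↔ ∃ c, z = (MF.obj Y).toCycles (i + 1) i c := by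
  have hj : Function.Injective ((MF.obj Y).iCycles i) := (ModuleCat.mono_iff_injective _).1 inferInstance
  have hc : ∀ c, (MF.obj Y).iCycles i ((MF.obj Y).toCycles (i + 1) i c) = (MF.obj Y).d (i + 1) i c :=
    fun c => ConcreteCategory.congr_hom ((MF.obj Y).toCycles_i (i + 1) i) c
  refine (hk_eq_zero _).trans ⟨?_, ?_⟩
  · rintro ⟨e, he⟩
    obtain ⟨c, rfl⟩ := (ex_bij Y (i + 1)).2 e
    rw [← ex_d] at he
    refine ⟨c, hj ?_⟩
    rw [hc]
    exact (ex_bij Y i).1 he.symm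
  · rintro ⟨c, rfl⟩
    refine ⟨ex Y (i + 1) c, ?_⟩
    rw [← ex_d, ← hc]; rfl

noncomputable def Ph (Y : TopCat.{0}) (i : ℕ) : (MF.obj Y).homology i ⟶ ModuleCat.of ℚ (H i Y) :=
  ((MF.obj Y).homologyIsCokernel (i + 1) i (by simp)).desc (Limits.CokernelCofork.ofπ (kz Y i) (by
    ext c
    exact (kz_zero _ _ _).2 ⟨c, rfl⟩))

theorem Ph_pi (Y : TopCat.{0}) (i : ℕ) (z) : Ph Y i ((MF.obj Y).homologyπ i z) = kz Y i z :=
  ConcreteCategory.congr_hom (((MF.obj Y).homologyIsCokernel (i + 1) i (by simp)).fac (Limits.CokernelCofork.ofπ (kz Y i) _) Limits.WalkingParallelPair.one) z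

theorem pi_surj (Y : TopCat.{0}) (i : ℕ) : Function.Surjective ((MF.obj Y).homologyπ i) := (ModuleCat.epi_iff_surjective _).1 inferInstance

theorem Ph_inj (Y : TopCat.{0}) (i : ℕ) : Function.Injective (Ph Y i) := by
  refine (injective_iff_map_eq_zero (Ph Y i).hom).2 fun x hx => ?_
  obtain ⟨z, rfl⟩ := pi_surj Y i x
  obtain ⟨c, rfl⟩ := (kz_zero Y i z).1 ((Ph_pi Y i z).symm.trans hx)
  exact ConcreteCategory.congr_hom ((MF.obj Y).toCycles_comp_homologyπ (i + 1) i) c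

theorem Ph_nat {Y Z : TopCat.{0}} (f : Y ⟶ Z) (i : ℕ) (x) :
    Ph Z i ((singularHomologyFunctor i).map f x) = Hm f.hom i (Ph Y i x) := by
  obtain ⟨z, rfl⟩ := pi_surj Y i x
  have h1 : (singularHomologyFunctor i).map f ((MF.obj Y).homologyπ i z) = (MF.obj Z).homologyπ i (HomologicalComplex.cyclesMap (MF.map f) i z) :=
    ConcreteCategory.congr_hom (HomologicalComplex.homologyπ_naturality (MF.map f) i) z
  have h2 : (MF.obj Z).iCycles i (HomologicalComplex.cyclesMap (MF.map f) i z) = (MF.map f).f i ((MF.obj Y).iCycles i z) :=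
    ConcreteCategory.congr_hom (HomologicalComplex.cyclesMap_i (MF.map f) i) z
  rw [Ph_pi]
  refine (congrArg _ h1).trans ((Ph_pi Z i _).trans ?_)
  refine Eq.trans ?_ (Hm_hk f.hom i _).symm
  change hk i Z _ = _
  congr 1
  refine Subtype.ext ?_
  change ex Z i ((MF.obj Z).iCycles i _) = cm f.hom (i + 1) (ex Y i ((MF.obj Y).iCycles i z))
  rw [h2, ex_map]

variable {G X : Type} [Group G] [MulAction G X] [TopologicalSpace X] [ContinuousConstSMul G X]

theorem fin_bound {n a i N : ℕ}
    (h : ∀ V : Submodule ℚ (H i (orbitConfigSp G X n)), (∀ x ∈ V, ∀ p : (Fin (n - a) → G) × Equiv.Perm (Fin (n - a)), Hm (wm p) i x = x) → Module.rank ℚ V ≤ (N : ℕ)) :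
    Module.finrank ℚ
        ↥(⨅ (p : (Fin (n - a) → G) × Equiv.Perm (Fin (n - a)))
            (f : TopCat.of (orbitConfigSp G X n) ⟶ TopCat.of (orbitConfigSp G X n))
            (_ : ∀ x, (f x).1 = wAct p x.1),
            LinearMap.ker (((singularHomologyFunctor i).map f).hom - LinearMap.id)) ≤ N := by
  set W := (⨅ (p : (Fin (n - a) → G) × Equiv.Perm (Fin (n - a)))
            (f : TopCat.of (orbitConfigSp G X n) ⟶ TopCat.of (orbitConfigSp G X n))
            (_ : ∀ x, (f x).1 = wAct p x.1),
            LinearMap.ker (((singularHomologyFunctor i).map f).hom - LinearMap.id)) with hW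
  let e : (singularHomologyFunctor i).obj (TopCat.of (orbitConfigSp G X n)) →ₗ[ℚ] H i (orbitConfigSp G X n) :=
    (Ph (TopCat.of (orbitConfigSp G X n)) i).hom
  have he : Function.Injective e := Ph_inj _ i
  have h1 := h (W.map e) (by
    rintro _ ⟨w, hw, rfl⟩ p
    have := (Submodule.mem_iInf _).1 ((Submodule.mem_iInf _).1 ((Submodule.mem_iInf _).1 hw p) (TopCat.ofHom (wm p))) fun _ => rfl
    have h2 : ((singularHomologyFunctor i).map (TopCat.ofHom (wm p))) w = w := sub_eq_zero.1 this
    exact (Ph_nat (TopCat.ofHom (wm p)) i w).symm.trans (congrArg e h2))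
  have h2 : Module.rank ℚ W ≤ (N : ℕ) := ((Submodule.equivMapOfInjective e he W).rank_eq).trans_le h1
  exact Module.finrank_le_of_rank_le h2

end
end OC

set_option linter.all false
open CategoryTheory AlgebraicTopology
/-- Let `G` be a finite group acting freely by homeomorphisms on a
Hausdorff space `X` with `X → X/G` a covering map and `X/G` homeomorphic to `ℂ ∖ F`
for a finite `F ⊆ ℂ`.  Let `W_{n−a}` act on `Conf^G_n(X)` through the first `n − a`
coordinates.  Then for every `a` the `W_{n−a}`-action induces maps on
`H_i(Conf^G_n(X); ℚ)`, and there is a real polynomial `p` bounding the dimension of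
the subspace fixed by all these induced maps by `p(i)`, for all `n ≥ a` and all `i`;
in fact there is a constant `C` bounding this dimension by `C · (1+i)^{|F|+a−1}`
whenever `|F| + a ≥ 1`. -/
theorem stmt_5 (G X : Type) [Group G] [Finite G] [MulAction G X]
    [TopologicalSpace X] [T2Space X] [ContinuousConstSMul G X]
    (hfree : ∀ (g : G) (x : X), g • x = x → g = 1)
    (hcov : IsCoveringMap (Quotient.mk (MulAction.orbitRel G X)))
    (F : Finset ℂ)
    (homeo : Quotient (MulAction.orbitRel G X) ≃ₜ {z : ℂ // z ∉ (F : Set ℂ)})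
    (a : ℕ) :
    -- every element of `W_{n−a}` induces a (continuous, hence homology-functorial)
    -- self-map of `Conf^G_n(X)`
    (∀ (n : ℕ) (p : (Fin (n - a) → G) × Equiv.Perm (Fin (n - a))),
      ∃ f : TopCat.of (orbitConfigSp G X n) ⟶ TopCat.of (orbitConfigSp G X n),
        ∀ x, (f x).1 = wAct p x.1) ∧
    -- polynomial bound on the dimension of the subspace of `H_i` fixed by all the
    -- induced maps
    (∃ P : Polynomial ℝ, ∀ n, a ≤ n → ∀ i : ℕ,
      (Module.finrank ℚ
        ↥(⨅ (p : (Fin (n - a) → G) × Equiv.Perm (Fin (n - a)))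
            (f : TopCat.of (orbitConfigSp G X n) ⟶ TopCat.of (orbitConfigSp G X n))
            (_ : ∀ x, (f x).1 = wAct p x.1),
            LinearMap.ker (((singularHomologyFunctor i).map f).hom - LinearMap.id)) : ℝ)
        ≤ P.eval (i : ℝ)) ∧
    (1 ≤ F.card + a → ∃ C : ℝ, ∀ n, a ≤ n → ∀ i : ℕ,
      (Module.finrank ℚ
        ↥(⨅ (p : (Fin (n - a) → G) × Equiv.Perm (Fin (n - a)))
            (f : TopCat.of (orbitConfigSp G X n) ⟶ TopCat.of (orbitConfigSp G X n))
            (_ : ∀ x, (f x).1 = wAct p x.1),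
            LinearMap.ker (((singularHomologyFunctor i).map f).hom - LinearMap.id)) : ℝ)
        ≤ C * (1 + (i : ℝ)) ^ (F.card + a - 1)) := by
  have hpi : IsCoveringMap (homeo ∘ Quotient.mk (MulAction.orbitRel G X)) := hcov.homeomorph_comp homeo
  obtain ⟨K, hK⟩ := OC.inv_bound (G := G) (X := X) (F := F) (π := homeo ∘ Quotient.mk (MulAction.orbitRel G X))
    (fun x y => by
      rw [Function.comp_apply, Function.comp_apply, homeo.injective.eq_iff, Quotient.eq]
      exact ⟨fun h => (MulAction.orbitRel G X).symm h, fun h => (MulAction.orbitRel G X).symm h⟩)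
    hpi (homeo.surjective.comp Quotient.mk_surjective) a
  have key := fun n (hn : a ≤ n) (i : ℕ) => OC.fin_bound (hK n hn i)
  refine ⟨fun n p => ⟨TopCat.ofHom (OC.wm p), fun _ => rfl⟩,
    ⟨Polynomial.C (K : ℝ) * (1 + Polynomial.X) ^ (F.card + a - 1), fun n hn i => ?_⟩, fun _ => ⟨K, fun n hn i => ?_⟩⟩
  · refine (Nat.cast_le.2 (key n hn i)).trans (le_of_eq ?_)
    simp [add_comm]
  · refine (Nat.cast_le.2 (key n hn i)).trans (le_of_eq ?_)
    simp [add_comm]
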